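/- arXiv:2201.08232 — 4 statements merged into one kernel-verified Lean document; each statement's English description precedes it below -/
import Mathlib

section
/- (Volume Pohozaev term coming from the regular part.) For all constants δ₀, κ₁, κ₀, R, K > 0 with κ₁ ≤ κ₀ there exist C > 0 and ε₀ > 0 with the following property. Let ε ∈ (0, ε₀], z = (z₁, 0) with δ₀ ≤ z₁ ≤ 1/δ₀, and let A ⊆ B_{Rε}(z) be a measurable set with κ := ε^{−2} ∫_A x₁ dx ∈ [κ₁, κ₀]; set s₀ := ε √(κ/(π z₁)) and assume the Lebesgue measure e of the symmetric difference A Δ B_{s₀}(z) satisfies e ≤ K ε. Then | (z₁²/ε⁴) ∫_A ∫_A (∂H_{z₁}/∂x₁)(x, x') dx' dx − (κ² z₁/(4π)) (ln(8 z₁/s₀) − 5/4) | ≤ C (e/ε² + ε² ln(1/ε)), where the derivative ∂H_{z₁}/∂x₁ is taken in the first coordinate of the first variable. -/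
open MeasureTheory Real Filter
open scoped RealInnerProductSpace

noncomputable section

/-- The plane `ℝ²` with the Euclidean norm. -/
abbrev Plane : Type := EuclideanSpace ℝ (Fin 2)

/-- The point `(a, b)` of the plane. -/
def mk2 (a b : ℝ) : Plane := (WithLp.equiv 2 (Fin 2 → ℝ)).symm ![a, b]

/-- The open right half plane `Π = {x : x₁ > 0}`. -/
def halfPlane : Set Plane := {x : Plane | 0 < x 0}

/-- The reflection `x̄ = (−x₁, x₂)` of a point `x = (x₁, x₂)`. -/
def reflPt (x : Plane) : Plane := mk2 (-(x 0)) (x 1)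

/-- The Green function `G_*` on the half plane of the operator `−(1/x₁)div((1/x₁)∇)`. -/
def Gstar (x x' : Plane) : ℝ :=
  x 0 * (x' 0) ^ 2 / (4 * π) *
    ∫ θ in (-π)..π, Real.cos θ /
      Real.sqrt ((x 1 - x' 1) ^ 2 + (x 0) ^ 2 + (x' 0) ^ 2 - 2 * x 0 * x' 0 * Real.cos θ)

/-- The Green function of `−Δ` on the half plane. -/
def Gfun (x x' : Plane) : ℝ :=
  (1 / (4 * π)) * Real.log
    (((x 0 + x' 0) ^ 2 + (x 1 - x' 1) ^ 2) / ((x 0 - x' 0) ^ 2 + (x 1 - x' 1) ^ 2))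

/-- The regular part `H_c(x,x') = G_*(x,x') − c² G(x,x')`. -/
def Hker (c : ℝ) (x x' : Plane) : ℝ := Gstar x x' - c ^ 2 * Gfun x x'

/-- The regular part `H_c`, extended continuously to the diagonal. -/
def HkerExt (c : ℝ) (x x' : Plane) : ℝ := by
  classical
  exact if x = x' then limUnder (nhdsWithin x' {x'}ᶜ) (fun y => Hker c y x')
    else Hker c x x'

/-- The cross-section `A = {x ∈ Π : ψ(x) − (W/2) x₁² ln(1/ε) > μ}`. -/
def crossSection (ψ : Plane → ℝ) (ε W μ : ℝ) : Set Plane :=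
  {x : Plane | x ∈ halfPlane ∧ μ < ψ x - W / 2 * (x 0) ^ 2 * Real.log (1 / ε)}

/-- `ψ` is a stream function of a steady vortex ring with parameters `(ε, W, μ)`. -/
structure IsVortexRingStream (ψ : Plane → ℝ) (ε W μ : ℝ) : Prop where
  continuousOn : ContinuousOn ψ halfPlane
  bounded : Bornology.IsBounded (crossSection ψ ε W μ)
  closure_subset : closure (crossSection ψ ε W μ) ⊆ halfPlane
  repr : ∀ x ∈ halfPlane, ψ x = (∫ x' in crossSection ψ ε W μ, Gstar x x') / ε ^ 2

/-- The circulation `ε⁻² ∫_A x₁ dx` of a vortex ring. -/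
def circulation (ψ : Plane → ℝ) (ε W μ : ℝ) : ℝ :=
  (∫ x in crossSection ψ ε W μ, x 0) / ε ^ 2

/-- `ψ` is centralized: it is even in the second variable. -/
def Centralized (ψ : Plane → ℝ) : Prop :=
  ∀ a b : ℝ, ψ (mk2 a (-b)) = ψ (mk2 a b)

/-- The profile function of the Green function `G_*` in the variable `t = |x - x'|² / (4 x₁ x₁')`. -/
def ringProfile (t : ℝ) : ℝ :=
  ∫ φ in (0)..(π / 2), (1 - 2 * sin φ ^ 2) / √(sin φ ^ 2 + t)

/-- The derivative of `ringProfile`. -/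
def ringProfileDeriv (t : ℝ) : ℝ :=
  ∫ φ in (0)..(π / 2), -(1 - 2 * sin φ ^ 2) / (2 * (sin φ ^ 2 + t) * √(sin φ ^ 2 + t))

lemma sin_sq_add_pos {t : ℝ} (ht : 0 < t) (φ : ℝ) : 0 < sin φ ^ 2 + t := by positivity

lemma continuous_div_sqrt_sin_sq_add {t : ℝ} (ht : 0 < t) {f : ℝ → ℝ} (hf : Continuous f) :
    Continuous fun φ => f φ / √(sin φ ^ 2 + t) := by
  have h := fun φ => (sqrt_pos.2 (sin_sq_add_pos ht φ)).ne'
  fun_prop (disch := exact h _)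

lemma continuous_div_mul_sqrt_sin_sq_add {t : ℝ} (ht : 0 < t) {f : ℝ → ℝ} (hf : Continuous f) :
    Continuous fun φ => f φ / ((sin φ ^ 2 + t) * √(sin φ ^ 2 + t)) := by
  have h := fun φ => (mul_pos (sin_sq_add_pos ht φ) (sqrt_pos.2 (sin_sq_add_pos ht φ))).ne'
  fun_prop (disch := exact h _)

lemma hasDerivAt_ringProfile {t : ℝ} (ht : 0 < t) :
    HasDerivAt ringProfile (ringProfileDeriv t) t := by
  have hs : Set.Ioi (t / 2) ∈ nhds t := Ioi_mem_nhds (by linarith)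
  refine (intervalIntegral.hasDerivAt_integral_of_dominated_loc_of_deriv_le (𝕜 := ℝ) (E := ℝ)
    (F := fun t φ => (1 - 2 * sin φ ^ 2) / √(sin φ ^ 2 + t))
    (F' := fun t φ => -(1 - 2 * sin φ ^ 2) / (2 * (sin φ ^ 2 + t) * √(sin φ ^ 2 + t)))
    (bound := fun _ => 1 / (2 * (t / 2) * √(t / 2))) hs ?_ ?_ ?_ ?_ ?_ ?_).2
  · filter_upwards [hs] with s hs
    exact (continuous_div_sqrt_sin_sq_add (lt_trans (half_pos ht) hs)
      (by fun_prop)).aestronglyMeasurable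
  · exact (continuous_div_sqrt_sin_sq_add ht (by fun_prop)).intervalIntegrable _ _
  · have := (continuous_div_mul_sqrt_sin_sq_add ht
      (f := fun φ => -(1 - 2 * sin φ ^ 2) / 2) (by fun_prop))
    refine Continuous.aestronglyMeasurable ?_
    convert this using 2 with φ
    rw [div_div]; ring_nf
  · refine Eventually.of_forall fun φ _ s hs => ?_
    have hs' : t / 2 < s := hs
    have h1 : t / 2 ≤ sin φ ^ 2 + s := by nlinarith [sq_nonneg (sin φ)]
    rw [norm_div, Real.norm_eq_abs, Real.norm_eq_abs]
    have h2 : |-(1 - 2 * sin φ ^ 2)| ≤ 1 := by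
      rw [abs_le]; constructor <;> nlinarith [sin_sq_add_cos_sq φ, sq_nonneg (cos φ), sq_nonneg (sin φ)]
    have h3 : 0 < t / 2 := by linarith
    rw [abs_of_pos (a := 2 * (sin φ ^ 2 + s) * √(sin φ ^ 2 + s)) (by
      have : 0 < sin φ ^ 2 + s := by linarith
      positivity)]
    gcongr
    linarith
  · simp
  · refine Eventually.of_forall fun φ _ s hs => ?_
    have hp : 0 < sin φ ^ 2 + s := by nlinarith [sq_nonneg (sin φ), Set.mem_Ioi.1 hs]
    have h1 : HasDerivAt (fun s => √(sin φ ^ 2 + s)) (1 / (2 * √(sin φ ^ 2 + s))) s := by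
      simpa using ((hasDerivAt_id s).const_add (sin φ ^ 2)).sqrt hp.ne'
    refine ((hasDerivAt_const s (1 - 2 * sin φ ^ 2)).div h1 (sqrt_pos.2 hp).ne').congr_deriv ?_
    rw [Real.sq_sqrt hp.le]
    field_simp
    ring

lemma integral_cos_div_sqrt {t : ℝ} (ht : 0 < t) :
    ∫ φ in (0)..(π / 2), cos φ / √(sin φ ^ 2 + t) = log (1 + √(1 + t)) - log t / 2 := by
  rw [intervalIntegral.integral_eq_sub_of_hasDerivAt
    (f := fun φ => log (sin φ + √(sin φ ^ 2 + t)))]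
  · simp [log_sqrt ht.le]
  · intro φ _
    have hp := sin_sq_add_pos ht φ
    have hq := sqrt_pos.2 hp
    have h1 : HasDerivAt (fun φ => √(sin φ ^ 2 + t)) (2 * sin φ * cos φ / (2 * √(sin φ ^ 2 + t))) φ := by
      have := ((((hasDerivAt_sin φ).pow 2).add_const t)).sqrt hp.ne'
      simpa using this
    have h3 : 0 < sin φ + √(sin φ ^ 2 + t) := by
      have : |sin φ| < √(sin φ ^ 2 + t) := by
        rw [← Real.sqrt_sq_eq_abs]; exact Real.sqrt_lt_sqrt (sq_nonneg _) (by linarith)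
      linarith [neg_abs_le (sin φ)]
    refine (((hasDerivAt_sin φ).add h1).log h3.ne').congr_deriv ?_
    simp only [Pi.add_apply]
    field_simp
    ring
  · exact (continuous_div_sqrt_sin_sq_add ht continuous_cos).intervalIntegrable _ _

lemma integral_cos_div_mul_sqrt {t : ℝ} (ht : 0 < t) :
    ∫ φ in (0)..(π / 2), cos φ / ((sin φ ^ 2 + t) * √(sin φ ^ 2 + t)) = 1 / (t * √(1 + t)) := by
  rw [intervalIntegral.integral_eq_sub_of_hasDerivAt
    (f := fun φ => sin φ / (t * √(sin φ ^ 2 + t)))]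
  · simp
  · intro φ _
    have hp := sin_sq_add_pos ht φ
    have hq := sqrt_pos.2 hp
    have h1 : HasDerivAt (fun φ => √(sin φ ^ 2 + t)) (2 * sin φ * cos φ / (2 * √(sin φ ^ 2 + t))) φ := by
      have := ((((hasDerivAt_sin φ).pow 2).add_const t)).sqrt hp.ne'
      simpa using this
    refine ((hasDerivAt_sin φ).div (h1.const_mul t) (by positivity)).congr_deriv ?_
    have h2 := Real.sq_sqrt hp.le
    have h3 : sin φ ^ 2 + t = √(sin φ ^ 2 + t) ^ 2 := h2.symm
    set q := √(sin φ ^ 2 + t)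
    have h4 : t = q ^ 2 - sin φ ^ 2 := by linarith
    rw [h3]
    field_simp
    rw [h4]
  · exact (continuous_div_mul_sqrt_sin_sq_add ht continuous_cos).intervalIntegrable _ _

lemma integral_inv_sqrt_le {t : ℝ} (ht : 0 < t) (ht1 : t ≤ 1) :
    ∫ φ in (0)..(π / 2), 1 / √(sin φ ^ 2 + t) ≤ 4 + |log t| := by
  have hpi := pi_pos
  have h1 : ∫ φ in (0)..(π / 2), 1 / √(sin φ ^ 2 + t) ≤
      ∫ φ in (0)..(π / 2), (cos φ / √(sin φ ^ 2 + t) + 1) := by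
    refine intervalIntegral.integral_mono_on (by positivity)
      ((continuous_div_sqrt_sin_sq_add ht continuous_const).intervalIntegrable _ _)
      (((continuous_div_sqrt_sin_sq_add ht continuous_cos).add
        continuous_const).intervalIntegrable _ _) fun φ hφ => ?_
    have hs : 0 ≤ sin φ := sin_nonneg_of_nonneg_of_le_pi hφ.1 (by linarith [hφ.2])
    have hc : 0 ≤ cos φ := cos_nonneg_of_mem_Icc ⟨by linarith [hφ.1], hφ.2⟩
    have hq := sqrt_pos.2 (sin_sq_add_pos ht φ)
    have h2 : sin φ ≤ √(sin φ ^ 2 + t) := Real.le_sqrt_of_sq_le (by linarith)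
    have h3 : 1 - cos φ ≤ sin φ := by
      nlinarith [sin_sq_add_cos_sq φ, sin_le_one φ, cos_le_one φ]
    rw [div_add_one hq.ne']
    gcongr
    linarith
  rw [intervalIntegral.integral_add ((continuous_div_sqrt_sin_sq_add ht
    continuous_cos).intervalIntegrable _ _) (by simp), integral_cos_div_sqrt ht] at h1
  have h4 : log (1 + √(1 + t)) ≤ 1 + √(1 + t) - 1 := log_le_sub_one_of_pos (by positivity)
  have h5 : √(1 + t) ≤ 3 / 2 := Real.sqrt_le_iff.2 ⟨by norm_num, by linarith⟩
  have := pi_lt_four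
  have := neg_abs_le (log t)
  have := abs_nonneg (log t)
  simp only [intervalIntegral.integral_const, smul_eq_mul] at h1
  linarith

lemma profile_numerator_eq {φ : ℝ} (hc : 0 ≤ cos φ) :
    1 - 2 * sin φ ^ 2 - cos φ = (1 / (1 + cos φ) - 2) * sin φ ^ 2 := by
  have : sin φ ^ 2 = 1 - cos φ ^ 2 := by linarith [sin_sq_add_cos_sq φ]
  rw [this]
  field_simp
  ring

lemma abs_profile_weight_le {φ : ℝ} (hc : 0 ≤ cos φ) : |1 / (1 + cos φ) - 2| ≤ 2 := by
  have h1 : 1 / (1 + cos φ) ≤ 1 := by rw [div_le_one (by linarith)]; linarith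
  have h2 : 0 ≤ 1 / (1 + cos φ) := by positivity
  rw [abs_le]; constructor <;> linarith

lemma integral_profile_weight_mul_sin :
    ∫ φ in (0)..(π / 2), (1 / (1 + cos φ) - 2) * sin φ = log 2 - 2 := by
  have hc : ∀ φ ∈ Set.uIcc 0 (π / 2), 0 ≤ cos φ := fun φ hφ => by
    rw [Set.uIcc_of_le (by positivity)] at hφ
    exact cos_nonneg_of_mem_Icc ⟨by linarith [hφ.1, pi_pos], hφ.2⟩
  rw [intervalIntegral.integral_eq_sub_of_hasDerivAt
    (f := fun φ => -log (1 + cos φ) + 2 * cos φ)]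
  · norm_num
    ring
  · intro φ hφ
    have h1 := hc φ hφ
    refine ((((hasDerivAt_cos φ).const_add 1).log (by positivity)).neg.add
      ((hasDerivAt_cos φ).const_mul 2)).congr_deriv ?_
    ring
  · refine ContinuousOn.intervalIntegrable fun φ hφ => ContinuousAt.continuousWithinAt ?_
    have h1 : 1 + cos φ ≠ 0 := by have := hc φ hφ; positivity
    fun_prop (disch := exact h1)

lemma cos_nonneg_of_mem_uIoc {φ : ℝ} (hφ : φ ∈ Set.Icc 0 (π / 2)) : 0 ≤ cos φ :=
  cos_nonneg_of_mem_Icc ⟨by linarith [hφ.1, pi_pos], hφ.2⟩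

lemma abs_ringProfile_sub_le {t : ℝ} (ht : 0 < t) (ht1 : t ≤ 1) :
    |ringProfile t - (2 * log 2 - 2 - log t / 2)| ≤ 9 * t * (1 + |log t|) := by
  have hpi := pi_pos
  have i1 := (continuous_div_sqrt_sin_sq_add ht (f := fun φ => 1 - 2 * sin φ ^ 2)
    (by fun_prop)).intervalIntegrable (μ := volume) 0 (π / 2)
  have i2 := (continuous_div_sqrt_sin_sq_add ht continuous_cos).intervalIntegrable
    (μ := volume) 0 (π / 2)
  have i3 : IntervalIntegrable (fun φ => (1 / (1 + cos φ) - 2) * sin φ) volume 0 (π / 2) := by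
    refine ContinuousOn.intervalIntegrable fun φ hφ => ContinuousAt.continuousWithinAt ?_
    rw [Set.uIcc_of_le (by positivity)] at hφ
    have h1 : 1 + cos φ ≠ 0 := by have := cos_nonneg_of_mem_uIoc hφ; positivity
    fun_prop (disch := exact h1)
  have i4 := (continuous_div_sqrt_sin_sq_add ht (f := fun _ => (1 : ℝ))
    (by fun_prop)).intervalIntegrable (μ := volume) 0 (π / 2)
  have e1 : ringProfile t - (2 * log 2 - 2 - log t / 2) =
      (log (1 + √(1 + t)) - log 2) +
      ∫ φ in (0)..(π / 2), ((1 - 2 * sin φ ^ 2) / √(sin φ ^ 2 + t) - cos φ / √(sin φ ^ 2 + t) -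
        (1 / (1 + cos φ) - 2) * sin φ) := by
    rw [intervalIntegral.integral_sub (i1.sub i2) i3, intervalIntegral.integral_sub i1 i2,
      integral_profile_weight_mul_sin, integral_cos_div_sqrt ht, ringProfile]
    ring
  have b1 : |∫ φ in (0)..(π / 2), ((1 - 2 * sin φ ^ 2) / √(sin φ ^ 2 + t) -
      cos φ / √(sin φ ^ 2 + t) - (1 / (1 + cos φ) - 2) * sin φ)| ≤
      ∫ φ in (0)..(π / 2), 2 * t * (1 / √(sin φ ^ 2 + t)) := by
    rw [← Real.norm_eq_abs]
    refine intervalIntegral.norm_integral_le_of_norm_le (by positivity)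
      (Eventually.of_forall fun φ hφ => ?_) (i4.const_mul _)
    have hφ' : φ ∈ Set.Icc 0 (π / 2) := ⟨hφ.1.le, hφ.2⟩
    have hc := cos_nonneg_of_mem_uIoc hφ'
    have hs : 0 ≤ sin φ := sin_nonneg_of_nonneg_of_le_pi hφ'.1 (by linarith [hφ'.2])
    have hp := sin_sq_add_pos ht φ
    have hq := sqrt_pos.2 hp
    have h2 : sin φ ≤ √(sin φ ^ 2 + t) := Real.le_sqrt_of_sq_le (by linarith)
    have h3 := Real.sq_sqrt hp.le
    rw [← sub_div, profile_numerator_eq hc, Real.norm_eq_abs]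
    set q := √(sin φ ^ 2 + t)
    have : (1 / (1 + cos φ) - 2) * sin φ ^ 2 / q - (1 / (1 + cos φ) - 2) * sin φ =
      (1 / (1 + cos φ) - 2) * -(sin φ * (q - sin φ) / q) := by field_simp; ring
    rw [this, abs_mul, abs_neg, abs_of_nonneg (a := sin φ * (q - sin φ) / q)
      (div_nonneg (mul_nonneg hs (by linarith)) hq.le)]
    calc _ ≤ 2 * (t / q) := by
          gcongr
          · exact abs_profile_weight_le hc
          · nlinarith
      _ = _ := by ring
  rw [intervalIntegral.integral_const_mul] at b1
  have b2 := integral_inv_sqrt_le ht ht1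
  have b3 : |log (1 + √(1 + t)) - log 2| ≤ t := by
    have h5 : √(1 + t) ≤ 1 + t := Real.sqrt_le_iff.2 ⟨by linarith, by nlinarith⟩
    have h6 : 1 ≤ √(1 + t) := Real.le_sqrt_of_sq_le (by linarith)
    rw [← log_div (by positivity) (by norm_num), abs_of_nonneg (log_nonneg (by linarith))]
    have := log_le_sub_one_of_pos (x := (1 + √(1 + t)) / 2) (by positivity)
    linarith
  rw [e1]
  refine (abs_add_le _ _).trans ?_
  have := abs_nonneg (log t)
  have : 2 * t * ∫ φ in (0)..(π / 2), 1 / √(sin φ ^ 2 + t) ≤ 2 * t * (4 + |log t|) := by gcongr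
  nlinarith [mul_nonneg ht.le (abs_nonneg (log t))]

lemma abs_ringProfileDeriv_add_le {t : ℝ} (ht : 0 < t) (ht1 : t ≤ 1) :
    |ringProfileDeriv t + 1 / (2 * t)| ≤ 5 * (1 + |log t|) := by
  have hpi := pi_pos
  have i1 := (continuous_div_mul_sqrt_sin_sq_add ht (f := fun φ => 1 - 2 * sin φ ^ 2)
    (by fun_prop)).intervalIntegrable (μ := volume) 0 (π / 2)
  have i2 := (continuous_div_mul_sqrt_sin_sq_add ht continuous_cos).intervalIntegrable
    (μ := volume) 0 (π / 2)
  have i4 := (continuous_div_sqrt_sin_sq_add ht (f := fun _ => (1 : ℝ))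
    (by fun_prop)).intervalIntegrable (μ := volume) 0 (π / 2)
  have e0 : ringProfileDeriv t =
      -(1 / 2) * ∫ φ in (0)..(π / 2), (1 - 2 * sin φ ^ 2) / ((sin φ ^ 2 + t) * √(sin φ ^ 2 + t)) := by
    rw [← intervalIntegral.integral_const_mul, ringProfileDeriv]
    congr 1
    ext φ
    rw [mul_assoc 2, neg_div, mul_comm 2, ← div_div]
    ring
  have e1 : ringProfileDeriv t + 1 / (2 * t) =
      (1 / (2 * t) - 1 / (2 * (t * √(1 + t)))) +
      -(1 / 2) * ∫ φ in (0)..(π / 2), ((1 - 2 * sin φ ^ 2) / ((sin φ ^ 2 + t) * √(sin φ ^ 2 + t)) -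
        cos φ / ((sin φ ^ 2 + t) * √(sin φ ^ 2 + t))) := by
    rw [intervalIntegral.integral_sub i1 i2, integral_cos_div_mul_sqrt ht, e0, ← div_div 1 2]
    rw [← div_div 1 2 (t * √(1 + t))]
    ring
  have b1 : |∫ φ in (0)..(π / 2), ((1 - 2 * sin φ ^ 2) / ((sin φ ^ 2 + t) * √(sin φ ^ 2 + t)) -
        cos φ / ((sin φ ^ 2 + t) * √(sin φ ^ 2 + t)))| ≤
      ∫ φ in (0)..(π / 2), 2 * (1 / √(sin φ ^ 2 + t)) := by
    rw [← Real.norm_eq_abs]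
    refine intervalIntegral.norm_integral_le_of_norm_le (by positivity)
      (Eventually.of_forall fun φ hφ => ?_) (i4.const_mul _)
    have hφ' : φ ∈ Set.Icc 0 (π / 2) := ⟨hφ.1.le, hφ.2⟩
    have hc := cos_nonneg_of_mem_uIoc hφ'
    have hp := sin_sq_add_pos ht φ
    have hq := sqrt_pos.2 hp
    rw [← sub_div, profile_numerator_eq hc, Real.norm_eq_abs]
    rw [mul_div_assoc, abs_mul, abs_of_nonneg (a := _ / _) (by positivity)]
    refine mul_le_mul (abs_profile_weight_le hc) ?_ (by positivity) (by norm_num)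
    rw [← div_div]
    gcongr
    rw [div_le_one hp]
    linarith
  rw [intervalIntegral.integral_const_mul] at b1
  have b2 := integral_inv_sqrt_le ht ht1
  have b3 : |1 / (2 * t) - 1 / (2 * (t * √(1 + t)))| ≤ 1 / 2 := by
    have h5 : √(1 + t) ≤ 1 + t := Real.sqrt_le_iff.2 ⟨by linarith, by nlinarith⟩
    have h6 : 1 ≤ √(1 + t) := Real.le_sqrt_of_sq_le (by linarith)
    have : 1 / (2 * t) - 1 / (2 * (t * √(1 + t))) = (√(1 + t) - 1) / (2 * (t * √(1 + t))) := by
      field_simp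
    rw [this, abs_of_nonneg (div_nonneg (by linarith) (by positivity)),
      div_le_div_iff₀ (by positivity) (by norm_num)]
    nlinarith
  rw [e1]
  refine (abs_add_le _ _).trans ?_
  rw [abs_mul, abs_neg, abs_of_pos (by norm_num : (0 : ℝ) < 1 / 2)]
  have := abs_nonneg (log t)
  linarith

lemma abs_ringProfile_le {t : ℝ} (ht : 0 < t) : |ringProfile t| ≤ 2 / √t := by
  have hpi := pi_pos
  have h := intervalIntegral.norm_integral_le_of_norm_le_const (a := 0) (b := π / 2)
    (f := fun φ => (1 - 2 * sin φ ^ 2) / √(sin φ ^ 2 + t)) (C := 1 / √t) fun φ _ => by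
      rw [norm_div, Real.norm_eq_abs, Real.norm_eq_abs, abs_of_nonneg (sqrt_nonneg _)]
      have h2 : |1 - 2 * sin φ ^ 2| ≤ 1 := by
        rw [abs_le]
        constructor <;> nlinarith [sin_sq_add_cos_sq φ, sq_nonneg (cos φ), sq_nonneg (sin φ)]
      gcongr
      nlinarith [sq_nonneg (sin φ)]
  rw [Real.norm_eq_abs, sub_zero, abs_of_pos (by positivity : 0 < π / 2)] at h
  refine h.trans ?_
  have := pi_lt_four
  rw [one_div_mul_eq_div]
  gcongr
  linarith

lemma measurable_ringProfile : Measurable ringProfile := by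
  have : ringProfile = fun t => ∫ φ in Set.Ioc 0 (π / 2), (1 - 2 * sin φ ^ 2) / √(sin φ ^ 2 + t) := by
    ext t
    rw [ringProfile, intervalIntegral.integral_of_le (by positivity)]
  rw [this]
  refine (StronglyMeasurable.integral_prod_right (f := fun t φ => (1 - 2 * sin φ ^ 2) /
    √(sin φ ^ 2 + t)) ?_).measurable
  exact Measurable.stronglyMeasurable (by fun_prop)

lemma measurable_ringProfileDeriv : Measurable ringProfileDeriv := by
  have : ringProfileDeriv = fun t => ∫ φ in Set.Ioc 0 (π / 2),
      -(1 - 2 * sin φ ^ 2) / (2 * (sin φ ^ 2 + t) * √(sin φ ^ 2 + t)) := by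
    ext t
    rw [ringProfileDeriv, intervalIntegral.integral_of_le (by positivity)]
  rw [this]
  refine (StronglyMeasurable.integral_prod_right (f := fun t φ => -(1 - 2 * sin φ ^ 2) /
    (2 * (sin φ ^ 2 + t) * √(sin φ ^ 2 + t))) ?_).measurable
  exact Measurable.stronglyMeasurable (by fun_prop)

/-- The variable `|x - x'|² / (4 x₁ x₁')` of the profile function. -/
def ringVar (x x' : Plane) : ℝ := ((x 1 - x' 1) ^ 2 + (x 0 - x' 0) ^ 2) / (4 * x 0 * x' 0)

lemma sq_add_sq_pos_of_ne {x x' : Plane} (h : x ≠ x') :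
    0 < (x 1 - x' 1) ^ 2 + (x 0 - x' 0) ^ 2 := by
  by_contra hc
  apply h
  have h1 : x 1 - x' 1 = 0 := by nlinarith [sq_nonneg (x 1 - x' 1), sq_nonneg (x 0 - x' 0)]
  have h0 : x 0 - x' 0 = 0 := by nlinarith [sq_nonneg (x 1 - x' 1), sq_nonneg (x 0 - x' 0)]
  ext i
  fin_cases i
  · exact sub_eq_zero.1 h0
  · exact sub_eq_zero.1 h1

lemma ringVar_pos {x x' : Plane} (hx : 0 < x 0) (hx' : 0 < x' 0) (h : x ≠ x') :
    0 < ringVar x x' :=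
  div_pos (sq_add_sq_pos_of_ne h) (by positivity)

lemma integral_eq_two_mul_of_even {f : ℝ → ℝ} (hf : Continuous f) (he : ∀ x, f (-x) = f x)
    (a : ℝ) : ∫ x in (-a)..a, f x = 2 * ∫ x in (0)..a, f x := by
  rw [← intervalIntegral.integral_add_adjacent_intervals (hf.intervalIntegrable (-a) 0)
    (hf.intervalIntegrable 0 a)]
  have : ∫ x in (-a)..0, f x = ∫ x in (0)..a, f x := by
    simpa [he] using (intervalIntegral.integral_comp_neg (a := -a) (b := 0) f)
  rw [this, two_mul]

lemma Gstar_eq {x x' : Plane} (hx : 0 < x 0) (hx' : 0 < x' 0) (h : x ≠ x') :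
    Gstar x x' = x' 0 * √(x 0 * x' 0) / (2 * π) * ringProfile (ringVar x x') := by
  have ht := ringVar_pos hx hx' h
  set t := ringVar x x' with ht_def
  have hd : (x 1 - x' 1) ^ 2 + (x 0 - x' 0) ^ 2 = 4 * (x 0 * x' 0) * t := by
    rw [ht_def, ringVar]; field_simp
  have hp : 0 < x 0 * x' 0 := by positivity
  have key : ∀ φ, (x 1 - x' 1) ^ 2 + (x 0) ^ 2 + (x' 0) ^ 2 - 2 * x 0 * x' 0 * Real.cos (2 * φ) =
      4 * (x 0 * x' 0) * (sin φ ^ 2 + t) := fun φ => by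
    rw [cos_two_mul, cos_sq']
    linear_combination hd
  have key2 : ∀ φ, cos (2 * φ) / √((x 1 - x' 1) ^ 2 + (x 0) ^ 2 + (x' 0) ^ 2 -
      2 * x 0 * x' 0 * Real.cos (2 * φ)) =
      1 / (2 * √(x 0 * x' 0)) * ((1 - 2 * sin φ ^ 2) / √(sin φ ^ 2 + t)) := fun φ => by
    have h4 : √(4 : ℝ) = 2 := by rw [show (4 : ℝ) = 2 ^ 2 by norm_num]; simp
    rw [key, Real.sqrt_mul (by positivity), Real.sqrt_mul (by norm_num), h4, cos_two_mul, cos_sq']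
    rw [div_mul_div_comm]
    ring_nf
  have e1 : ∫ θ in (-π)..π, Real.cos θ /
      Real.sqrt ((x 1 - x' 1) ^ 2 + (x 0) ^ 2 + (x' 0) ^ 2 - 2 * x 0 * x' 0 * Real.cos θ) =
      2 * ∫ φ in (-(π / 2))..(π / 2), cos (2 * φ) / √((x 1 - x' 1) ^ 2 + (x 0) ^ 2 + (x' 0) ^ 2 -
      2 * x 0 * x' 0 * Real.cos (2 * φ)) := by
    rw [intervalIntegral.integral_comp_mul_left (fun θ => Real.cos θ /
      Real.sqrt ((x 1 - x' 1) ^ 2 + (x 0) ^ 2 + (x' 0) ^ 2 - 2 * x 0 * x' 0 * Real.cos θ))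
      (two_ne_zero)]
    rw [show 2 * -(π / 2) = -π by ring, show 2 * (π / 2) = π by ring, smul_eq_mul]
    ring
  rw [Gstar, e1]
  simp_rw [key2]
  rw [intervalIntegral.integral_const_mul, integral_eq_two_mul_of_even
    (continuous_div_sqrt_sin_sq_add ht (by fun_prop)) (fun φ => by simp), ← ringProfile]
  have hq := sqrt_pos.2 hp
  have hsq := Real.sq_sqrt hp.le
  set p := √(x 0 * x' 0)
  have : x 0 * x' 0 ^ 2 = x' 0 * p ^ 2 := by rw [hsq]; ring
  rw [this]
  field_simp
  ring

/-- The derivative of the regular part `H_c(x,x')` in the first coordinate of `x`. -/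
def HkerDeriv (c : ℝ) (x x' : Plane) : ℝ :=
  1 / (2 * π) * (x' 0 ^ 2 / (2 * √(x 0 * x' 0)) * ringProfile (ringVar x x') +
    x' 0 * √(x 0 * x' 0) * (ringProfileDeriv (ringVar x x') *
      ((x 0 - x' 0) / (2 * x 0 * x' 0) - ringVar x x' / x 0))) -
  c ^ 2 / (2 * π) * ((x 0 + x' 0) / ((x 0 + x' 0) ^ 2 + (x 1 - x' 1) ^ 2) -
    (x 0 - x' 0) / ((x 0 - x' 0) ^ 2 + (x 1 - x' 1) ^ 2))

lemma Hker_eventuallyEq (c : ℝ) {x x' : Plane} (hx : 0 < x 0) (hx' : 0 < x' 0) (h : x ≠ x') :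
    (fun y => Hker c y x') =ᶠ[nhds x] fun y =>
      x' 0 * √(y 0 * x' 0) / (2 * π) * ringProfile (((y 1 - x' 1) ^ 2 + (y 0 - x' 0) ^ 2) /
        (4 * y 0 * x' 0)) -
      c ^ 2 * ((1 / (4 * π)) * Real.log
    (((y 0 + x' 0) ^ 2 + (y 1 - x' 1) ^ 2) / ((y 0 - x' 0) ^ 2 + (y 1 - x' 1) ^ 2))) := by
  have h0 : ∀ᶠ y : Plane in nhds x, 0 < y 0 :=
    (isOpen_lt continuous_const (by fun_prop)).mem_nhds hx
  filter_upwards [h0, isOpen_ne.mem_nhds h] with y hy hne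
  rw [Hker, Gstar_eq hy hx' hne, Gfun, ringVar]

lemma differentiableAt_Hker (c : ℝ) {x x' : Plane} (hx : 0 < x 0) (hx' : 0 < x' 0)
    (h : x ≠ x') : DifferentiableAt ℝ (fun y => Hker c y x') x := by
  refine DifferentiableAt.congr_of_eventuallyEq ?_ (Hker_eventuallyEq c hx hx' h)
  have hd := sq_add_sq_pos_of_ne h
  have hF : DifferentiableAt ℝ ringProfile
      (((x 1 - x' 1) ^ 2 + (x 0 - x' 0) ^ 2) / (4 * x 0 * x' 0)) :=
    (hasDerivAt_ringProfile (ringVar_pos hx hx' h)).differentiableAt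
  have hp0 : ∀ i : Fin 2, DifferentiableAt ℝ (fun y : Plane => y i) x := fun i => by fun_prop
  have hvar : DifferentiableAt ℝ (fun y : Plane =>
      ((y 1 - x' 1) ^ 2 + (y 0 - x' 0) ^ 2) / (4 * y 0 * x' 0)) x := by
    fun_prop (disch := positivity)
  have h1 := DifferentiableAt.comp x hF hvar
  have h2 : DifferentiableAt ℝ (fun y : Plane => √(y 0 * x' 0)) x := by
    fun_prop (disch := positivity)
  have h3 : DifferentiableAt ℝ (fun y : Plane => Real.log
    (((y 0 + x' 0) ^ 2 + (y 1 - x' 1) ^ 2) / ((y 0 - x' 0) ^ 2 + (y 1 - x' 1) ^ 2))) x := by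
    have hd' : (x 0 - x' 0) ^ 2 + (x 1 - x' 1) ^ 2 ≠ 0 := by linarith
    refine DifferentiableAt.log (by fun_prop (disch := exact hd')) ?_
    positivity
  have h4 : DifferentiableAt ℝ (fun y : Plane => x' 0 * √(y 0 * x' 0) / (2 * π)) x := by
    simpa only [div_eq_mul_inv] using (h2.const_mul (x' 0)).mul_const (2 * π)⁻¹
  exact (h4.mul h1).sub ((h3.const_mul _).const_mul _)

lemma fderiv_Hker (c : ℝ) {x x' : Plane} (hx : 0 < x 0) (hx' : 0 < x' 0) (h : x ≠ x') :
    fderiv ℝ (fun y => Hker c y x') x (EuclideanSpace.single 0 1) = HkerDeriv c x x' := by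
  have hd := sq_add_sq_pos_of_ne h
  set γ : ℝ → Plane := fun s => x + (s - x 0) • EuclideanSpace.single 0 1 with hγ
  have hγ0 : γ (x 0) = x := by simp [hγ]
  have hγd : HasDerivAt γ (EuclideanSpace.single 0 1) (x 0) := by
    have := (((hasDerivAt_id (x 0)).sub_const (x 0)).smul_const
      (EuclideanSpace.single 0 1 : Plane)).const_add x
    rwa [one_smul] at this
  have h1 := (hγ0.symm ▸ (differentiableAt_Hker c hx hx' h).hasFDerivAt :
    HasFDerivAt (fun y => Hker c y x') (fderiv ℝ (fun y => Hker c y x') x) (γ (x 0)))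
  have h2 := h1.comp_hasDerivAt (x 0) hγd
  have c0 : ∀ s, γ s 0 = s := fun s => by simp [hγ]
  have c1 : ∀ s, γ s 1 = x 1 := fun s => by simp [hγ]
  have h3 := (hγ0.symm ▸ Hker_eventuallyEq c hx hx' h :
    (fun y => Hker c y x') =ᶠ[nhds (γ (x 0))] _).comp_tendsto hγd.continuousAt
  have h4 := h2.congr_of_eventuallyEq h3.symm
  simp only [Function.comp_def, c0, c1] at h4
  refine h4.unique ?_
  have ht := ringVar_pos hx hx' h
  have i := hasDerivAt_id (x 0)
  have hp : 0 < x 0 * x' 0 := by positivity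
  have k1 : HasDerivAt (fun s => √(s * x' 0)) (x' 0 / (2 * √(x 0 * x' 0))) (x 0) := by
    simpa using (i.mul_const (x' 0)).sqrt hp.ne'
  have k2 : HasDerivAt (fun s => ((x 1 - x' 1) ^ 2 + (s - x' 0) ^ 2) / (4 * s * x' 0))
      ((x 0 - x' 0) / (2 * x 0 * x' 0) - ringVar x x' / x 0) (x 0) := by
    have := ((((i.sub_const (x' 0)).pow 2).const_add ((x 1 - x' 1) ^ 2))).div
      ((i.const_mul 4).mul_const (x' 0)) (by simp; exact ⟨hx.ne', hx'.ne'⟩)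
    refine this.congr_deriv ?_
    simp only [ringVar, id, Pi.pow_apply]
    field_simp
    ring
  have k3 := HasDerivAt.comp (x 0) (hasDerivAt_ringProfile ht) k2
  have hd' : (x 0 - x' 0) ^ 2 + (x 1 - x' 1) ^ 2 ≠ 0 := by linarith
  have hn' : (x 0 + x' 0) ^ 2 + (x 1 - x' 1) ^ 2 ≠ 0 := by positivity
  have k4 : HasDerivAt (fun s => Real.log (((s + x' 0) ^ 2 + (x 1 - x' 1) ^ 2) /
      ((s - x' 0) ^ 2 + (x 1 - x' 1) ^ 2)))
      (2 * ((x 0 + x' 0) / ((x 0 + x' 0) ^ 2 + (x 1 - x' 1) ^ 2) -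
    (x 0 - x' 0) / ((x 0 - x' 0) ^ 2 + (x 1 - x' 1) ^ 2))) (x 0) := by
    have := ((((i.add_const (x' 0)).pow 2).add_const ((x 1 - x' 1) ^ 2)).div
      (((i.sub_const (x' 0)).pow 2).add_const ((x 1 - x' 1) ^ 2)) hd').log (div_ne_zero hn' hd')
    refine this.congr_deriv ?_
    simp only [id, Pi.pow_apply, Pi.div_apply]
    field_simp
    ring
  refine ((((k1.const_mul (x' 0)).div_const (2 * π)).mul k3).sub
    ((k4.const_mul (1 / (4 * π))).const_mul (c ^ 2))).congr_deriv ?_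
  simp only [HkerDeriv, Function.comp_def, ← ringVar.eq_1]
  field_simp
  ring

lemma abs_log_le_add_inv {l u x : ℝ} (hl : 0 < l) (h1 : l ≤ x) (h2 : x ≤ u) :
    |log x| ≤ u + 1 / l := by
  have hx : 0 < x := hl.trans_le h1
  have h3 := log_le_sub_one_of_pos hx
  have h4 := one_sub_inv_le_log_of_pos hx
  have h5 : x⁻¹ ≤ 1 / l := by rw [inv_eq_one_div]; gcongr
  have h6 : 0 < 1 / l := by positivity
  rw [abs_le]
  constructor <;> linarith

set_option maxHeartbeats 2000000 in
lemma symm_kernel_expansion {l u : ℝ} (hl : 0 < l) : ∃ C > 0, ∀ a a' b z d η : ℝ,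
    l ≤ a → a ≤ u → l ≤ a' → a' ≤ u → l ≤ z → z ≤ u → 0 < d → d ^ 2 = (a - a') ^ 2 + b ^ 2 →
    d ≤ η → |(a + a') / 2 - z| ≤ η → d ≤ 2 * l →
    |(a ^ 2 + a' ^ 2) / (2 * √(a * a')) * ringProfile (d ^ 2 / (4 * a * a'))
      - (a - a') ^ 2 * ringProfileDeriv (d ^ 2 / (4 * a * a')) / (2 * √(a * a'))
      - 2 * ((a ^ 2 + a' ^ 2) / (2 * √(a * a'))) * (d ^ 2 / (4 * a * a')) *
        ringProfileDeriv (d ^ 2 / (4 * a * a'))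
      - 2 * z ^ 2 * (a + a') / ((a + a') ^ 2 + b ^ 2)
      - ((a + a') / 2 * (log (8 * z) - 2 - log d + (a - a') ^ 2 / d ^ 2)
        + 3 * ((a + a') / 2 - z))| ≤ C * (η ^ 2 * (1 + |log d|)) := by
  set Λ := u + 1 / l with hΛ
  refine ⟨(3 * |u| / l ^ 2) * 2 + (3 * |u| / l ^ 2) * |Λ| + |u| / l ^ 2 + 1 / l
    + (2 * u ^ 2 / l) * (9 / l ^ 2 * (3 + 2 * |Λ|)) + 1 / l
    + 5 * (3 + 2 * |Λ|) / l + 2 * (2 * u ^ 2 / l) * (1 / l ^ 2 * (5 * (3 + 2 * |Λ|)))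
    + (3 * |u| / l ^ 2 + 1 / l + u ^ 2 / l ^ 3), by positivity, ?_⟩
  intro a a' b z d η ha1 ha2 ha1' ha2' hz1 hz2 hd hdd hdη hmη hdl
  have hu : 0 < u := hl.trans_le (ha1.trans ha2)
  have hΛ0 : 0 < Λ := by positivity
  rw [abs_of_pos hu, abs_of_pos hΛ0]
  have ha : 0 < a := by linarith
  have ha' : 0 < a' := by linarith
  have hz : 0 < z := by linarith
  have hη : 0 < η := by linarith
  set p := √(a * a') with hp_def
  have hp2 : p ^ 2 = a * a' := Real.sq_sqrt (by positivity)
  have hp0 : 0 < p := by positivity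
  have hpl : l ≤ p := Real.le_sqrt_of_sq_le (by rw [sq]; gcongr)
  have hpu : p ≤ u := Real.sqrt_le_iff.2 ⟨hu.le, by rw [sq]; gcongr⟩
  set m := (a + a') / 2 with hm
  have hml : l ≤ m := by linarith
  have hmu : m ≤ u := by linarith
  have hm0 : 0 < m := by linarith
  set t := d ^ 2 / (4 * a * a') with ht_def
  have htp : d ^ 2 = 4 * p ^ 2 * t := by rw [hp2, ht_def]; field_simp
  have ht : 0 < t := by positivity
  have ht1 : t ≤ 1 := by
    rw [ht_def, div_le_one (by positivity)]
    calc d ^ 2 ≤ (2 * l) ^ 2 := by gcongr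
      _ = 4 * l * l := by ring
      _ ≤ 4 * a * a' := by gcongr
  have htη : t ≤ 1 / l ^ 2 * η ^ 2 := by
    rw [one_div_mul_eq_div, le_div_iff₀ (by positivity)]
    calc t * l ^ 2 ≤ 4 * (t * p ^ 2) := by
          have : t * l ^ 2 ≤ t * p ^ 2 := by gcongr
          have : 0 ≤ t * p ^ 2 := by positivity
          linarith
      _ = d ^ 2 := by rw [htp]; ring
      _ ≤ η ^ 2 := by gcongr
  have hd2 : d ^ 2 ≤ η ^ 2 := by gcongr
  set W := 1 + |log d| with hW
  have hW1 : 1 ≤ W := by linarith [abs_nonneg (log d)]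
  have hlogp : |log p| ≤ Λ := abs_log_le_add_inv hl hpl hpu
  have hlogt : log t = 2 * log d - 2 * log 2 - 2 * log p := by
    have : log (d ^ 2) = log (4 * p ^ 2 * t) := by rw [htp]
    rw [log_pow, log_mul (by positivity) ht.ne', log_mul (by norm_num) (by positivity), log_pow,
      show (4 : ℝ) = 2 ^ 2 by norm_num, log_pow] at this
    push_cast at this
    linarith
  have hl2 := log_two_lt_d9
  have hl2' := log_two_gt_d9
  have hlt : 1 + |log t| ≤ (3 + 2 * Λ) * W := by
    have : |log t| ≤ 2 * |log d| + 2 + 2 * |log p| := by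
      rw [hlogt, abs_le]
      constructor <;> linarith [le_abs_self (log d), le_abs_self (log p), neg_abs_le (log d),
        neg_abs_le (log p)]
    have h3 : Λ ≤ Λ * W := le_mul_of_one_le_right hΛ0.le hW1
    have h4 : (3 + 2 * Λ) * W = 3 * W + 2 * (Λ * W) := by ring
    linarith
  obtain ⟨r, hr⟩ : ∃ r, r = ringProfile t - (2 * log 2 - 2 - log t / 2) := ⟨_, rfl⟩
  obtain ⟨ρ, hρ⟩ : ∃ ρ, ρ = ringProfileDeriv t + 1 / (2 * t) := ⟨_, rfl⟩
  have hrb : |r| ≤ 9 / l ^ 2 * (3 + 2 * Λ) * (η ^ 2 * W) := by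
    rw [hr]
    refine (abs_ringProfile_sub_le ht ht1).trans ?_
    calc 9 * t * (1 + |log t|) ≤ 9 * (1 / l ^ 2 * η ^ 2) * ((3 + 2 * Λ) * W) := by gcongr
      _ = _ := by ring
  have hρb : |ρ| ≤ 5 * (3 + 2 * Λ) * W := by
    rw [hρ]
    refine (abs_ringProfileDeriv_add_le ht ht1).trans ?_
    rw [mul_assoc]
    gcongr
  have hF : ringProfile t = 2 * log 2 - 2 - log t / 2 + r := by rw [hr]; ring
  have hF' : ringProfileDeriv t = -(1 / (2 * t)) + ρ := by rw [hρ]; ring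
  -- the difference of the arithmetic and the geometric mean
  set v := m - p with hv
  have hmp : (m + p) * v = (a - a') ^ 2 / 4 := by
    rw [hv, hm]; linear_combination -hp2
  have hv0 : 0 ≤ v := by
    refine (mul_nonneg_iff_of_pos_left (by positivity : 0 < m + p)).1 ?_
    rw [hmp]; positivity
  have hvη : v ≤ 1 / l * η ^ 2 := by
    rw [one_div_mul_eq_div, le_div_iff₀ hl]
    calc v * l ≤ v * (m + p) := by gcongr; linarith
      _ = (a - a') ^ 2 / 4 := by rw [mul_comm, hmp]
      _ ≤ η ^ 2 := by linarith [sq_nonneg b, sq_nonneg (a - a')]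
  have hη2W : η ^ 2 ≤ η ^ 2 * W := le_mul_of_one_le_right (by positivity) hW1
  set N := (a ^ 2 + a' ^ 2) / (2 * p) with hN
  have hNm : N - m = (2 * m + p) * v / p := by
    rw [hN, hv, hm]
    field_simp
    linear_combination 2 * hp2
  have hNm0 : 0 ≤ N - m := by rw [hNm]; positivity
  have hNmb : N - m ≤ 3 * u / l ^ 2 * η ^ 2 := by
    rw [hNm]
    calc (2 * m + p) * v / p ≤ (2 * u + u) * (1 / l * η ^ 2) / l := by gcongr
      _ = _ := by field_simp; ring
  have hN0 : 0 < N := by positivity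
  have hNb : N ≤ 2 * u ^ 2 / l := by
    rw [hN, div_le_div_iff₀ (by positivity) hl]
    calc (a ^ 2 + a' ^ 2) * l ≤ (u ^ 2 + u ^ 2) * p := by gcongr
      _ ≤ 2 * u ^ 2 * (2 * p) := by
        have : 0 < u ^ 2 * p := by positivity
        linarith
  set q := (a - a') ^ 2 / d ^ 2 with hq
  have hq0 : 0 ≤ q := by positivity
  have hq1 : q ≤ 1 := by
    rw [hq, div_le_one (by positivity)]; linarith [sq_nonneg b]
  have hqd : (a - a') ^ 2 = q * (4 * p ^ 2 * t) := by rw [← htp, hq]; field_simp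
  have hlog8 : log (8 * z) = 3 * log 2 + log z := by
    rw [log_mul (by norm_num) hz.ne', show (8 : ℝ) = 2 ^ 3 by norm_num, log_pow]; norm_num
  have key : N * ringProfile t - (a - a') ^ 2 * ringProfileDeriv t / (2 * p)
      - 2 * N * t * ringProfileDeriv t - 2 * z ^ 2 * (a + a') / ((a + a') ^ 2 + b ^ 2)
      - (m * (log (8 * z) - 2 - log d + q) + 3 * (m - z)) =
      (N - m) * (3 * log 2 - 2 - log d) + (N - m) * log p + -(m * (log m - log p))
      + (m * (log m - log z) - (m - z)) + N * r + -(v * q) + -((a - a') ^ 2 * ρ / (2 * p))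
      + -(2 * N * (t * ρ)) + ((N - m) + -((m - z) ^ 2 / m)
        + z ^ 2 * b ^ 2 / (m * (4 * m ^ 2 + b ^ 2))) := by
    have e1 : (a - a') ^ 2 * ringProfileDeriv t / (2 * p) =
        -(p * q) + (a - a') ^ 2 * ρ / (2 * p) := by
      rw [hF', mul_add, add_div]
      congr 1
      rw [hqd]
      field_simp
      norm_num
    have e2 : 2 * N * t * ringProfileDeriv t = -N + 2 * N * (t * ρ) := by
      rw [hF']; field_simp
    have e3 : 2 * z ^ 2 * (a + a') / ((a + a') ^ 2 + b ^ 2) =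
        z ^ 2 / m - z ^ 2 * b ^ 2 / (m * (4 * m ^ 2 + b ^ 2)) := by
      have : a + a' = 2 * m := by rw [hm]; ring
      rw [this]
      have : (2 * m) ^ 2 + b ^ 2 ≠ 0 := by positivity
      have : 4 * m ^ 2 + b ^ 2 ≠ 0 := by positivity
      field_simp
      ring
    have e4 : (m - z) ^ 2 / m = m - 2 * z + z ^ 2 / m := by field_simp; ring
    rw [e1, e2, e3, e4, hF, hlogt, hlog8, hv]
    ring
  rw [key]
  have bound1 : |(N - m) * (3 * log 2 - 2 - log d)| ≤ (3 * u / l ^ 2) * 2 * (η ^ 2 * W) := by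
    rw [abs_mul, abs_of_nonneg hNm0]
    have : |3 * log 2 - 2 - log d| ≤ 2 * W := by
      rw [abs_le]
      constructor <;> linarith [le_abs_self (log d), neg_abs_le (log d)]
    calc _ ≤ (3 * u / l ^ 2 * η ^ 2) * (2 * W) := by gcongr
      _ = _ := by ring
  have bound2 : |(N - m) * log p| ≤ (3 * u / l ^ 2) * Λ * (η ^ 2 * W) := by
    rw [abs_mul, abs_of_nonneg hNm0]
    calc _ ≤ (3 * u / l ^ 2 * (η ^ 2 * W)) * Λ := by
          gcongr; exact hNmb.trans (by gcongr)
      _ = _ := by ring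
  have bound3 : |-(m * (log m - log p))| ≤ u / l ^ 2 * (η ^ 2 * W) := by
    have h1 : log m - log p ≤ v / p := by
      rw [← log_div hm0.ne' hp0.ne']
      have := log_le_sub_one_of_pos (div_pos hm0 hp0)
      rw [hv, sub_div, div_self hp0.ne']
      linarith
    have h2 : 0 ≤ log m - log p := sub_nonneg.2 (log_le_log hp0 (by linarith))
    rw [abs_neg, abs_of_nonneg (by positivity)]
    calc _ ≤ u * ((1 / l * (η ^ 2 * W)) / l) := by
          gcongr
          exact h1.trans (by gcongr; exact hvη.trans (by gcongr))
      _ = _ := by field_simp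
  have hmz : (m - z) ^ 2 ≤ η ^ 2 := sq_le_sq' (by linarith [(abs_le.1 hmη).1]) (abs_le.1 hmη).2
  have bound4 : |m * (log m - log z) - (m - z)| ≤ 1 / l * (η ^ 2 * W) := by
    rw [← log_div hm0.ne' hz.ne']
    have h1 := log_le_sub_one_of_pos (div_pos hm0 hz)
    have h2 := one_sub_inv_le_log_of_pos (div_pos hm0 hz)
    have h3 : m * (1 - (m / z)⁻¹) = m - z := by field_simp
    have h4 : m * (m / z - 1) - (m - z) = (m - z) ^ 2 / z := by field_simp
    have h5 : (m - z) ^ 2 / z ≤ 1 / l * (η ^ 2 * W) := by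
      rw [one_div_mul_eq_div]
      exact div_le_div₀ (by positivity) (hmz.trans hη2W) hl hz1
    rw [abs_le]
    have := mul_le_mul_of_nonneg_left h1 hm0.le
    have := mul_le_mul_of_nonneg_left h2 hm0.le
    have : 0 ≤ 1 / l * (η ^ 2 * W) := by positivity
    constructor <;> linarith
  have bound5 : |N * r| ≤ (2 * u ^ 2 / l) * (9 / l ^ 2 * (3 + 2 * Λ)) * (η ^ 2 * W) := by
    rw [abs_mul, abs_of_pos hN0, mul_assoc]
    gcongr
  have bound6 : |-(v * q)| ≤ 1 / l * (η ^ 2 * W) := by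
    rw [abs_neg, abs_of_nonneg (by positivity)]
    calc v * q ≤ v * 1 := by gcongr
      _ ≤ 1 / l * η ^ 2 := by linarith
      _ ≤ _ := by gcongr
  have haa : (a - a') ^ 2 ≤ η ^ 2 := by linarith [sq_nonneg b]
  have bound7 : |-((a - a') ^ 2 * ρ / (2 * p))| ≤ 5 * (3 + 2 * Λ) / l * (η ^ 2 * W) := by
    rw [abs_neg, abs_div, abs_mul, abs_of_nonneg (sq_nonneg (a - a')),
      abs_of_pos (by positivity : 0 < 2 * p)]
    calc _ ≤ η ^ 2 * (5 * (3 + 2 * Λ) * W) / l := by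
          gcongr; linarith
      _ = _ := by ring
  have bound8 : |-(2 * N * (t * ρ))| ≤
      2 * (2 * u ^ 2 / l) * (1 / l ^ 2 * (5 * (3 + 2 * Λ))) * (η ^ 2 * W) := by
    rw [abs_neg, abs_mul, abs_mul t, abs_of_pos ht, abs_of_pos (by positivity : 0 < 2 * N)]
    calc _ ≤ 2 * (2 * u ^ 2 / l) * ((1 / l ^ 2 * η ^ 2) * (5 * (3 + 2 * Λ) * W)) := by gcongr
      _ = _ := by ring
  have bound9 : |(N - m) + -((m - z) ^ 2 / m) + z ^ 2 * b ^ 2 / (m * (4 * m ^ 2 + b ^ 2))| ≤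
      (3 * u / l ^ 2 + 1 / l + u ^ 2 / l ^ 3) * (η ^ 2 * W) := by
    have h1 : (m - z) ^ 2 / m ≤ 1 / l * η ^ 2 := by rw [one_div_mul_eq_div]; gcongr
    have h2 : z ^ 2 * b ^ 2 / (m * (4 * m ^ 2 + b ^ 2)) ≤ u ^ 2 / l ^ 3 * η ^ 2 := by
      have e : u ^ 2 / l ^ 3 * η ^ 2 = u ^ 2 * η ^ 2 / l ^ 3 := by ring
      rw [e]
      refine div_le_div₀ (by positivity) ?_ (by positivity) ?_
      · have : b ^ 2 ≤ η ^ 2 := by linarith [sq_nonneg (a - a')]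
        gcongr
      · calc l ^ 3 = l * l ^ 2 := by ring
          _ ≤ m * (4 * m ^ 2 + b ^ 2) := by
            gcongr
            have : l ^ 2 ≤ m ^ 2 := by gcongr
            linarith [sq_nonneg b, sq_nonneg m]
    have h3 : 0 ≤ (m - z) ^ 2 / m := by positivity
    have h4 : 0 ≤ z ^ 2 * b ^ 2 / (m * (4 * m ^ 2 + b ^ 2)) := by positivity
    have h5 : 0 ≤ 3 * u / l ^ 2 * η ^ 2 := by positivity
    have h6 : 0 ≤ 1 / l * η ^ 2 := by positivity
    have h7 : 0 ≤ u ^ 2 / l ^ 3 * η ^ 2 := by positivity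
    refine le_trans ?_ (mul_le_mul_of_nonneg_left hη2W (by positivity))
    rw [abs_le]
    constructor <;> linarith
  refine (abs_add_le _ _).trans ?_
  rw [add_mul _ (3 * u / l ^ 2 + 1 / l + u ^ 2 / l ^ 3)]
  refine add_le_add ?_ bound9
  iterate 7
    refine (abs_add_le _ _).trans ?_
    rw [add_mul]
    refine add_le_add ?_ (by assumption)
  exact bound1

lemma dist_sq_eq (x x' : Plane) : dist x x' ^ 2 = (x 0 - x' 0) ^ 2 + (x 1 - x' 1) ^ 2 := by
  rw [EuclideanSpace.dist_eq, Real.sq_sqrt (by positivity), Fin.sum_univ_two, Real.dist_eq,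
    Real.dist_eq, sq_abs, sq_abs]

lemma abs_coord_sub_le_dist (x x' : Plane) : |x 0 - x' 0| ≤ dist x x' :=
  abs_le_of_sq_le_sq (by rw [dist_sq_eq]; linarith [sq_nonneg (x 1 - x' 1)]) dist_nonneg

lemma ringVar_eq (x x' : Plane) : ringVar x x' = dist x x' ^ 2 / (4 * x 0 * x' 0) := by
  rw [ringVar, dist_sq_eq, add_comm]

/-- The leading part of `4π` times the symmetrization of `HkerDeriv`. -/
def symmMain (z : ℝ) (x x' : Plane) : ℝ :=
  (x 0 + x' 0) / 2 * (log (8 * z) - 2 - log (dist x x') + (x 0 - x' 0) ^ 2 / dist x x' ^ 2) +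
    3 * ((x 0 + x' 0) / 2 - z)

lemma HkerDeriv_add_swap (c : ℝ) {x x' : Plane} (hx : 0 < x 0) (hx' : 0 < x' 0) (h : x ≠ x') :
    (HkerDeriv c x x' + HkerDeriv c x' x) / 2 = 1 / (4 * π) *
    ((x 0 ^ 2 + x' 0 ^ 2) / (2 * √(x 0 * x' 0)) * ringProfile (dist x x' ^ 2 / (4 * x 0 * x' 0))
      - (x 0 - x' 0) ^ 2 * ringProfileDeriv (dist x x' ^ 2 / (4 * x 0 * x' 0)) /
        (2 * √(x 0 * x' 0))
      - 2 * ((x 0 ^ 2 + x' 0 ^ 2) / (2 * √(x 0 * x' 0))) * (dist x x' ^ 2 / (4 * x 0 * x' 0)) *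
        ringProfileDeriv (dist x x' ^ 2 / (4 * x 0 * x' 0))
      - 2 * c ^ 2 * (x 0 + x' 0) / ((x 0 + x' 0) ^ 2 + (x 1 - x' 1) ^ 2)) := by
  have hsymm : ringVar x' x = ringVar x x' := by
    rw [ringVar_eq, ringVar_eq, dist_comm]; ring
  simp only [HkerDeriv, hsymm]
  rw [← ringVar_eq]
  have hp2 : √(x 0 * x' 0) ^ 2 = x 0 * x' 0 := Real.sq_sqrt (by positivity)
  have hp0 : 0 < √(x 0 * x' 0) := by positivity
  rw [mul_comm (x' 0) (x 0), add_comm (x' 0) (x 0)]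
  have e1 : (x' 0 - x 0) ^ 2 + (x' 1 - x 1) ^ 2 = (x 0 - x' 0) ^ 2 + (x 1 - x' 1) ^ 2 := by ring
  have e2 : (x' 1 - x 1) ^ 2 = (x 1 - x' 1) ^ 2 := by ring
  rw [e1, e2]
  have hd : (x 0 - x' 0) ^ 2 + (x 1 - x' 1) ^ 2 ≠ 0 := by linarith [sq_add_sq_pos_of_ne h]
  have hs : (x 0 + x' 0) ^ 2 + (x 1 - x' 1) ^ 2 ≠ 0 := by positivity
  generalize ringProfile (ringVar x x') = F
  generalize ringProfileDeriv (ringVar x x') = F'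
  generalize ringVar x x' = t
  set p := √(x 0 * x' 0)
  generalize x 0 = a at *
  generalize x' 0 = a' at *
  generalize x 1 - x' 1 = b at *
  have e3 : (a + a') / ((a + a') ^ 2 + b ^ 2) = (a + a') * ((a + a') ^ 2 + b ^ 2)⁻¹ := rfl
  have e4 : ∀ y, y / ((a - a') ^ 2 + b ^ 2) = y * ((a - a') ^ 2 + b ^ 2)⁻¹ := fun y => rfl
  have e5 : 2 * c ^ 2 * (a + a') / ((a + a') ^ 2 + b ^ 2) =
    2 * c ^ 2 * (a + a') * ((a + a') ^ 2 + b ^ 2)⁻¹ := rfl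
  rw [e3, e4, e4, e5]
  generalize ((a + a') ^ 2 + b ^ 2)⁻¹ = P
  generalize ((a - a') ^ 2 + b ^ 2)⁻¹ = Q
  have e6 : a' * p * (F' * ((a - a') / (2 * a * a') - t / a)) =
      F' * ((a' * (a - a') / 2 - a' ^ 2 * t) / p) := by
    have : a' * p = a' * p ^ 2 / p := by field_simp
    rw [this, hp2]
    field_simp
  have e7 : a * p * (F' * ((a' - a) / (2 * a' * a) - t / a')) =
      F' * ((a * (a' - a) / 2 - a ^ 2 * t) / p) := by
    have : a * p = a * p ^ 2 / p := by field_simp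
    rw [this, hp2]
    field_simp
  rw [e6, e7]
  have := pi_pos
  field_simp
  ring

lemma abs_HkerDeriv_le (c : ℝ) {l u : ℝ} (hl : 0 < l) : ∃ C, ∀ x x' : Plane,
    l ≤ x 0 → x 0 ≤ u → l ≤ x' 0 → x' 0 ≤ u → x ≠ x' → dist x x' ≤ 2 * l →
    |HkerDeriv c x x'| ≤ C * (dist x x')⁻¹ := by
  refine ⟨1 * (u ^ 2 / (2 * l) * (4 * u) + u * u * (24 * u ^ 2 / l ^ 2)) + c ^ 2 * 1 * (1 + 1), ?_⟩
  intro x x' h1 h2 h1' h2' hne hd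
  have ha : 0 < x 0 := by linarith
  have ha' : 0 < x' 0 := by linarith
  have hu : 0 < u := by linarith
  have hd0 : 0 < dist x x' := dist_pos.2 hne
  have hda := abs_coord_sub_le_dist x x'
  have hd2 := dist_sq_eq x x'
  have ht := ringVar_pos ha ha' hne
  have hteq := ringVar_eq x x'
  simp only [HkerDeriv]
  rw [← hd2]
  set t := ringVar x x'
  generalize x 0 = a at *
  generalize x' 0 = a' at *
  generalize x 1 - x' 1 = b at *
  set d := dist x x'
  have hp2 : √(a * a') ^ 2 = a * a' := Real.sq_sqrt (by positivity)
  have hp0 : 0 < √(a * a') := by positivity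
  set p := √(a * a')
  have hpl : l ≤ p := Real.le_sqrt_of_sq_le (by rw [sq]; gcongr)
  have hpu : p ≤ u := Real.sqrt_le_iff.2 ⟨hu.le, by rw [sq]; gcongr⟩
  have ht' : t = d ^ 2 / (4 * p ^ 2) := by rw [hteq, hp2]; ring
  have ht1 : t ≤ 1 := by
    rw [ht', div_le_one (by positivity)]
    calc d ^ 2 ≤ (2 * l) ^ 2 := by gcongr
      _ = 4 * l ^ 2 := by ring
      _ ≤ _ := by gcongr
  have hst : √t = d / (2 * p) := by
    rw [ht', show d ^ 2 / (4 * p ^ 2) = (d / (2 * p)) ^ 2 by ring, Real.sqrt_sq (by positivity)]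
  have hF : |ringProfile t| ≤ 4 * u * d⁻¹ := by
    refine (abs_ringProfile_le ht).trans ?_
    rw [hst]
    calc 2 / (d / (2 * p)) = 4 * p * d⁻¹ := by field_simp; norm_num
      _ ≤ _ := by gcongr
  have hF' : |ringProfileDeriv t| ≤ 24 * u ^ 2 * d⁻¹ ^ 2 := by
    have k1 := abs_ringProfileDeriv_add_le ht ht1
    have k2 : |log t| = -log t := abs_of_nonpos (log_nonpos ht.le ht1)
    have k3 := one_sub_inv_le_log_of_pos ht
    have k4 : |ringProfileDeriv t| ≤ 6 * t⁻¹ := by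
      have : 1 / (2 * t) = t⁻¹ / 2 := by field_simp
      rw [this, k2] at k1
      have : 0 < t⁻¹ := by positivity
      rw [abs_le] at k1 ⊢
      constructor <;> linarith
    refine k4.trans ?_
    calc 6 * t⁻¹ = 24 * p ^ 2 * d⁻¹ ^ 2 := by rw [ht']; field_simp; norm_num
      _ ≤ _ := by gcongr
  have hτ : |(a - a') / (2 * a * a') - t / a| ≤ d / l ^ 2 := by
    have k1 : |(a - a') / (2 * a * a')| ≤ d / (2 * l * l) := by
      rw [abs_div, abs_of_pos (by positivity : 0 < 2 * a * a')]
      gcongr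
    have k2 : |t / a| ≤ d / (2 * l * l) := by
      rw [abs_of_pos (by positivity), hteq, div_div]
      calc d ^ 2 / (4 * a * a' * a) ≤ (d * (2 * l)) / (4 * l * l * l) := by
            rw [sq]; gcongr
        _ = _ := by field_simp; norm_num
    calc _ ≤ _ := abs_sub _ _
      _ ≤ d / (2 * l * l) + d / (2 * l * l) := add_le_add k1 k2
      _ = _ := by field_simp; norm_num
  have hS : |(a + a') / ((a + a') ^ 2 + b ^ 2)| ≤ d⁻¹ := by
    rw [abs_of_pos (by positivity), inv_eq_one_div, div_le_div_iff₀ (by positivity) hd0, one_mul]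
    calc (a + a') * d ≤ (a + a') * (a + a') := by gcongr; linarith
      _ ≤ _ := by linarith [sq_nonneg b]
  have hD : |(a - a') / d ^ 2| ≤ d⁻¹ := by
    rw [abs_div, abs_of_pos (by positivity : 0 < d ^ 2), inv_eq_one_div,
      div_le_div_iff₀ (by positivity) hd0, one_mul, sq]
    gcongr
  have h2pi : |1 / (2 * π)| ≤ 1 := by
    rw [abs_of_pos (by positivity), div_le_one (by positivity)]
    linarith [pi_gt_three]
  have hcpi : |c ^ 2 / (2 * π)| ≤ c ^ 2 * 1 := by
    rw [div_eq_mul_one_div, abs_mul, abs_of_nonneg (sq_nonneg c)]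
    gcongr
  have hX : |a' ^ 2 / (2 * p) * ringProfile t| ≤ u ^ 2 / (2 * l) * (4 * u * d⁻¹) := by
    rw [abs_mul, abs_of_pos (by positivity : 0 < a' ^ 2 / (2 * p))]
    gcongr
  have hY : |a' * p * (ringProfileDeriv t * ((a - a') / (2 * a * a') - t / a))| ≤
      u * u * (24 * u ^ 2 * d⁻¹ ^ 2 * (d / l ^ 2)) := by
    rw [abs_mul, abs_of_pos (by positivity : 0 < a' * p), abs_mul]
    gcongr
  calc _ ≤ _ := abs_sub _ _
    _ ≤ 1 * (u ^ 2 / (2 * l) * (4 * u * d⁻¹) + u * u * (24 * u ^ 2 * d⁻¹ ^ 2 * (d / l ^ 2))) +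
        c ^ 2 * 1 * (d⁻¹ + d⁻¹) := by
      rw [abs_mul, abs_mul]
      refine add_le_add (mul_le_mul h2pi ((abs_add_le _ _).trans (add_le_add hX hY))
        (abs_nonneg _) zero_le_one) (mul_le_mul hcpi ((abs_sub _ _).trans (add_le_add hS hD))
        (abs_nonneg _) (by positivity))
    _ = _ := by field_simp

lemma mk2_zero (a b : ℝ) : mk2 a b 0 = a := rfl

lemma one_add_abs_log_le {M ε d : ℝ} (hε : 0 < ε) (hε1 : ε ≤ exp (-1)) (hM : 0 < M)
    (hd : 0 < d) (hdM : d ≤ 2 * (M * ε)) :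
    1 + |log d| ≤ (2 + 2 * M) * (log (1 / ε) + ε * d⁻¹) := by
  have h1 : 1 ≤ log (1 / ε) := by
    rw [one_div, log_inv, le_neg, ← log_exp (-1)]
    exact log_le_log hε hε1
  have h2 : log d = log (d / ε) - log (1 / ε) := by
    rw [log_div hd.ne' hε.ne', one_div, log_inv]; ring
  have h3 := log_le_sub_one_of_pos (div_pos hd hε)
  have h4 := one_sub_inv_le_log_of_pos (div_pos hd hε)
  have h5 : (d / ε)⁻¹ = ε * d⁻¹ := by field_simp
  have h6 : d / ε ≤ 2 * M := by rw [div_le_iff₀ hε]; linarith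
  have h7 : 0 < ε * d⁻¹ := by positivity
  have h8 : |log d| ≤ log (1 / ε) + 2 * M + ε * d⁻¹ := by
    rw [h2, abs_le]
    constructor <;> linarith
  nlinarith

lemma symm_HkerDeriv_expansion {δ M : ℝ} (hδ : 0 < δ) (hM : 0 < M) : ∃ C > 0,
    ∀ ε : ℝ, 0 < ε → ε ≤ exp (-1) → M * ε ≤ δ / 2 → ∀ z : ℝ, δ ≤ z → z ≤ 1 / δ →
    ∀ x ∈ Metric.ball (mk2 z 0) (M * ε), ∀ x' ∈ Metric.ball (mk2 z 0) (M * ε), x ≠ x' →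
    |(HkerDeriv z x x' + HkerDeriv z x' x) / 2 - 1 / (4 * π) * symmMain z x x'| ≤
      C * (ε ^ 2 * (log (1 / ε) + ε * (dist x x')⁻¹)) := by
  obtain ⟨C, hC, h⟩ := symm_kernel_expansion (l := δ / 2) (u := 1 / δ + δ / 2) (by positivity)
  refine ⟨1 * C * (2 * M) ^ 2 * (2 + 2 * M), by positivity, ?_⟩
  intro ε hε hε1 hMε z hz1 hz2 x hx x' hx' hne
  have hxz := (abs_coord_sub_le_dist x (mk2 z 0)).trans (Metric.mem_ball.1 hx).le
  have hxz' := (abs_coord_sub_le_dist x' (mk2 z 0)).trans (Metric.mem_ball.1 hx').le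
  rw [mk2_zero] at hxz hxz'
  have b1 := abs_le.1 hxz
  have b2 := abs_le.1 hxz'
  have hd0 : 0 < dist x x' := dist_pos.2 hne
  have hdd : dist x x' ≤ 2 * (M * ε) := by
    have := dist_triangle_right x x' (mk2 z 0)
    linarith [Metric.mem_ball.1 hx, Metric.mem_ball.1 hx']
  have key := h (x 0) (x' 0) (x 1 - x' 1) z (dist x x') (2 * (M * ε)) (by linarith)
    (by linarith) (by linarith) (by linarith) (by linarith) (by linarith) hd0 (dist_sq_eq x x') hdd
    (by rw [abs_le]; constructor <;> linarith) (by linarith)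
  rw [HkerDeriv_add_swap z (by linarith) (by linarith) hne, symmMain, ← mul_sub, abs_mul]
  have h4pi : |1 / (4 * π)| ≤ 1 := by
    rw [abs_of_pos (by positivity), div_le_one (by positivity)]
    linarith [pi_gt_three]
  calc _ ≤ 1 * (C * ((2 * (M * ε)) ^ 2 * (1 + |log (dist x x')|))) :=
        mul_le_mul h4pi key (abs_nonneg _) zero_le_one
    _ ≤ 1 * (C * ((2 * (M * ε)) ^ 2 * ((2 + 2 * M) * (log (1 / ε) + ε * (dist x x')⁻¹)))) := by
        gcongr; exact one_add_abs_log_le hε hε1 hM hd0 hdd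
    _ = _ := by ring

lemma setIntegral_norm_ball (f : ℝ → ℝ) {s : ℝ} (hs : 0 ≤ s) :
    ∫ x in Metric.ball (0 : Plane) s, f ‖x‖ = 2 * π * ∫ y in (0 : ℝ)..s, y * f y := by
  have h1 : ∫ x in Metric.ball (0 : Plane) s, f ‖x‖ =
      ∫ x : Plane, (Set.Iio s).indicator f ‖x‖ := by
    rw [← integral_indicator Metric.isOpen_ball.measurableSet]
    congr 1; ext x
    simp [Set.indicator]
  have h2 : (volume : Measure Plane).real (Metric.ball 0 1) = π := by
    rw [Measure.real, EuclideanSpace.volume_ball_fin_two]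
    simp [pi_pos.le]
  rw [h1, integral_fun_norm_addHaar, h2, finrank_euclideanSpace_fin,
    intervalIntegral.integral_of_le hs, integral_Ioc_eq_integral_Ioo]
  have h3 : ∫ y in Set.Ioi (0 : ℝ), y ^ (2 - 1) • (Set.Iio s).indicator f y =
      ∫ y in Set.Ioo 0 s, y * f y := by
    rw [← Set.Ioi_inter_Iio, Set.inter_comm, ← Measure.restrict_restrict measurableSet_Iio,
      ← integral_indicator (μ := volume.restrict (Set.Ioi 0)) measurableSet_Iio]
    congr 1; ext y
    simp [Set.indicator]
  rw [h3, nsmul_eq_mul, smul_eq_mul]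
  push_cast; ring

lemma volume_real_ball (x : Plane) {s : ℝ} (hs : 0 ≤ s) :
    (volume : Measure Plane).real (Metric.ball x s) = π * s ^ 2 := by
  rw [Measure.real, EuclideanSpace.volume_ball_fin_two, ENNReal.toReal_mul]
  simp [pi_pos.le, hs]; ring

lemma integrableOn_dist_inv_ball (x : Plane) (s : ℝ) :
    IntegrableOn (fun y => (dist x y)⁻¹) (Metric.ball x s) := by
  have h : IntegrableOn (fun y : Plane => ‖y‖⁻¹) (Metric.ball 0 s) := by
    rw [integrableOn_fun_norm_addHaar (μ := volume) (f := fun r => r⁻¹), finrank_euclideanSpace_fin]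
    refine IntegrableOn.congr_fun (f := fun _ => (1 : ℝ)) (by simp) ?_ measurableSet_Ioo
    intro y hy
    simp [hy.1.ne']
  have := (measurePreserving_sub_right (volume : Measure Plane) x).integrableOn_comp_preimage
    (MeasurableEquiv.subRight x).measurableEmbedding |>.2 h
  refine (this.congr_fun (fun y _ => ?_) ?_).mono_set ?_
  · simp [dist_eq_norm, norm_sub_rev x y]
  · exact (by fun_prop : Measurable fun y : Plane => y - x) Metric.isOpen_ball.measurableSet
  · intro y hy; simpa [dist_eq_norm] using hy

lemma setIntegral_dist_inv_ball (x : Plane) {s : ℝ} (hs : 0 ≤ s) :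
    ∫ y in Metric.ball x s, (dist x y)⁻¹ = 2 * π * s := by
  have := (measurePreserving_sub_right (volume : Measure Plane) x).setIntegral_preimage_emb
    (MeasurableEquiv.subRight x).measurableEmbedding (fun y => ‖y‖⁻¹) (Metric.ball 0 s)
  rw [setIntegral_norm_ball (fun r => r⁻¹) hs] at this
  have h2 : ∫ y in (0 : ℝ)..s, y * y⁻¹ = s := by
    rw [intervalIntegral.integral_of_le hs, setIntegral_congr_fun (g := fun _ => (1 : ℝ))
      measurableSet_Ioc (fun y hy => mul_inv_cancel₀ hy.1.ne')]
    simp [hs]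
  rw [h2] at this
  rw [← this]
  have hb : (fun y => y - x) ⁻¹' Metric.ball 0 s = Metric.ball x s := by
    ext y; simp [dist_eq_norm]
  rw [hb]
  simp [dist_eq_norm, norm_sub_rev x]

lemma measurable_dist_inv : Measurable fun p : Plane × Plane => (dist p.1 p.2)⁻¹ := by fun_prop

lemma integrableOn_dist_inv_section {x z : Plane} {ρ : ℝ} (hx : x ∈ Metric.ball z ρ) :
    IntegrableOn (fun y => (dist x y)⁻¹) (Metric.ball z ρ) ∧
    ∫ y in Metric.ball z ρ, (dist x y)⁻¹ ≤ 4 * π * ρ := by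
  have hsub : Metric.ball z ρ ⊆ Metric.ball x (2 * ρ) :=
    Metric.ball_subset_ball' (by rw [dist_comm]; linarith [Metric.mem_ball.1 hx])
  have hρ : 0 ≤ 2 * ρ := by
    have := dist_nonneg.trans_lt (Metric.mem_ball.1 hx); linarith
  have hi := integrableOn_dist_inv_ball x (2 * ρ)
  refine ⟨hi.mono_set hsub, ?_⟩
  calc _ ≤ ∫ y in Metric.ball x (2 * ρ), (dist x y)⁻¹ :=
        setIntegral_mono_set hi (by filter_upwards with y; positivity) hsub.eventuallyLE
    _ = _ := by rw [setIntegral_dist_inv_ball x hρ]; ring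

lemma integrable_dist_inv_prod {z : Plane} {ρ : ℝ} {S : Set Plane} (hS : MeasurableSet S)
    (hSU : S ⊆ Metric.ball z ρ) :
    IntegrableOn (fun p : Plane × Plane => (dist p.1 p.2)⁻¹) (S ×ˢ Metric.ball z ρ) ∧
    ∫ p in S ×ˢ Metric.ball z ρ, (dist p.1 p.2)⁻¹ ≤ 4 * π * ρ * volume.real S := by
  have hfin : volume S ≠ ⊤ := measure_ne_top_of_subset hSU measure_ball_lt_top.ne
  have : IsFiniteMeasure (volume.restrict S) := ⟨by simpa using hfin.lt_top⟩
  have hint : IntegrableOn (fun p : Plane × Plane => (dist p.1 p.2)⁻¹)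
      (S ×ˢ Metric.ball z ρ) := by
    rw [IntegrableOn, Measure.volume_eq_prod, ← Measure.prod_restrict,
      integrable_prod_iff measurable_dist_inv.aestronglyMeasurable]
    constructor
    · filter_upwards [ae_restrict_mem hS] with x hx
      exact (integrableOn_dist_inv_section (hSU hx)).1
    · refine Integrable.of_bound (C := 4 * π * ρ) ?_ ?_
      · exact (measurable_dist_inv.norm.stronglyMeasurable.integral_prod_right
          (ν := volume.restrict (Metric.ball z ρ))).aestronglyMeasurable
      · filter_upwards [ae_restrict_mem hS] with x hx
        rw [Real.norm_of_nonneg (integral_nonneg fun _ => norm_nonneg _)]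
        simpa using (integrableOn_dist_inv_section (hSU hx)).2
  refine ⟨hint, ?_⟩
  have h2 := hint
  rw [Measure.volume_eq_prod] at h2 ⊢
  rw [setIntegral_prod _ h2]
  calc _ ≤ ∫ x in S, 4 * π * ρ := by
        refine setIntegral_mono_on ?_ (integrable_const _) hS
          fun x hx => (integrableOn_dist_inv_section (hSU hx)).2
        rw [IntegrableOn, ← Measure.prod_restrict] at h2
        exact h2.integral_prod_left
    _ = _ := by rw [setIntegral_const, smul_eq_mul, mul_comm]

lemma abs_log_dist_le {s d : ℝ} (hd : 0 < d) (hds : d ≤ s) :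
    |log d| ≤ (s ^ 2 + 1) * d⁻¹ := by
  have h3 := log_le_sub_one_of_pos hd
  have h4 := one_sub_inv_le_log_of_pos hd
  have h5 : d * d ≤ s ^ 2 := by nlinarith
  have h6 : d ≤ s ^ 2 * d⁻¹ := by rw [← div_eq_mul_inv, le_div_iff₀ hd]; exact h5
  have h7 : 0 < d⁻¹ := by positivity
  rw [abs_le]; constructor <;> nlinarith [sq_nonneg s]

lemma integrableOn_log_dist {x : Plane} {s : ℝ} (hx : x ∈ Metric.ball 0 s) :
    IntegrableOn (fun y => log (dist x y)) (Metric.ball 0 s) := by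
  refine (((integrableOn_dist_inv_section hx).1.const_mul ((2 * s) ^ 2 + 1))).mono'
    (measurable_log.comp (by fun_prop : Measurable fun y => dist x y)).aestronglyMeasurable ?_
  filter_upwards [ae_restrict_mem Metric.isOpen_ball.measurableSet,
    compl_mem_ae_iff.2 (measure_singleton x)] with y hy hne
  refine abs_log_dist_le (dist_pos.2 fun h => hne h.symm) ?_
  have := dist_triangle_right x y 0
  linarith [Metric.mem_ball.1 hx, Metric.mem_ball.1 hy]

/-- Rotation of the plane by the angle `θ`. -/
def planeRotation (θ : ℝ) : Plane ≃ₗᵢ[ℝ] Plane :=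
  (Complex.orthonormalBasisOneI.repr.symm.trans (rotation (Circle.exp θ))).trans
    Complex.orthonormalBasisOneI.repr

lemma dist_planeRotation (θ : ℝ) (x y : Plane) :
    dist x (planeRotation θ y) = ‖Complex.exp (θ * Complex.I) *
      Complex.orthonormalBasisOneI.repr.symm y - Complex.orthonormalBasisOneI.repr.symm x‖ := by
  rw [← Complex.orthonormalBasisOneI.repr.symm.dist_map, dist_comm, dist_eq_norm]
  simp [planeRotation]

lemma integral_log_dist_planeRotation (x : Plane) {y : Plane} (hy : y ≠ 0) :
    ∫ θ in (0 : ℝ)..2 * π, log (dist x (planeRotation θ y)) =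
      2 * π * (log ‖y‖ + log⁺ (‖y‖⁻¹ * ‖x‖)) := by
  set b := Complex.orthonormalBasisOneI.repr.symm y with hb
  set a := Complex.orthonormalBasisOneI.repr.symm x with ha
  have hbn : ‖b‖ = ‖y‖ := LinearIsometryEquiv.norm_map _ _
  have han : ‖a‖ = ‖x‖ := LinearIsometryEquiv.norm_map _ _
  have hy0 : ‖y‖ ≠ 0 := norm_ne_zero_iff.2 hy
  have hb0 : b ≠ 0 := norm_ne_zero_iff.1 (hbn ▸ hy0)
  have hbc : (‖b‖ : ℂ) ≠ 0 := by simpa using hb0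
  have key := circleAverage_log_norm_sub_const_eq_log_radius_add_posLog
    (c := 0) (R := ‖b‖) (a := a * ‖b‖ / b) (by rw [hbn]; exact hy0)
  have hna : ‖(0 : ℂ) - a * ‖b‖ / b‖ = ‖x‖ := by
    rw [zero_sub, norm_neg, norm_div, norm_mul, han]
    simp [hb0]
  rw [hna, circleAverage_def, hbn, smul_eq_mul] at key
  rw [← key, ← mul_assoc, mul_inv_cancel₀ (by positivity), one_mul]
  congr 1; ext θ
  rw [dist_planeRotation, ← hb, ← ha]
  congr 1
  have : Complex.exp (θ * Complex.I) * b - a =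
      (b / ‖b‖) * (circleMap 0 ‖y‖ θ - a * ‖b‖ / b) := by
    rw [circleMap, ← hbn]
    field_simp
    ring
  rw [this, norm_mul, norm_div, ← hbn]
  simp [hb0]

lemma integral_log_dist_ball {x : Plane} {s : ℝ} (hx : x ∈ Metric.ball 0 s) :
    ∫ y in Metric.ball (0 : Plane) s, log (dist x y) =
      π * s ^ 2 * log s - π * s ^ 2 / 2 + π / 2 * ‖x‖ ^ 2 := by
  have hs : 0 < s := dist_nonneg.trans_lt hx
  set U := Metric.ball (0 : Plane) s
  have hpre : ∀ θ, planeRotation θ ⁻¹' U = U := fun θ => by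
    ext y; simp [U]
  have hmp : ∀ θ, ∀ g : Plane → ℝ, ∫ y in U, g (planeRotation θ y) = ∫ y in U, g y := by
    intro θ g
    have := (planeRotation θ).measurePreserving.setIntegral_preimage_emb
      (planeRotation θ).toHomeomorph.measurableEmbedding g U
    rwa [hpre] at this
  have hmi : ∀ θ, ∀ g : Plane → ℝ, IntegrableOn g U →
      IntegrableOn (fun y => g (planeRotation θ y)) U := by
    intro θ g hg
    have := ((planeRotation θ).measurePreserving.integrableOn_comp_preimage
      (planeRotation θ).toHomeomorph.measurableEmbedding (f := g) (s := U)).2 hg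
    rwa [hpre] at this
  have hlog := integrableOn_log_dist hx
  have hmeas : Measurable fun p : ℝ × Plane => log (dist x (planeRotation p.1 p.2)) := by
    simp_rw [dist_planeRotation]
    fun_prop
  have hint : Integrable (fun p : ℝ × Plane => log (dist x (planeRotation p.1 p.2)))
      ((volume.restrict (Set.Ioc 0 (2 * π))).prod (volume.restrict U)) := by
    rw [integrable_prod_iff hmeas.aestronglyMeasurable]
    refine ⟨Eventually.of_forall fun θ => hmi θ _ hlog, ?_⟩
    have : (fun θ => ∫ y in U, ‖log (dist x (planeRotation θ y))‖) =
        fun _ => ∫ y in U, ‖log (dist x y)‖ := by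
      ext θ; exact hmp θ (fun y => ‖log (dist x y)‖)
    rw [this]
    exact integrable_const _
  have hsw := integral_integral_swap (f := fun θ y => log (dist x (planeRotation θ y))) hint
  have hl : ∫ θ in Set.Ioc 0 (2 * π), ∫ y in U, log (dist x (planeRotation θ y)) =
      2 * π * ∫ y in U, log (dist x y) := by
    have : (fun θ => ∫ y in U, log (dist x (planeRotation θ y))) =
        fun _ => ∫ y in U, log (dist x y) := by
      ext θ; exact hmp θ (fun y => log (dist x y))
    rw [this, setIntegral_const]
    simp [pi_pos.le]
  have hr : ∫ y in U, ∫ θ in Set.Ioc 0 (2 * π), log (dist x (planeRotation θ y)) =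
      2 * π * ∫ y in U, (log ‖y‖ + log⁺ (‖y‖⁻¹ * ‖x‖)) := by
    rw [← integral_const_mul]
    refine integral_congr_ae ?_
    filter_upwards [ae_restrict_of_ae (compl_mem_ae_iff.2 (measure_singleton (0 : Plane)))]
      with y hy
    rw [← intervalIntegral.integral_of_le (by positivity)]
    exact integral_log_dist_planeRotation x hy
  have heq : ∫ y in U, log (dist x y) = ∫ y in U, (log ‖y‖ + log⁺ (‖y‖⁻¹ * ‖x‖)) := by
    have : 2 * π * ∫ y in U, log (dist x y) =
        2 * π * ∫ y in U, (log ‖y‖ + log⁺ (‖y‖⁻¹ * ‖x‖)) := by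
      rw [← hl, ← hr]; exact hsw
    exact mul_left_cancel₀ (by positivity) this
  rw [heq, setIntegral_norm_ball (fun r => log r + log⁺ (r⁻¹ * ‖x‖)) hs.le]
  set a := ‖x‖ with ha
  have ha0 : 0 ≤ a := norm_nonneg x
  have has : a < s := mem_ball_zero_iff.1 hx
  have c1 : Set.EqOn (fun r => r * log a) (fun r => r * (log r + log⁺ (r⁻¹ * a)))
      (Set.uIoc 0 a) := by
    intro r hr
    rw [Set.uIoc_of_le ha0] at hr
    have h1 : 1 ≤ r⁻¹ * a := by
      rw [inv_mul_eq_div, le_div_iff₀ hr.1]; linarith [hr.2]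
    have ha1 : 0 < a := hr.1.trans_le hr.2
    simp only
    rw [posLog_eq_log (by rwa [abs_of_nonneg (by linarith)]),
      log_mul (inv_ne_zero hr.1.ne') ha1.ne', log_inv]
    ring
  have c2 : Set.EqOn (fun r => r * log r) (fun r => r * (log r + log⁺ (r⁻¹ * a)))
      (Set.uIoc a s) := by
    intro r hr
    rw [Set.uIoc_of_le has.le] at hr
    have hr0 : 0 < r := ha0.trans_lt hr.1
    have h1 : r⁻¹ * a ≤ 1 := by
      rw [inv_mul_eq_div, div_le_one hr0]; exact hr.1.le
    simp only
    rw [posLog_eq_zero_iff _ |>.2 (by rwa [abs_of_nonneg (by positivity)])]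
    ring
  have e1 : ∫ r in (0 : ℝ)..a, r * log a = a ^ 2 / 2 * log a := by
    rw [intervalIntegral.integral_mul_const, integral_id]; ring
  have e2 : ∫ r in a..s, r * log r =
      (s ^ 2 / 2 * log s - s ^ 2 / 4) - (a ^ 2 / 2 * log a - a ^ 2 / 4) := by
    have hc : Continuous fun r : ℝ => r ^ 2 / 2 * log r - r ^ 2 / 4 := by
      have : (fun r : ℝ => r ^ 2 / 2 * log r - r ^ 2 / 4) =
          fun r => r / 2 * (r * log r) - r ^ 2 / 4 := by ext r; ring
      rw [this]
      have := continuous_mul_log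
      fun_prop
    refine intervalIntegral.integral_eq_sub_of_hasDerivAt_of_le has.le hc.continuousOn ?_
      (continuous_mul_log.intervalIntegrable _ _)
    intro r hr
    have hr0 : r ≠ 0 := (ha0.trans_lt hr.1).ne'
    have := (((hasDerivAt_pow 2 r).div_const 2).mul (hasDerivAt_log hr0)).sub
      ((hasDerivAt_pow 2 r).div_const 4)
    refine this.congr_deriv ?_
    field_simp
    push_cast
    ring
  have i1 : IntervalIntegrable (fun r => r * log a) volume 0 a :=
    (continuous_mul_const _).intervalIntegrable _ _
  have i2 : IntervalIntegrable (fun r => r * log r) volume a s :=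
    continuous_mul_log.intervalIntegrable _ _
  rw [← intervalIntegral.integral_add_adjacent_intervals (i1.congr c1) (i2.congr c2),
    ← intervalIntegral.integral_congr_ae (Eventually.of_forall c1),
    ← intervalIntegral.integral_congr_ae (Eventually.of_forall c2), e1, e2]
  ring

lemma ae_fst_ne_snd : ∀ᵐ p : Plane × Plane, p.1 ≠ p.2 := by
  have hm : MeasurableSet {p : Plane × Plane | p.1 = p.2} :=
    measurableSet_eq_fun measurable_fst measurable_snd
  have : (volume : Measure (Plane × Plane)) {p : Plane × Plane | p.1 = p.2} = 0 := by
    rw [Measure.volume_eq_prod, Measure.measure_prod_null hm]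
    refine Eventually.of_forall fun x => ?_
    have : Prod.mk x ⁻¹' {p : Plane × Plane | p.1 = p.2} = {x} := by
      ext y; simp [eq_comm]
    show volume _ = 0
    rw [this]; simp
  exact compl_mem_ae_iff.2 this

lemma integrableOn_of_abs_le_dist_inv {f : Plane × Plane → ℝ} (hf : Measurable f) {z : Plane}
    {ρ C : ℝ} (hC : 0 ≤ C)
    (hbd : ∀ x ∈ Metric.ball z ρ, ∀ x' ∈ Metric.ball z ρ, x ≠ x' →
      |f (x, x')| ≤ C * (dist x x')⁻¹)
    {S : Set Plane} (hS : MeasurableSet S) (hSU : S ⊆ Metric.ball z ρ) :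
    IntegrableOn f (S ×ˢ Metric.ball z ρ) ∧
    ∫ p in S ×ˢ Metric.ball z ρ, |f p| ≤ C * (4 * π * ρ * volume.real S) := by
  obtain ⟨h1, h2⟩ := integrable_dist_inv_prod hS hSU
  have hms : MeasurableSet (S ×ˢ Metric.ball z ρ) := hS.prod Metric.isOpen_ball.measurableSet
  have hae : ∀ᵐ p ∂(volume.restrict (S ×ˢ Metric.ball z ρ)),
      |f p| ≤ C * (dist p.1 p.2)⁻¹ := by
    filter_upwards [ae_restrict_mem hms, ae_restrict_of_ae ae_fst_ne_snd] with p hp hne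
    exact hbd p.1 (hSU hp.1) p.2 hp.2 hne
  have hi : IntegrableOn f (S ×ˢ Metric.ball z ρ) :=
    (h1.const_mul C).mono' hf.aestronglyMeasurable hae
  refine ⟨hi, ?_⟩
  calc _ ≤ ∫ p in S ×ˢ Metric.ball z ρ, C * (dist p.1 p.2)⁻¹ :=
        integral_mono_ae hi.abs (h1.const_mul C) hae
    _ = C * ∫ p in S ×ˢ Metric.ball z ρ, (dist p.1 p.2)⁻¹ := integral_const_mul _ _
    _ ≤ _ := by gcongr

lemma setIntegral_prod_self_map {e : Plane ≃ᵐ Plane} (he : MeasurePreserving e) (S : Set Plane)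
    (f : Plane × Plane → ℝ) :
    ∫ p in (e ⁻¹' S) ×ˢ (e ⁻¹' S), f (e p.1, e p.2) = ∫ p in S ×ˢ S, f p := by
  have h := (he.prod he).setIntegral_preimage_emb
    (e.measurableEmbedding.prodMap e.measurableEmbedding) f (S ×ˢ S)
  rw [Set.preimage_prod_map_prod] at h
  exact h

lemma setIntegral_prod_self_swap (S : Set Plane) (f : Plane × Plane → ℝ) :
    ∫ p in S ×ˢ S, f (p.2, p.1) = ∫ p in S ×ˢ S, f p := by
  have h := (Measure.measurePreserving_swap (μ := (volume : Measure Plane))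
    (ν := (volume : Measure Plane))).setIntegral_preimage_emb
    MeasurableEquiv.prodComm.measurableEmbedding f (S ×ˢ S)
  rw [Set.preimage_swap_prod] at h
  exact h

lemma abs_setIntegral_sub_le {X : Type*} [MeasurableSpace X] {μ : Measure X} {f : X → ℝ}
    {S T : Set X} (hS : MeasurableSet S) (hT : MeasurableSet T) (hf : IntegrableOn f (S ∪ T) μ) :
    |(∫ x in S, f x ∂μ) - ∫ x in T, f x ∂μ| ≤ ∫ x in symmDiff S T, |f x| ∂μ := by
  have hfS := hf.mono_set Set.subset_union_left
  have hfT := hf.mono_set Set.subset_union_right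
  have e1 := integral_inter_add_sdiff hT hfS
  have e2 := integral_inter_add_sdiff hS hfT
  have hd1 := hfS.mono_set (Set.sdiff_subset (t := T))
  have hd2 := hfT.mono_set (Set.sdiff_subset (t := S))
  have e3 : ∫ x in symmDiff S T, |f x| ∂μ =
      (∫ x in S \ T, |f x| ∂μ) + ∫ x in T \ S, |f x| ∂μ :=
    setIntegral_union disjoint_sdiff_sdiff (hT.diff hS) hd1.abs hd2.abs
  have e4 := abs_integral_le_integral_abs (f := f) (μ := μ.restrict (S \ T))
  have e5 := abs_integral_le_integral_abs (f := f) (μ := μ.restrict (T \ S))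
  rw [e3, ← e1, ← e2, Set.inter_comm T S]
  rw [abs_le] at *
  constructor <;> linarith [e4.1, e4.2, e5.1, e5.2]

lemma abs_setIntegral_prod_sub_le {f : Plane × Plane → ℝ} (hf : Measurable f) {z : Plane}
    {ρ C : ℝ} (hC : 0 ≤ C)
    (hbd : ∀ x ∈ Metric.ball z ρ, ∀ x' ∈ Metric.ball z ρ, x ≠ x' →
      |f (x, x')| ≤ C * (dist x x')⁻¹)
    {S T : Set Plane} (hS : MeasurableSet S) (hSU : S ⊆ Metric.ball z ρ)
    (hT : MeasurableSet T) (hTU : T ⊆ Metric.ball z ρ) :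
    |(∫ p in S ×ˢ S, f p) - ∫ p in T ×ˢ T, f p| ≤
      2 * C * (4 * π * ρ * volume.real (symmDiff S T)) := by
  set U := Metric.ball z ρ
  have hU : MeasurableSet U := Metric.isOpen_ball.measurableSet
  have hfull := (integrableOn_of_abs_le_dist_inv hf hC hbd hU subset_rfl).1
  have hST := hS.symmDiff hT
  have hSTU : symmDiff S T ⊆ U := by
    rintro x (hx | hx)
    exacts [hSU hx.1, hTU hx.1]
  have step1 := abs_setIntegral_sub_le (hS.prod hS) (hT.prod hT)
    (hfull.mono_set (Set.union_subset (Set.prod_mono hSU hSU) (Set.prod_mono hTU hTU)))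
  have hsub : symmDiff (S ×ˢ S) (T ×ˢ T) ⊆ (symmDiff S T ×ˢ U) ∪ (U ×ˢ symmDiff S T) := by
    rintro ⟨x, y⟩ h
    simp only [Set.mem_symmDiff, Set.mem_prod, Set.mem_union] at h ⊢
    have := @hSU x; have := @hSU y; have := @hTU x; have := @hTU y
    tauto
  obtain ⟨a1, a2⟩ := integrableOn_of_abs_le_dist_inv hf hC hbd hST hSTU
  obtain ⟨b1, b2⟩ := integrableOn_of_abs_le_dist_inv (f := fun p => f (p.2, p.1))
    (hf.comp measurable_swap) hC
    (fun x hx x' hx' h => by rw [dist_comm]; exact hbd x' hx' x hx h.symm) hST hSTU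
  have hsw := (Measure.measurePreserving_swap (μ := (volume : Measure Plane))
    (ν := (volume : Measure Plane))).setIntegral_preimage_emb
    MeasurableEquiv.prodComm.measurableEmbedding (fun p => |f p|) (U ×ˢ symmDiff S T)
  rw [Set.preimage_swap_prod] at hsw
  have hsw' : ∫ p in U ×ˢ symmDiff S T, |f p| ≤ C * (4 * π * ρ * volume.real (symmDiff S T)) := by
    rw [Measure.volume_eq_prod, ← hsw]; exact b2
  have hU2 : IntegrableOn f (U ×ˢ symmDiff S T) := hfull.mono_set (Set.prod_mono subset_rfl hSTU)
  calc _ ≤ ∫ p in symmDiff (S ×ˢ S) (T ×ˢ T), |f p| := step1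
    _ ≤ ∫ p in (symmDiff S T ×ˢ U) ∪ (U ×ˢ symmDiff S T), |f p| :=
        setIntegral_mono_set (a1.union hU2).abs (Eventually.of_forall fun _ => abs_nonneg _)
          hsub.eventuallyLE
    _ ≤ (∫ p in symmDiff S T ×ˢ U, |f p|) + ∫ p in U ×ˢ symmDiff S T, |f p| := by
        rw [← integral_add_measure a1.abs hU2.abs]
        refine integral_mono_measure (Measure.restrict_union_le _ _)
          (Eventually.of_forall fun _ => abs_nonneg _) (a1.abs.add_measure hU2.abs)
    _ ≤ _ := by linarith

/-- The squared cosine of the angle between `x − x'` and the first axis. -/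
def cosSq (p : Plane × Plane) : ℝ := (p.1 0 - p.2 0) ^ 2 / dist p.1 p.2 ^ 2

lemma measurable_cosSq : Measurable cosSq := by unfold cosSq; fun_prop

lemma measurable_log_dist : Measurable fun p : Plane × Plane => log (dist p.1 p.2) :=
  measurable_log.comp (by fun_prop)

lemma cosSq_nonneg (p : Plane × Plane) : 0 ≤ cosSq p := by unfold cosSq; positivity

lemma cosSq_le_one (p : Plane × Plane) : cosSq p ≤ 1 := by
  unfold cosSq
  refine div_le_one_of_le₀ ?_ (by positivity)
  rw [dist_sq_eq]; linarith [sq_nonneg (p.1 1 - p.2 1)]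

lemma integrableOn_log_dist_prod (z : Plane) (s : ℝ) :
    IntegrableOn (fun p : Plane × Plane => log (dist p.1 p.2))
      (Metric.ball z s ×ˢ Metric.ball z s) := by
  refine (integrableOn_of_abs_le_dist_inv measurable_log_dist (C := (2 * s) ^ 2 + 1)
    (by positivity) (fun x hx x' hx' hne => ?_) Metric.isOpen_ball.measurableSet subset_rfl).1
  refine abs_log_dist_le (dist_pos.2 hne) ?_
  have := dist_triangle_right x x' z
  linarith [Metric.mem_ball.1 hx, Metric.mem_ball.1 hx']

lemma volume_ball_prod_lt_top (z : Plane) (s : ℝ) :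
    (volume : Measure (Plane × Plane)) (Metric.ball z s ×ˢ Metric.ball z s) < ⊤ := by
  rw [Measure.volume_eq_prod, Measure.prod_prod]
  exact ENNReal.mul_lt_top measure_ball_lt_top measure_ball_lt_top

lemma integrableOn_cosSq (z : Plane) (s : ℝ) :
    IntegrableOn cosSq (Metric.ball z s ×ˢ Metric.ball z s) :=
  Measure.integrableOn_of_bounded (M := 1) (volume_ball_prod_lt_top z s).ne
    measurable_cosSq.aestronglyMeasurable
    (Eventually.of_forall fun p => by
      rw [Real.norm_of_nonneg (cosSq_nonneg p)]; exact cosSq_le_one p)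

lemma integral_log_dist_ball_prod {s : ℝ} (hs : 0 ≤ s) :
    ∫ p in Metric.ball (0 : Plane) s ×ˢ Metric.ball (0 : Plane) s, log (dist p.1 p.2) =
      (π * s ^ 2) ^ 2 * (log s - 1 / 4) := by
  have h := integrableOn_log_dist_prod 0 s
  rw [Measure.volume_eq_prod] at h ⊢
  rw [setIntegral_prod _ h]
  rw [setIntegral_congr_fun Metric.isOpen_ball.measurableSet
    (fun x hx => integral_log_dist_ball hx),
    setIntegral_norm_ball (fun r => π * s ^ 2 * log s - π * s ^ 2 / 2 + π / 2 * r ^ 2) hs]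
  have : ∫ y in (0 : ℝ)..s, y * (π * s ^ 2 * log s - π * s ^ 2 / 2 + π / 2 * y ^ 2) =
      (π * s ^ 2 * log s - π * s ^ 2 / 2) * (s ^ 2 / 2) + π / 2 * (s ^ 4 / 4) := by
    have e : (fun y : ℝ => y * (π * s ^ 2 * log s - π * s ^ 2 / 2 + π / 2 * y ^ 2)) =
        fun y => (π * s ^ 2 * log s - π * s ^ 2 / 2) * y + π / 2 * y ^ 3 := by ext y; ring
    rw [e, intervalIntegral.integral_add (Continuous.intervalIntegrable (by fun_prop) _ _)
      (Continuous.intervalIntegrable (by fun_prop) _ _), intervalIntegral.integral_const_mul,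
      intervalIntegral.integral_const_mul, integral_id, integral_pow]
    norm_num
  rw [this]; ring

lemma integral_cosSq_ball_prod {s : ℝ} (hs : 0 ≤ s) :
    ∫ p in Metric.ball (0 : Plane) s ×ˢ Metric.ball (0 : Plane) s, cosSq p =
      (π * s ^ 2) ^ 2 / 2 := by
  set e := LinearIsometryEquiv.piLpCongrLeft 2 ℝ ℝ (Equiv.swap (0 : Fin 2) 1) with he
  have e0 : ∀ x : Plane, e x 0 = x 1 := fun x => by simp [e]
  have e1 : ∀ x : Plane, e x 1 = x 0 := fun x => by simp [e]
  set B := Metric.ball (0 : Plane) s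
  have hpre : e.toMeasurableEquiv ⁻¹' B = B := by
    ext x
    show e x ∈ B ↔ x ∈ B
    simp [B]
  have h := setIntegral_prod_self_map (e := e.toMeasurableEquiv) e.measurePreserving B cosSq
  rw [hpre] at h
  have hi := integrableOn_cosSq 0 s
  have i1 := integrableOn_const (C := (1 : ℝ)) (volume_ball_prod_lt_top (0 : Plane) s).ne
  rw [IntegrableOn] at hi i1
  have hsum : ∀ᵐ p : Plane × Plane,
      cosSq (e.toMeasurableEquiv p.1, e.toMeasurableEquiv p.2) = 1 - cosSq p := by
    filter_upwards [ae_fst_ne_snd] with p hp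
    show (e p.1 0 - e p.2 0) ^ 2 / dist (e p.1) (e p.2) ^ 2 = _
    have hd : dist p.1 p.2 ^ 2 ≠ 0 := pow_ne_zero 2 (dist_pos.2 hp).ne'
    rw [e.dist_map, e0, e0, cosSq, eq_sub_iff_add_eq, ← add_div, div_eq_one_iff_eq hd, dist_sq_eq]
    ring
  rw [integral_congr_ae (ae_restrict_of_ae hsum),
    integral_sub i1 hi,
    setIntegral_const, Measure.volume_eq_prod, measureReal_prod_prod,
    volume_real_ball _ hs] at h
  rw [Measure.volume_eq_prod]
  simp only [smul_eq_mul, mul_one] at h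
  linarith

/-- The density `(x₁ + x₁')/2 · (ln (s/|x − x'|) + cos²)`. -/
def discKernel (s : ℝ) (p : Plane × Plane) : ℝ :=
  (p.1 0 + p.2 0) / 2 * (log s - log (dist p.1 p.2) + cosSq p)

lemma measurable_discKernel (s : ℝ) : Measurable (discKernel s) := by
  have := measurable_cosSq
  have := measurable_log_dist
  unfold discKernel
  fun_prop

lemma abs_discKernel_le {s ρ u : ℝ} (hs : 0 < s) {z : Plane} {x x' : Plane} (hx : x ∈ Metric.ball z ρ)
    (hx' : x' ∈ Metric.ball z ρ) (hne : x ≠ x') (hxu : |x 0| ≤ u) (hxu' : |x' 0| ≤ u) :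
    |discKernel s (x, x')| ≤ u * (s + 4 * ρ ^ 2 / s + 2 * ρ) * (dist x x')⁻¹ := by
  have hd := dist_pos.2 hne
  have hdρ : dist x x' ≤ 2 * ρ := by
    have := dist_triangle_right x x' z
    linarith [Metric.mem_ball.1 hx, Metric.mem_ball.1 hx']
  have hlog : log s - log (dist x x') = log (s / dist x x') := (log_div hs.ne' hd.ne').symm
  have h3 := log_le_sub_one_of_pos (div_pos hs hd)
  have h4 := one_sub_inv_le_log_of_pos (div_pos hs hd)
  have hu : 0 ≤ u := (abs_nonneg _).trans hxu
  have h5 : (s / dist x x')⁻¹ ≤ 4 * ρ ^ 2 / s * (dist x x')⁻¹ := by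
    rw [inv_div, div_mul_eq_mul_div, div_le_div_iff_of_pos_right hs, ← div_eq_mul_inv,
      le_div_iff₀ hd]
    nlinarith
  have h6 : 1 ≤ 2 * ρ * (dist x x')⁻¹ := by
    rw [← div_eq_mul_inv, le_div_iff₀ hd]; linarith
  have h7 : s / dist x x' = s * (dist x x')⁻¹ := div_eq_mul_inv _ _
  have h8 : 0 < s * (dist x x')⁻¹ := by positivity
  have h9 : 0 ≤ 4 * ρ ^ 2 / s * (dist x x')⁻¹ := by positivity
  have c0 := cosSq_nonneg (x, x')
  have c1 := cosSq_le_one (x, x')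
  have hA : |(x 0 + x' 0) / 2| ≤ u := by
    rw [abs_le] at *; constructor <;> linarith [hxu.1, hxu.2, hxu'.1, hxu'.2]
  have hB : |log s - log (dist x x') + cosSq (x, x')| ≤
      (s + 4 * ρ ^ 2 / s + 2 * ρ) * (dist x x')⁻¹ := by
    rw [hlog, abs_le]; constructor <;> nlinarith
  calc |discKernel s (x, x')| = |(x 0 + x' 0) / 2| * |log s - log (dist x x') + cosSq (x, x')| := by
        rw [discKernel, abs_mul]
    _ ≤ u * ((s + 4 * ρ ^ 2 / s + 2 * ρ) * (dist x x')⁻¹) := by gcongr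
    _ = _ := by ring

lemma integral_discKernel_ball (z : Plane) {s : ℝ} (hs : 0 < s) :
    ∫ p in Metric.ball z s ×ˢ Metric.ball z s, discKernel s p =
      3 / 4 * z 0 * (π * s ^ 2) ^ 2 := by
  set B := Metric.ball z s with hB
  set B0 := Metric.ball (0 : Plane) s with hB0
  let h : Plane × Plane → ℝ := fun p => log s - log (dist p.1 p.2) + cosSq p
  have hi : IntegrableOn h (B ×ˢ B) :=
    ((integrableOn_const (volume_ball_prod_lt_top z s).ne).sub
      (integrableOn_log_dist_prod z s)).add (integrableOn_cosSq z s)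
  have hi0 : ∫ p in B0 ×ˢ B0, h p = 3 / 4 * (π * s ^ 2) ^ 2 := by
    have i1 := integrableOn_const (C := log s) (volume_ball_prod_lt_top (0 : Plane) s).ne
    have i2 := integrableOn_log_dist_prod 0 s
    have i3 := integral_add (i1.sub i2) (integrableOn_cosSq 0 s)
    simp only [Pi.sub_apply] at i3
    rw [i3, integral_sub i1 i2,
      integral_log_dist_ball_prod hs.le, integral_cosSq_ball_prod hs.le, setIntegral_const,
      Measure.volume_eq_prod, measureReal_prod_prod, volume_real_ball _ hs.le, smul_eq_mul]
    ring
  have htr : ∫ p in B ×ˢ B, h p = 3 / 4 * (π * s ^ 2) ^ 2 := by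
    have := setIntegral_prod_self_map (e := MeasurableEquiv.subRight z)
      (measurePreserving_sub_right volume z) B0 h
    have hpre : MeasurableEquiv.subRight z ⁻¹' B0 = B := by
      ext y
      show y - z ∈ B0 ↔ y ∈ B
      rw [hB0, mem_ball_zero_iff, hB, mem_ball_iff_norm]
    rw [hpre, hi0] at this
    rw [← this]
    congr 1; ext p
    show h p = h (p.1 - z, p.2 - z)
    simp [h, cosSq]
  have hrefl := setIntegral_prod_self_map (e := MeasurableEquiv.subLeft (z + z))
      (Measure.measurePreserving_sub_left volume (z + z)) B (discKernel s)
  have hpre : MeasurableEquiv.subLeft (z + z) ⁻¹' B = B := by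
    ext y
    show (z + z) - y ∈ B ↔ y ∈ B
    rw [hB, mem_ball_iff_norm, mem_ball_iff_norm', add_sub_right_comm, add_sub_cancel_right]
  rw [hpre] at hrefl
  have hpt : ∀ p : Plane × Plane, discKernel s (MeasurableEquiv.subLeft (z + z) p.1,
      MeasurableEquiv.subLeft (z + z) p.2) = 2 * z 0 * h p - discKernel s p := by
    intro p
    show discKernel s (z + z - p.1, z + z - p.2) = _
    have e1 : (p.2 0 - p.1 0) ^ 2 = (p.1 0 - p.2 0) ^ 2 := by ring
    simp only [discKernel, h, cosSq, dist_sub_left, PiLp.sub_apply, PiLp.add_apply,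
      sub_sub_sub_cancel_left, e1]
    ring
  have hdi : IntegrableOn (discKernel s) (B ×ˢ B) := by
    have hu : ∀ x ∈ B, |x 0| ≤ |z 0| + s := fun x hx => by
      have := abs_coord_sub_le_dist x z
      have h2 := abs_sub_abs_le_abs_sub (x 0) (z 0)
      linarith [Metric.mem_ball.1 hx]
    exact (integrableOn_of_abs_le_dist_inv (measurable_discKernel s)
      (C := (|z 0| + s) * (s + 4 * s ^ 2 / s + 2 * s)) (by positivity)
      (fun x hx x' hx' hne => abs_discKernel_le hs hx hx' hne (hu x hx) (hu x' hx'))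
      Metric.isOpen_ball.measurableSet subset_rfl).1
  simp_rw [hpt] at hrefl
  rw [integral_sub (hi.const_mul _) hdi, integral_const_mul, htr] at hrefl
  linarith

lemma measurable_HkerDeriv (c : ℝ) : Measurable fun p : Plane × Plane => HkerDeriv c p.1 p.2 := by
  have hv : Measurable fun p : Plane × Plane => ringVar p.1 p.2 := by unfold ringVar; fun_prop
  have h1 := measurable_ringProfile.comp hv
  have h2 := measurable_ringProfileDeriv.comp hv
  simp only [Function.comp_def] at h1 h2
  unfold HkerDeriv
  fun_prop

lemma symmMain_eq (z s : ℝ) (hz : 0 < z) (hs : 0 < s) (p : Plane × Plane) :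
    symmMain z p.1 p.2 = (log (8 * z / s) + 1) * ((p.1 0 + p.2 0) / 2) + discKernel s p - 3 * z := by
  rw [symmMain, discKernel, cosSq, log_div (by positivity) hs.ne']
  ring

lemma abs_coord_mk2_le {z ρ : ℝ} {x : Plane} (hx : x ∈ Metric.ball (mk2 z 0) ρ) :
    |x 0 - z| ≤ ρ :=
  (abs_coord_sub_le_dist x (mk2 z 0)).trans (Metric.mem_ball.1 hx).le

lemma integrableOn_coord {z ρ : ℝ} {S : Set Plane} (hS : MeasurableSet S)
    (hSU : S ⊆ Metric.ball (mk2 z 0) ρ) : IntegrableOn (fun x : Plane => x 0) S := by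
  refine Measure.integrableOn_of_bounded (M := |z| + ρ)
    (measure_ne_top_of_subset hSU measure_ball_lt_top.ne) (by fun_prop) ?_
  filter_upwards [ae_restrict_mem hS] with x hx
  have := abs_coord_mk2_le (hSU hx)
  have h2 := abs_sub_abs_le_abs_sub (x 0) z
  rw [Real.norm_eq_abs]; linarith

lemma integral_symmMain {z s ρ : ℝ} (hz : 0 < z) (hs : 0 < s) (hρ : ρ ≤ z / 2)
    {S : Set Plane} (hS : MeasurableSet S) (hSU : S ⊆ Metric.ball (mk2 z 0) ρ) :
    IntegrableOn (fun p : Plane × Plane => symmMain z p.1 p.2) (S ×ˢ S) ∧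
    ∫ p in S ×ˢ S, symmMain z p.1 p.2 =
      (log (8 * z / s) - 2) * volume.real S * (∫ x in S, x 0) + (∫ p in S ×ˢ S, discKernel s p) +
      3 * volume.real S * ((∫ x in S, x 0) - z * volume.real S) := by
  have hfin : volume S ≠ ⊤ := measure_ne_top_of_subset hSU measure_ball_lt_top.ne
  have : IsFiniteMeasure (volume.restrict S) := ⟨by simpa using hfin.lt_top⟩
  have hx := integrableOn_coord hS hSU
  have ha1 : IntegrableOn (fun p : Plane × Plane => p.1 0) (S ×ˢ S) := by
    rw [IntegrableOn, Measure.volume_eq_prod, ← Measure.prod_restrict]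
    exact Integrable.comp_fst hx _
  have ha2 : IntegrableOn (fun p : Plane × Plane => p.2 0) (S ×ˢ S) := by
    rw [IntegrableOn, Measure.volume_eq_prod, ← Measure.prod_restrict]
    exact Integrable.comp_snd hx _
  have hd : IntegrableOn (discKernel s) (S ×ˢ S) := by
    have hu : ∀ x ∈ Metric.ball (mk2 z 0) ρ, |x 0| ≤ z + z := fun x hx => by
      have := abs_le.1 (abs_coord_mk2_le hx)
      rw [abs_le]; constructor <;> linarith
    by_cases hρ0 : 0 ≤ ρ
    · exact (integrableOn_of_abs_le_dist_inv (measurable_discKernel s)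
        (C := (z + z) * (s + 4 * ρ ^ 2 / s + 2 * ρ)) (by positivity)
        (fun x hx x' hx' hne => abs_discKernel_le hs hx hx' hne (hu x hx) (hu x' hx'))
        hS hSU).1.mono_set (Set.prod_mono subset_rfl hSU)
    · rw [Metric.ball_eq_empty.2 (by linarith)] at hSU
      simp [Set.subset_empty_iff.1 hSU]
  have hfinp : (volume : Measure (Plane × Plane)) (S ×ˢ S) ≠ ⊤ := by
    rw [Measure.volume_eq_prod, Measure.prod_prod]
    exact (ENNReal.mul_lt_top hfin.lt_top hfin.lt_top).ne
  have hc := integrableOn_const (C := 3 * z) hfinp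
  have e1 : ∫ p in S ×ˢ S, p.1 0 = volume.real S * ∫ x in S, x 0 := by
    rw [Measure.volume_eq_prod] at ha1 ⊢
    rw [setIntegral_prod _ ha1]
    simp [integral_const_mul]
  have e2 : ∫ p in S ×ˢ S, p.2 0 = volume.real S * ∫ x in S, x 0 := by
    rw [Measure.volume_eq_prod] at ha2 ⊢
    rw [setIntegral_prod _ ha2]
    simp
  have hav : IntegrableOn (fun p : Plane × Plane =>
      (log (8 * z / s) + 1) * ((p.1 0 + p.2 0) / 2)) (S ×ˢ S) :=
    ((ha1.add ha2).div_const 2).const_mul _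
  have hvol : (volume : Measure (Plane × Plane)).real (S ×ˢ S) = volume.real S ^ 2 := by
    rw [Measure.volume_eq_prod, measureReal_prod_prod, sq]
  simp_rw [symmMain_eq z s hz hs]
  refine ⟨(hav.add hd).sub hc, ?_⟩
  have i1 := integral_sub (hav.add hd) hc
  simp only [Pi.add_apply] at i1
  rw [i1, integral_add hav hd, integral_const_mul, integral_div, integral_add ha1 ha2, e1, e2,
    setIntegral_const, hvol, smul_eq_mul]
  ring

lemma integral_HkerDeriv {c l u ρ : ℝ} {z : Plane} (hl : 0 < l) (hρ : ρ ≤ l)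
    (hU : ∀ x ∈ Metric.ball z ρ, l ≤ x 0 ∧ x 0 ≤ u) {S : Set Plane} (hS : MeasurableSet S)
    (hSU : S ⊆ Metric.ball z ρ) :
    IntegrableOn (fun p : Plane × Plane => HkerDeriv c p.1 p.2) (S ×ˢ S) ∧
    ∫ x in S, ∫ x' in S, fderiv ℝ (fun y => Hker c y x') x (EuclideanSpace.single 0 1) =
      ∫ p in S ×ˢ S, HkerDeriv c p.1 p.2 := by
  obtain ⟨C, hC⟩ := abs_HkerDeriv_le c (u := u) hl
  have hint : IntegrableOn (fun p : Plane × Plane => HkerDeriv c p.1 p.2) (S ×ˢ S) := by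
    refine (integrableOn_of_abs_le_dist_inv (measurable_HkerDeriv c) (C := max C 0)
      (le_max_right _ _) (fun x hx x' hx' hne => ?_) hS hSU).1.mono_set
      (Set.prod_mono subset_rfl hSU)
    have hdl : dist x x' ≤ 2 * l := by
      have := dist_triangle_right x x' z
      linarith [Metric.mem_ball.1 hx, Metric.mem_ball.1 hx']
    refine (hC x x' (hU x hx).1 (hU x hx).2 (hU x' hx').1 (hU x' hx').2 hne hdl).trans ?_
    gcongr
    exact le_max_left _ _
  refine ⟨hint, ?_⟩
  rw [Measure.volume_eq_prod] at hint ⊢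
  rw [setIntegral_prod _ hint]
  refine setIntegral_congr_fun hS fun x hx => ?_
  refine setIntegral_congr_ae hS ?_
  filter_upwards [compl_mem_ae_iff.2 (measure_singleton x)] with x' hne hx'
  exact fderiv_Hker c (hl.trans_le (hU x (hSU hx)).1) (hl.trans_le (hU x' (hSU hx')).1)
    fun h => hne h.symm

lemma integral_HkerDeriv_expansion {δ M : ℝ} (hδ : 0 < δ) (hM : 0 < M) : ∃ C > 0,
    ∀ ε : ℝ, 0 < ε → ε ≤ exp (-1) → M * ε ≤ δ / 2 → ∀ z : ℝ, δ ≤ z → z ≤ 1 / δ →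
    ∀ S : Set Plane, MeasurableSet S → S ⊆ Metric.ball (mk2 z 0) (M * ε) →
    |(∫ x in S, ∫ x' in S, fderiv ℝ (fun y => Hker z y x') x (EuclideanSpace.single 0 1)) -
      1 / (4 * π) * ∫ p in S ×ˢ S, symmMain z p.1 p.2| ≤ C * (ε ^ 6 * log (1 / ε)) := by
  obtain ⟨C, hC, h⟩ := symm_HkerDeriv_expansion hδ hM
  refine ⟨C * (π ^ 2 * M ^ 4 + 4 * π ^ 2 * M ^ 3), by positivity, ?_⟩
  intro ε hε hε1 hMε z hz1 hz2 S hS hSU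
  have hlog : 1 ≤ log (1 / ε) := by
    rw [one_div, log_inv, le_neg, ← log_exp (-1)]
    exact log_le_log hε hε1
  have hfin : volume S ≠ ⊤ := measure_ne_top_of_subset hSU measure_ball_lt_top.ne
  have hm0 : 0 ≤ volume.real S := measureReal_nonneg
  have hm : volume.real S ≤ π * (M * ε) ^ 2 := by
    rw [← volume_real_ball (mk2 z 0) (by positivity : 0 ≤ M * ε)]
    exact measureReal_mono hSU measure_ball_lt_top.ne
  have hU : ∀ x ∈ Metric.ball (mk2 z 0) (M * ε), δ / 2 ≤ x 0 ∧ x 0 ≤ 1 / δ + δ / 2 := by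
    intro x hx
    have := abs_le.1 (abs_coord_mk2_le hx)
    constructor <;> linarith
  obtain ⟨hK, hKe⟩ := integral_HkerDeriv (c := z) (by positivity : 0 < δ / 2) hMε hU hS hSU
  have hKs : IntegrableOn (fun p : Plane × Plane => HkerDeriv z p.2 p.1) (S ×ˢ S) := by
    have := (Measure.measurePreserving_swap (μ := (volume : Measure Plane))
      (ν := (volume : Measure Plane))).integrableOn_comp_preimage
      MeasurableEquiv.prodComm.measurableEmbedding
      (f := fun p => HkerDeriv z p.1 p.2) (s := S ×ˢ S) |>.2 hK
    rwa [Set.preimage_swap_prod] at this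
  have hsw := setIntegral_prod_self_swap S (fun p => HkerDeriv z p.1 p.2)
  have hsym : ∫ p in S ×ˢ S, HkerDeriv z p.1 p.2 =
      ∫ p in S ×ˢ S, (HkerDeriv z p.1 p.2 + HkerDeriv z p.2 p.1) / 2 := by
    rw [integral_div, integral_add hK hKs]
    simp only at hsw
    rw [hsw]; ring
  have hmain := (integral_symmMain (by linarith) one_pos (by linarith) hS hSU).1
  obtain ⟨hd1, hd2⟩ := integrable_dist_inv_prod hS hSU
  have hd1' := hd1.mono_set (Set.prod_mono (subset_refl S) hSU)
  have hd3 : ∫ p in S ×ˢ S, (dist p.1 p.2)⁻¹ ≤ 4 * π * (M * ε) * volume.real S :=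
    (setIntegral_mono_set hd1 (Eventually.of_forall fun p => by positivity)
      (Set.prod_mono (subset_refl S) hSU).eventuallyLE).trans hd2
  have hfinp : (volume : Measure (Plane × Plane)) (S ×ˢ S) ≠ ⊤ := by
    rw [Measure.volume_eq_prod, Measure.prod_prod]
    exact (ENNReal.mul_lt_top hfin.lt_top hfin.lt_top).ne
  have hvol : (volume : Measure (Plane × Plane)).real (S ×ˢ S) = volume.real S ^ 2 := by
    rw [Measure.volume_eq_prod, measureReal_prod_prod, sq]
  have hconst := integrableOn_const (C := log (1 / ε)) hfinp
  have hsymi : IntegrableOn (fun p : Plane × Plane =>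
      (HkerDeriv z p.1 p.2 + HkerDeriv z p.2 p.1) / 2) (S ×ˢ S) := (hK.add hKs).div_const 2
  rw [hKe, hsym, ← integral_const_mul, ← integral_sub hsymi (hmain.const_mul _)]
  have hbi : IntegrableOn (fun p : Plane × Plane =>
      C * (ε ^ 2 * (log (1 / ε) + ε * (dist p.1 p.2)⁻¹))) (S ×ˢ S) :=
    ((hconst.add (hd1'.const_mul ε)).const_mul (ε ^ 2)).const_mul C
  calc _ ≤ ∫ p in S ×ˢ S, |(HkerDeriv z p.1 p.2 + HkerDeriv z p.2 p.1) / 2 -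
        1 / (4 * π) * symmMain z p.1 p.2| := abs_integral_le_integral_abs
    _ ≤ ∫ p in S ×ˢ S, C * (ε ^ 2 * (log (1 / ε) + ε * (dist p.1 p.2)⁻¹)) := by
        refine integral_mono_ae (hsymi.sub (hmain.const_mul _)).abs hbi ?_
        filter_upwards [ae_restrict_mem (hS.prod hS), ae_restrict_of_ae ae_fst_ne_snd]
          with p hp hne
        exact h ε hε hε1 hMε z hz1 hz2 p.1 (hSU hp.1) p.2 (hSU hp.2) hne
    _ = C * (ε ^ 2 * (log (1 / ε) * volume.real S ^ 2 +
          ε * ∫ p in S ×ˢ S, (dist p.1 p.2)⁻¹)) := by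
        rw [integral_const_mul, integral_const_mul, integral_add hconst (hd1'.const_mul ε),
          integral_const_mul, setIntegral_const, hvol, smul_eq_mul]
        ring
    _ ≤ C * (ε ^ 2 * (log (1 / ε) * (π * (M * ε) ^ 2) ^ 2 +
          log (1 / ε) * (ε * (4 * π * (M * ε) * (π * (M * ε) ^ 2))))) := by
        have h4 : 0 ≤ ε * (4 * π * (M * ε) * (π * (M * ε) ^ 2)) := by positivity
        have h5 : ε * ∫ p in S ×ˢ S, (dist p.1 p.2)⁻¹ ≤
            ε * (4 * π * (M * ε) * (π * (M * ε) ^ 2)) := by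
          gcongr
          exact hd3.trans (by gcongr)
        have h6 := le_mul_of_one_le_left h4 hlog
        refine mul_le_mul_of_nonneg_left (mul_le_mul_of_nonneg_left
          (add_le_add ?_ (h5.trans h6)) (by positivity)) hC.le
        gcongr
    _ = _ := by ring

lemma setIntegral_coord_sub_ball (z s : ℝ) :
    ∫ x in Metric.ball (mk2 z 0) s, (x 0 - z) = 0 := by
  set c := mk2 z 0 with hc
  have hc0 : c 0 = z := mk2_zero z 0
  have h := (Measure.measurePreserving_sub_left volume (c + c)).setIntegral_preimage_emb
    (MeasurableEquiv.subLeft (c + c)).measurableEmbedding (fun x : Plane => x 0 - z)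
    (Metric.ball c s)
  have hpre : (fun x => c + c - x) ⁻¹' Metric.ball c s = Metric.ball c s := by
    ext y
    show (c + c) - y ∈ Metric.ball c s ↔ y ∈ Metric.ball c s
    rw [mem_ball_iff_norm, mem_ball_iff_norm', add_sub_right_comm, add_sub_cancel_right]
  rw [hpre] at h
  have hpt : (fun x : Plane => (c + c - x) 0 - z) = fun x : Plane => -(x 0 - z) := by
    ext x
    simp [hc0]; ring
  rw [hpt, integral_neg] at h
  linarith

lemma abs_setIntegral_coord_sub_le {z s ρ : ℝ} {S : Set Plane} (hS : MeasurableSet S)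
    (hSU : S ⊆ Metric.ball (mk2 z 0) ρ) (hs : s ≤ ρ) :
    |(∫ x in S, x 0) - z * volume.real S| ≤
      ρ * volume.real (symmDiff S (Metric.ball (mk2 z 0) s)) := by
  set B := Metric.ball (mk2 z 0) s
  have hB : MeasurableSet B := Metric.isOpen_ball.measurableSet
  have hBU : B ⊆ Metric.ball (mk2 z 0) ρ := Metric.ball_subset_ball hs
  have hSBU : S ∪ B ⊆ Metric.ball (mk2 z 0) ρ := Set.union_subset hSU hBU
  have hfin : volume S ≠ ⊤ := measure_ne_top_of_subset hSU measure_ball_lt_top.ne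
  have hDU : symmDiff S B ⊆ Metric.ball (mk2 z 0) ρ := by
    rintro x (hx | hx)
    exacts [hSU hx.1, hBU hx.1]
  have hDfin : volume (symmDiff S B) ≠ ⊤ := measure_ne_top_of_subset hDU measure_ball_lt_top.ne
  have hi : IntegrableOn (fun x : Plane => x 0 - z) (S ∪ B) :=
    (integrableOn_coord (hS.union hB) hSBU).sub (integrableOn_const
      (measure_ne_top_of_subset hSBU measure_ball_lt_top.ne))
  have h1 := abs_setIntegral_sub_le hS hB hi
  rw [setIntegral_coord_sub_ball, sub_zero, integral_sub (integrableOn_coord hS hSU)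
    (integrableOn_const hfin), setIntegral_const, smul_eq_mul, mul_comm] at h1
  refine h1.trans ?_
  have hc : IntegrableOn (fun _ : Plane => ρ) (symmDiff S B) := integrableOn_const hDfin
  calc _ ≤ ∫ x in symmDiff S B, ρ :=
        setIntegral_mono_on (hi.mono_set (by
          rintro x (hx | hx)
          exacts [Or.inl hx.1, Or.inr hx.1])).abs hc (hS.symmDiff hB)
          fun x hx => abs_coord_mk2_le (hDU hx)
    _ = _ := by rw [setIntegral_const, smul_eq_mul, mul_comm]

lemma eps_mul_abs_log_le {δ c₁ c₂ ε z s : ℝ} (hδ : 0 < δ) (hc₁ : 0 < c₁) (hε : 0 < ε)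
    (hε1 : ε ≤ 1) (hz1 : δ ≤ z) (hz2 : z ≤ 1 / δ) (hs1 : c₁ * ε ≤ s) (hs2 : s ≤ c₂ * ε) :
    ε * |log (8 * z / s) - 2| ≤ 8 / (δ * c₁) + c₂ / (8 * δ) + 2 := by
  have hz : 0 < z := hδ.trans_le hz1
  have hs : 0 < s := (mul_pos hc₁ hε).trans_le hs1
  have hy : 0 < 8 * z / s := by positivity
  have h1 := log_le_sub_one_of_pos hy
  have h2 := one_sub_inv_le_log_of_pos hy
  have h3 : ε * (8 * z / s) ≤ 8 / (δ * c₁) := by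
    rw [mul_div_assoc', div_le_div_iff₀ hs (by positivity)]
    have : z * δ ≤ 1 := by rwa [le_div_iff₀ hδ] at hz2
    calc ε * (8 * z) * (δ * c₁) = 8 * (z * δ) * (c₁ * ε) := by ring
      _ ≤ 8 * 1 * s := by gcongr
      _ = _ := by ring
  have hc₂ : 0 < c₂ := pos_of_mul_pos_left (hs.trans_le hs2) hε.le
  have h4 : ε * (8 * z / s)⁻¹ ≤ c₂ / (8 * δ) := by
    rw [inv_div, mul_div_assoc', div_le_div_iff₀ (by positivity) (by positivity)]
    calc ε * s * (8 * δ) ≤ 1 * (c₂ * 1) * (8 * z) := by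
          gcongr
          exact hs2.trans (by gcongr)
      _ = _ := by ring
  have h5 : 0 < ε * (8 * z / s) := by positivity
  have h6 : 0 < ε * (8 * z / s)⁻¹ := by positivity
  rw [show ε * |log (8 * z / s) - 2| = |ε * (log (8 * z / s) - 2)| by
    rw [abs_mul, abs_of_pos hε], abs_le]
  constructor <;> nlinarith

/-- The algebra combining the error terms of the Pohozaev integral. -/
lemma abs_pohozaev_sub_le {δ M κ κ₀ z ε e C₁ D G I L γ w : ℝ} (hδ : 0 < δ) (hM : 0 < M)
    (hε : 0 < ε) (hε1 : ε ≤ 1) (hz1 : δ ≤ z) (hz2 : z ≤ 1 / δ) (hκ0 : 0 < κ) (hκu : κ ≤ κ₀)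
    (he0 : 0 ≤ e) (hC₁ : 0 ≤ C₁) (hD0 : 0 ≤ D) (hG0 : 0 ≤ G) (hL : ε * |L - 2| ≤ D)
    (hγ : |γ| ≤ G * (ε ^ 2 * e)) (hw : |w| ≤ M * ε * e) (hm0 : 0 ≤ (κ * ε ^ 2 - w) / z)
    (hm : (κ * ε ^ 2 - w) / z ≤ π * (M * ε) ^ 2)
    (hexp : |I - 1 / (4 * π) * ((L - 2) * ((κ * ε ^ 2 - w) / z) * (κ * ε ^ 2) +
      (γ + 3 / 4 * z * (κ * ε ^ 2 / z) ^ 2) + 3 * ((κ * ε ^ 2 - w) / z) * w)| ≤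
      C₁ * (ε ^ 6 * log (1 / ε))) :
    |z ^ 2 / ε ^ 4 * I - κ ^ 2 * z / (4 * π) * (L - 5 / 4)| ≤
      ((1 / δ) ^ 2 / (4 * π) * (D * M * κ₀ / δ + G + 3 * π * M ^ 3) + C₁ * (1 / δ) ^ 2) *
        (e / ε ^ 2 + ε ^ 2 * log (1 / ε)) := by
  have hz : 0 < z := hδ.trans_le hz1
  have hκ₀ : 0 < κ₀ := hκ0.trans_le hκu
  set P := (1 / δ) ^ 2 / (4 * π) * (D * M * κ₀ / δ + G + 3 * π * M ^ 3) with hP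
  have hP0 : 0 ≤ P := by positivity
  set m := (κ * ε ^ 2 - w) / z with hmdef
  set N := (L - 2) * m * (κ * ε ^ 2) + (γ + 3 / 4 * z * (κ * ε ^ 2 / z) ^ 2) + 3 * m * w with hN
  have hid : z ^ 2 / ε ^ 4 * I - κ ^ 2 * z / (4 * π) * (L - 5 / 4) =
      z ^ 2 / ε ^ 4 * (I - 1 / (4 * π) * N) +
      z ^ 2 / (4 * π) / ε ^ 4 * (-((L - 2) * w * (κ * ε ^ 2) / z) + γ + 3 * m * w) := by
    rw [hN, hmdef]
    field_simp
    ring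
  have hz2' : z ^ 2 ≤ (1 / δ) ^ 2 := by gcongr
  have hT1 : |z ^ 2 / ε ^ 4 * (I - 1 / (4 * π) * N)| ≤
      C₁ * (1 / δ) ^ 2 * (ε ^ 2 * log (1 / ε)) := by
    have hlog : 0 ≤ log (1 / ε) := log_nonneg (by rw [le_div_iff₀ hε]; linarith)
    rw [abs_mul, abs_of_nonneg (by positivity)]
    calc _ ≤ (1 / δ) ^ 2 / ε ^ 4 * (C₁ * (ε ^ 6 * log (1 / ε))) := by gcongr
      _ = _ := by field_simp
  have hR1 : |(L - 2) * w * (κ * ε ^ 2) / z| ≤ D * M * κ₀ / δ * (ε ^ 2 * e) := by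
    rw [abs_div, abs_mul, abs_mul, abs_of_pos hz, abs_of_pos (by positivity : 0 < κ * ε ^ 2)]
    calc |L - 2| * |w| * (κ * ε ^ 2) / z ≤ |L - 2| * (M * ε * e) * (κ₀ * ε ^ 2) / δ := by gcongr
      _ = (ε * |L - 2|) * M * κ₀ / δ * (ε ^ 2 * e) := by ring
      _ ≤ _ := by gcongr
  have hR2 : |3 * m * w| ≤ 3 * π * M ^ 3 * (ε ^ 2 * e) := by
    rw [abs_mul, abs_of_nonneg (by positivity)]
    calc 3 * m * |w| ≤ 3 * (π * (M * ε) ^ 2) * (M * ε * e) := by gcongr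
      _ = 3 * π * M ^ 3 * (ε ^ 2 * e) * ε := by ring
      _ ≤ _ := mul_le_of_le_one_right (by positivity) hε1
  have hT2 : |z ^ 2 / (4 * π) / ε ^ 4 * (-((L - 2) * w * (κ * ε ^ 2) / z) + γ + 3 * m * w)| ≤
      P * (e / ε ^ 2) := by
    rw [abs_mul, abs_of_nonneg (by positivity)]
    have hsum : |-((L - 2) * w * (κ * ε ^ 2) / z) + γ + 3 * m * w| ≤
        (D * M * κ₀ / δ + G + 3 * π * M ^ 3) * (ε ^ 2 * e) := by
      refine (abs_add_three _ _ _).trans ?_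
      rw [abs_neg]
      linarith
    calc _ ≤ (1 / δ) ^ 2 / (4 * π) / ε ^ 4 *
          ((D * M * κ₀ / δ + G + 3 * π * M ^ 3) * (ε ^ 2 * e)) := by gcongr
      _ = _ := by rw [hP]; field_simp
  rw [hid]
  have hlog : 0 ≤ ε ^ 2 * log (1 / ε) :=
    mul_nonneg (by positivity) (log_nonneg (by rw [le_div_iff₀ hε]; linarith))
  have he2 : 0 ≤ e / ε ^ 2 := by positivity
  calc _ ≤ C₁ * (1 / δ) ^ 2 * (ε ^ 2 * log (1 / ε)) + P * (e / ε ^ 2) :=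
        (abs_add_le _ _).trans (by linarith)
    _ ≤ _ := by
        have : 0 ≤ C₁ * (1 / δ) ^ 2 := by positivity
        nlinarith [mul_nonneg this he2, mul_nonneg hP0 hlog]

/-- **Volume Pohozaev term coming from the regular part** (Lemma C.4). For `A ⊆ B_{Rε}(z)`
with circulation `κ ∈ [κ₁, κ₀]` differing from the disc `B_{s₀}(z)` by measure `e ≤ Kε`,
`(z₁²/ε⁴) ∬_{A×A} ∂_{x₁}H_{z₁}(x,x') = (κ²z₁/4π)(ln(8z₁/s₀) − 5/4)` up to
`C(e/ε² + ε² ln(1/ε))`. -/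
theorem pohozaev_volume_regular_part (δ₀ κ₁ κ₀ R K : ℝ)
    (hδ₀ : 0 < δ₀) (hκ₁ : 0 < κ₁) (hκ : κ₁ ≤ κ₀) (hR : 0 < R) (hK : 0 < K) :
    ∃ C > (0 : ℝ), ∃ ε₀ > (0 : ℝ), ∀ ε ∈ Set.Ioc (0 : ℝ) ε₀,
      ∀ z₁ : ℝ, δ₀ ≤ z₁ → z₁ ≤ 1 / δ₀ →
      ∀ A : Set Plane, MeasurableSet A → A ⊆ Metric.ball (mk2 z₁ 0) (R * ε) →
      ∀ κ : ℝ, κ = (∫ x in A, x 0) / ε ^ 2 → κ₁ ≤ κ → κ ≤ κ₀ →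
      ∀ s₀ : ℝ, s₀ = ε * Real.sqrt (κ / (π * z₁)) →
      ∀ e : ℝ, e = (volume (symmDiff A (Metric.ball (mk2 z₁ 0) s₀))).toReal → e ≤ K * ε →
        |z₁ ^ 2 / ε ^ 4 *
              (∫ x in A, ∫ x' in A,
                fderiv ℝ (fun y => Hker z₁ y x') x (EuclideanSpace.single 0 1))
            - κ ^ 2 * z₁ / (4 * π) * (Real.log (8 * z₁ / s₀) - 5 / 4)|
          ≤ C * (e / ε ^ 2 + ε ^ 2 * Real.log (1 / ε)) := by
  set c₁ := √(κ₁ * δ₀ / π) with hc₁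
  set c₂ := √(κ₀ / (π * δ₀)) with hc₂
  have hκ₀ : 0 < κ₀ := hκ₁.trans_le hκ
  have hc₁0 : 0 < c₁ := Real.sqrt_pos.2 (by positivity)
  have hc₂0 : 0 < c₂ := Real.sqrt_pos.2 (by positivity)
  set M := R + c₂ with hMdef
  have hM : 0 < M := by positivity
  obtain ⟨C₁, hC₁, hexp⟩ := integral_HkerDeriv_expansion hδ₀ hM
  set D := 8 / (δ₀ * c₁) + c₂ / (8 * δ₀) + 2 with hD
  set G := 2 * ((1 / δ₀ + δ₀) * (c₂ + 4 * M ^ 2 / c₁ + 2 * M)) * (4 * π * M) with hG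
  have hD0 : 0 < D := by positivity
  have hG0 : 0 < G := by positivity
  refine ⟨(1 / δ₀) ^ 2 / (4 * π) * (D * M * κ₀ / δ₀ + G + 3 * π * M ^ 3) + C₁ * (1 / δ₀) ^ 2,
    by positivity, min (exp (-1)) (δ₀ / (2 * M)),
    lt_min (exp_pos _) (by positivity), ?_⟩
  rintro ε ⟨hε, hεle⟩ z hz1 hz2 A hA hAR κ hκA hκl hκu s hs e he -
  have hεe : ε ≤ exp (-1) := hεle.trans (min_le_left _ _)
  have hε1 : ε ≤ 1 := hεe.trans (exp_le_one_iff.2 (by norm_num))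
  have hMε : M * ε ≤ δ₀ / 2 := by
    have := hεle.trans (min_le_right _ _)
    rw [le_div_iff₀ (by positivity)] at this
    linarith
  have hz : 0 < z := hδ₀.trans_le hz1
  have hκ0 : 0 < κ := hκ₁.trans_le hκl
  have hzδ : z * δ₀ ≤ 1 := by rwa [le_div_iff₀ hδ₀] at hz2
  have hs1 : c₁ * ε ≤ s := by
    rw [hs, mul_comm]
    gcongr
    rw [hc₁]
    apply Real.sqrt_le_sqrt
    rw [div_le_div_iff₀ (by positivity) (by positivity)]
    calc κ₁ * δ₀ * (π * z) = κ₁ * π * (z * δ₀) := by ring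
      _ ≤ κ * π * 1 := by gcongr
      _ = _ := by ring
  have hs2 : s ≤ c₂ * ε := by
    rw [hs, mul_comm]
    gcongr
    rw [hc₂]
    apply Real.sqrt_le_sqrt
    gcongr
  have hs0 : 0 < s := (mul_pos hc₁0 hε).trans_le hs1
  have hsM : s ≤ M * ε := hs2.trans (by gcongr; rw [hMdef]; linarith)
  have hAU : A ⊆ Metric.ball (mk2 z 0) (M * ε) :=
    hAR.trans (Metric.ball_subset_ball (by gcongr; rw [hMdef]; linarith))
  have hB : MeasurableSet (Metric.ball (mk2 z 0) s) := Metric.isOpen_ball.measurableSet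
  have hBU : Metric.ball (mk2 z 0) s ⊆ Metric.ball (mk2 z 0) (M * ε) :=
    Metric.ball_subset_ball hsM
  have he0 : 0 ≤ e := he ▸ ENNReal.toReal_nonneg
  have hF : ∫ x in A, x 0 = κ * ε ^ 2 := by rw [hκA]; field_simp
  have hdisc : π * s ^ 2 = κ * ε ^ 2 / z := by
    rw [hs, mul_pow, Real.sq_sqrt (by positivity)]
    field_simp
  have hu : ∀ x ∈ Metric.ball (mk2 z 0) (M * ε), |x 0| ≤ 1 / δ₀ + δ₀ := fun x hx => by
    have := abs_le.1 (abs_coord_mk2_le hx)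
    have := one_div_pos.2 hδ₀
    rw [abs_le]; constructor <;> linarith
  have hw := abs_setIntegral_coord_sub_le hA hAU hsM
  have hγ := abs_setIntegral_prod_sub_le (measurable_discKernel s)
    (C := (1 / δ₀ + δ₀) * (s + 4 * (M * ε) ^ 2 / s + 2 * (M * ε))) (by positivity)
    (fun x hx x' hx' hne => abs_discKernel_le hs0 hx hx' hne (hu x hx) (hu x' hx'))
    hA hAU hB hBU
  rw [integral_discKernel_ball _ hs0, mk2_zero, hdisc, Measure.real, ← he] at hγ
  rw [hF, Measure.real, Measure.real, ← he] at hw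
  have hexpA := hexp ε hε hεe hMε z hz1 hz2 A hA hAU
  have hS := (integral_symmMain hz hs0 (by linarith) hA hAU).2
  rw [hF, Measure.real] at hS
  rw [hS] at hexpA
  have hm : (volume A).toReal ≤ π * (M * ε) ^ 2 := by
    rw [← volume_real_ball (mk2 z 0) (by positivity : 0 ≤ M * ε)]
    exact measureReal_mono hAU measure_ball_lt_top.ne
  have hm0 : 0 ≤ (volume A).toReal := ENNReal.toReal_nonneg
  have hL := eps_mul_abs_log_le hδ₀ hc₁0 hε hε1 hz1 hz2 hs1 hs2
  rw [← hD] at hL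
  have hγ' : |(∫ p in A ×ˢ A, discKernel s p) - 3 / 4 * z * (κ * ε ^ 2 / z) ^ 2| ≤
      G * (ε ^ 2 * e) := by
    refine hγ.trans ?_
    have h1 : 4 * (M * ε) ^ 2 / s ≤ 4 * M ^ 2 / c₁ * ε := by
      rw [div_mul_eq_mul_div, div_le_div_iff₀ hs0 hc₁0]
      calc 4 * (M * ε) ^ 2 * c₁ = 4 * M ^ 2 * ε * (c₁ * ε) := by ring
        _ ≤ 4 * M ^ 2 * ε * s := by gcongr
    calc _ ≤ 2 * ((1 / δ₀ + δ₀) * (c₂ * ε + 4 * M ^ 2 / c₁ * ε + 2 * (M * ε))) *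
          (4 * π * (M * ε) * e) := by gcongr
      _ = _ := by rw [hG]; ring
  generalize (∫ x in A, ∫ x' in A,
    fderiv ℝ (fun y => Hker z y x') x (EuclideanSpace.single 0 1)) = I at hexpA ⊢
  generalize (∫ p in A ×ˢ A, discKernel s p) = Γ at hexpA hγ'
  generalize (volume A).toReal = m at hexpA hm hm0 hw
  generalize log (8 * z / s) = L at hexpA hL ⊢
  obtain ⟨γ, rfl⟩ : ∃ γ, Γ = γ + 3 / 4 * z * (κ * ε ^ 2 / z) ^ 2 := ⟨_, (sub_add_cancel _ _).symm⟩
  rw [add_sub_cancel_right] at hγ'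
  obtain ⟨w, rfl⟩ : ∃ w, m = (κ * ε ^ 2 - w) / z := ⟨κ * ε ^ 2 - z * m, by field_simp; ring⟩
  have hwe : κ * ε ^ 2 - z * ((κ * ε ^ 2 - w) / z) = w := by field_simp; ring
  rw [hwe] at hw hexpA
  exact abs_pohozaev_sub_le hδ₀ hM hε hε1 hz1 hz2 hκ0 hκu he0 hC₁.le hD0.le hG0.le hL hγ' hw hm0 hm
    hexpA
end
end

section
/- (Positivity and strict monotonicity of the axisymmetric Green kernel in the vertical separation.) For a, b > 0 define I_{a,b}(t) := ∫_{−π}^{π} cosθ · [t + a² + b² − 2ab cosθ]^{−1/2} dθ, which is a well-defined finite integral whenever t + (a−b)² > 0. Then for all 0 ≤ t₁ < t₂ with t₁ + (a−b)² > 0 one has I_{a,b}(t₁) > I_{a,b}(t₂) > 0. In particular, for fixed x₁, x₁' > 0, the kernel G_*(x,x') = (x₁ x₁'²/(4π)) I_{x₁,x₁'}((x₂−x₂')²) is positive and strictly decreasing as a function of (x₂ − x₂')². -/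
open MeasureTheory Real Filter
open scoped RealInnerProductSpace

noncomputable section

/-- A strictly increasing function of `cos θ` correlates positively with `cos θ` on a period. -/
theorem integral_cos_mul_comp_cos_pos {f : ℝ → ℝ} (hf : ContinuousOn f (Set.Icc (-1) 1))
    (hmono : StrictMonoOn f (Set.Icc (-1) 1)) :
    0 < ∫ θ in (-π)..π, Real.cos θ * f (Real.cos θ) := by
  have hmem : ∀ θ : ℝ, Real.cos θ ∈ Set.Icc (-1 : ℝ) 1 := Real.cos_mem_Icc
  have h0 : (0 : ℝ) ∈ Set.Icc (-1 : ℝ) 1 := by norm_num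
  have hc : Continuous fun θ => f (Real.cos θ) :=
    hf.comp_continuous Real.continuous_cos hmem
  have hsub : ∫ θ in (-π)..π, Real.cos θ * f (Real.cos θ)
      = ∫ θ in (-π)..π, Real.cos θ * (f (Real.cos θ) - f 0) := by
    have i₁ : Continuous fun θ => Real.cos θ * f (Real.cos θ) := Real.continuous_cos.mul hc
    have i₂ : Continuous fun θ => Real.cos θ * f 0 := Real.continuous_cos.mul continuous_const
    simp only [mul_sub]
    rw [intervalIntegral.integral_sub (i₁.intervalIntegrable _ _) (i₂.intervalIntegrable _ _),
      intervalIntegral.integral_mul_const, integral_cos]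
    simp
  rw [hsub]
  refine intervalIntegral.integral_pos (by linarith [Real.pi_pos])
    (Real.continuous_cos.mul (hc.sub continuous_const)).continuousOn (fun θ _ => ?_)
    ⟨0, ⟨by linarith [Real.pi_pos], Real.pi_pos.le⟩, ?_⟩
  · rcases le_total 0 (Real.cos θ) with h | h
    · exact mul_nonneg h (sub_nonneg.2 (hmono.monotoneOn h0 (hmem θ) h))
    · exact mul_nonneg_of_nonpos_of_nonpos h
        (sub_nonpos.2 (hmono.monotoneOn (hmem θ) h0 h))
  · simpa using hmono h0 (by norm_num : (1 : ℝ) ∈ Set.Icc (-1 : ℝ) 1) one_pos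

theorem axisymmetric_radicand_pos {a b t c : ℝ} (ha : 0 < a) (hb : 0 < b)
    (hpos : 0 < t + (a - b) ^ 2) (hc : c ≤ 1) :
    0 < t + a ^ 2 + b ^ 2 - 2 * a * b * c := by
  nlinarith [mul_nonneg (mul_pos ha hb).le (sub_nonneg.2 hc)]

theorem continuousOn_inv_sqrt_axisymmetric_radicand {a b t : ℝ} (ha : 0 < a) (hb : 0 < b)
    (hpos : 0 < t + (a - b) ^ 2) :
    ContinuousOn (fun c => (Real.sqrt (t + a ^ 2 + b ^ 2 - 2 * a * b * c))⁻¹)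
      (Set.Icc (-1) 1) :=
  ContinuousOn.inv₀ (by fun_prop) fun _ hc =>
    (Real.sqrt_pos.2 (axisymmetric_radicand_pos ha hb hpos hc.2)).ne'

theorem integral_cos_div_sqrt_pos {a b t : ℝ} (ha : 0 < a) (hb : 0 < b)
    (hpos : 0 < t + (a - b) ^ 2) :
    0 < ∫ θ in (-π)..π,
      Real.cos θ / Real.sqrt (t + a ^ 2 + b ^ 2 - 2 * a * b * Real.cos θ) := by
  simp only [div_eq_mul_inv]
  refine integral_cos_mul_comp_cos_pos
    (continuousOn_inv_sqrt_axisymmetric_radicand ha hb hpos) fun c _ d hd hcd => ?_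
  have hd' := axisymmetric_radicand_pos ha hb hpos hd.2
  exact inv_strictAnti₀ (Real.sqrt_pos.2 hd') (Real.sqrt_lt_sqrt hd'.le
    (by nlinarith [mul_pos (mul_pos ha hb) (sub_pos.2 hcd)]))

/-- The increments of `s ↦ 1 / √s` over a step `h` strictly decrease in absolute value. -/
theorem inv_sqrt_sub_inv_sqrt_add_lt {h r s : ℝ} (hh : 0 < h) (hr : 0 < r) (hrs : r < s) :
    (Real.sqrt s)⁻¹ - (Real.sqrt (s + h))⁻¹ < (Real.sqrt r)⁻¹ - (Real.sqrt (r + h))⁻¹ := by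
  have key : ∀ x : ℝ, 0 < x → (Real.sqrt x)⁻¹ - (Real.sqrt (x + h))⁻¹
      = h / (Real.sqrt x * Real.sqrt (x + h) * (Real.sqrt x + Real.sqrt (x + h))) := by
    intro x hx
    have h1 : 0 < Real.sqrt x := Real.sqrt_pos.2 hx
    have h2 : 0 < Real.sqrt (x + h) := Real.sqrt_pos.2 (by linarith)
    have e1 := Real.sq_sqrt hx.le
    have e2 := Real.sq_sqrt (by linarith : 0 ≤ x + h)
    field_simp
    linarith
  have h1 : 0 < Real.sqrt r := Real.sqrt_pos.2 hr
  have h2 : 0 < Real.sqrt (r + h) := Real.sqrt_pos.2 (by linarith)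
  have h3 : Real.sqrt r < Real.sqrt s := Real.sqrt_lt_sqrt hr.le hrs
  have h4 : Real.sqrt (r + h) < Real.sqrt (s + h) :=
    Real.sqrt_lt_sqrt (by linarith) (by linarith)
  rw [key r hr, key s (hr.trans hrs)]
  exact div_lt_div_of_pos_left hh (by positivity) (by gcongr)

theorem integral_cos_div_sqrt_lt {a b t₁ t₂ : ℝ} (ha : 0 < a) (hb : 0 < b)
    (ht : t₁ < t₂) (hpos : 0 < t₁ + (a - b) ^ 2) :
    (∫ θ in (-π)..π,
        Real.cos θ / Real.sqrt (t₂ + a ^ 2 + b ^ 2 - 2 * a * b * Real.cos θ))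
      < ∫ θ in (-π)..π,
          Real.cos θ / Real.sqrt (t₁ + a ^ 2 + b ^ 2 - 2 * a * b * Real.cos θ) := by
  have c₁ := continuousOn_inv_sqrt_axisymmetric_radicand ha hb hpos
  have c₂ := continuousOn_inv_sqrt_axisymmetric_radicand (t := t₂) ha hb (by linarith)
  have i₁ : Continuous fun θ => Real.cos θ *
      (Real.sqrt (t₁ + a ^ 2 + b ^ 2 - 2 * a * b * Real.cos θ))⁻¹ :=
    Real.continuous_cos.mul (c₁.comp_continuous Real.continuous_cos Real.cos_mem_Icc)
  have i₂ : Continuous fun θ => Real.cos θ *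
      (Real.sqrt (t₂ + a ^ 2 + b ^ 2 - 2 * a * b * Real.cos θ))⁻¹ :=
    Real.continuous_cos.mul (c₂.comp_continuous Real.continuous_cos Real.cos_mem_Icc)
  simp only [div_eq_mul_inv]
  rw [← sub_pos, ← intervalIntegral.integral_sub (i₁.intervalIntegrable _ _)
    (i₂.intervalIntegrable _ _)]
  simp only [← mul_sub]
  refine integral_cos_mul_comp_cos_pos (c₁.sub c₂) fun c _ d hd hcd => ?_
  have h := inv_sqrt_sub_inv_sqrt_add_lt (sub_pos.2 ht)
    (axisymmetric_radicand_pos ha hb hpos hd.2)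
    (s := t₁ + a ^ 2 + b ^ 2 - 2 * a * b * c)
    (by nlinarith [mul_pos (mul_pos ha hb) (sub_pos.2 hcd)])
  have e : ∀ x : ℝ, t₁ + a ^ 2 + b ^ 2 - 2 * a * b * x + (t₂ - t₁)
      = t₂ + a ^ 2 + b ^ 2 - 2 * a * b * x := fun x => by ring
  simpa only [e, Pi.sub_apply] using h

theorem Gstar_pos {x x' : Plane} (hx : 0 < x 0) (hx' : 0 < x' 0) (hne : x ≠ x') :
    0 < Gstar x x' := by
  refine mul_pos (by positivity) (integral_cos_div_sqrt_pos hx hx' ?_)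
  by_contra hle
  have h1 : (x 1 - x' 1) ^ 2 = 0 := by nlinarith [sq_nonneg (x 1 - x' 1), sq_nonneg (x 0 - x' 0)]
  have h0 : (x 0 - x' 0) ^ 2 = 0 := by nlinarith [sq_nonneg (x 1 - x' 1), sq_nonneg (x 0 - x' 0)]
  refine hne (PiLp.ext fun i => ?_)
  fin_cases i
  · exact sub_eq_zero.1 (pow_eq_zero_iff two_ne_zero |>.1 h0)
  · exact sub_eq_zero.1 (pow_eq_zero_iff two_ne_zero |>.1 h1)

/-- **Positivity and strict monotonicity of the axisymmetric Green kernel in the vertical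
separation.** The integral `I_{a,b}(t) = ∫_{−π}^{π} cosθ [t + a² + b² − 2ab cosθ]^{−1/2} dθ`
is positive and strictly decreasing in `t ≥ 0` (as long as `t + (a−b)² > 0`); in particular
the kernel `G_*` is positive off the diagonal of the half plane. -/
theorem axisymmetric_kernel_monotone (a b : ℝ) (ha : 0 < a) (hb : 0 < b)
    (t₁ t₂ : ℝ) (ht₁ : 0 ≤ t₁) (ht : t₁ < t₂) (hpos : 0 < t₁ + (a - b) ^ 2) :
    (0 < ∫ θ in (-π)..π,
        Real.cos θ / Real.sqrt (t₂ + a ^ 2 + b ^ 2 - 2 * a * b * Real.cos θ)) ∧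
    ((∫ θ in (-π)..π,
        Real.cos θ / Real.sqrt (t₂ + a ^ 2 + b ^ 2 - 2 * a * b * Real.cos θ))
      < ∫ θ in (-π)..π,
          Real.cos θ / Real.sqrt (t₁ + a ^ 2 + b ^ 2 - 2 * a * b * Real.cos θ)) ∧
    (∀ x x' : Plane, 0 < x 0 → 0 < x' 0 → x ≠ x' → 0 < Gstar x x') := by
  exact ⟨integral_cos_div_sqrt_pos ha hb (by linarith), integral_cos_div_sqrt_lt ha hb ht hpos,
    fun _ _ hx hx' hne => Gstar_pos hx hx' hne⟩
end
end

section
/- (Quasi-Lipschitz regularity of the regular part of the Green function.) Let z = (z₁, 0) with z₁ > 0. The function x ↦ G_*(x, z) − z₁² G(x, z), defined on Π \ {z}, extends to a continuous function H(·, z) on all of Π; and for every compact set K ⊂ Π there exists a constant C = C(K, z) such that for all distinct x⁽¹⁾, x⁽²⁾ ∈ K: |H(x⁽¹⁾, z) − H(x⁽²⁾, z)| ≤ C |x⁽¹⁾ − x⁽²⁾| (1 + |ln |x⁽¹⁾ − x⁽²⁾||). -/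
open MeasureTheory Real Filter
open scoped RealInnerProductSpace

noncomputable section

/-- `f` is quasi-Lipschitz on `K`: it has modulus of continuity `t (1 + |ln t|)` there. -/
def QuasiLipschitzOn {E : Type*} [SeminormedAddCommGroup E] (f : E → ℝ) (K : Set E) : Prop :=
  ∃ C, 0 ≤ C ∧ ∀ x ∈ K, ∀ y ∈ K, |f x - f y| ≤ C * ‖x - y‖ * (1 + |Real.log ‖x - y‖|)

namespace QuasiLipschitzOn

section Algebra

variable {E : Type*} [SeminormedAddCommGroup E] {f g : E → ℝ} {K : Set E}

theorem of_lipschitz {C : ℝ} (hC : 0 ≤ C)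
    (h : ∀ x ∈ K, ∀ y ∈ K, |f x - f y| ≤ C * ‖x - y‖) : QuasiLipschitzOn f K := by
  refine ⟨C, hC, fun x hx y hy => (h x hx y hy).trans ?_⟩
  exact le_mul_of_one_le_right (by positivity) (by simp)

theorem add (hf : QuasiLipschitzOn f K) (hg : QuasiLipschitzOn g K) :
    QuasiLipschitzOn (fun x => f x + g x) K := by
  obtain ⟨C, hC, h⟩ := hf
  obtain ⟨D, hD, h'⟩ := hg
  refine ⟨C + D, by positivity, fun x hx y hy => ?_⟩
  calc |f x + g x - (f y + g y)| = |(f x - f y) + (g x - g y)| := by ring_nf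
    _ ≤ |f x - f y| + |g x - g y| := abs_add_le _ _
    _ ≤ _ := add_le_add (h x hx y hy) (h' x hx y hy)
    _ = _ := by ring

theorem continuousOn (hf : QuasiLipschitzOn f K) : ContinuousOn f K := by
  obtain ⟨C, -, h⟩ := hf
  intro x hx
  have hlim : Tendsto (fun y => C * ‖y - x‖ * (1 + |Real.log ‖y - x‖|)) (nhdsWithin x K)
      (nhds 0) := by
    have hcont : Continuous fun y : E =>
        C * (‖y - x‖ + |‖y - x‖ * Real.log ‖y - x‖|) := by
      have : Continuous fun y : E => ‖y - x‖ * Real.log ‖y - x‖ :=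
        Real.continuous_mul_log.comp (by fun_prop)
      fun_prop
    have := (hcont.tendsto x).mono_left (nhdsWithin_le_nhds (s := K))
    simp only [sub_self, norm_zero, zero_mul, abs_zero, add_zero, mul_zero] at this
    refine this.congr fun y => ?_
    rw [abs_mul, abs_of_nonneg (norm_nonneg _)]
    ring
  refine tendsto_iff_norm_sub_tendsto_zero.2 (squeeze_zero' (Eventually.of_forall fun _ =>
    norm_nonneg _) ?_ hlim)
  filter_upwards [self_mem_nhdsWithin] with y hy using h y hy x hx

theorem mul (hK : IsCompact K) (hf : QuasiLipschitzOn f K) (hg : QuasiLipschitzOn g K) :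
    QuasiLipschitzOn (fun x => f x * g x) K := by
  obtain ⟨A, hA⟩ := hK.exists_bound_of_continuousOn hf.continuousOn
  obtain ⟨B, hB⟩ := hK.exists_bound_of_continuousOn hg.continuousOn
  obtain ⟨C, hC, h⟩ := hf
  obtain ⟨D, hD, h'⟩ := hg
  refine ⟨|A| * D + |B| * C, by positivity, fun x hx y hy => ?_⟩
  have hAx : |f x| ≤ |A| := (hA x hx).trans (le_abs_self _)
  have hBy : |g y| ≤ |B| := (hB y hy).trans (le_abs_self _)
  calc |f x * g x - f y * g y| = |f x * (g x - g y) + g y * (f x - f y)| := by ring_nf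
    _ ≤ |f x * (g x - g y)| + |g y * (f x - f y)| := abs_add_le _ _
    _ = |f x| * |g x - g y| + |g y| * |f x - f y| := by rw [abs_mul, abs_mul]
    _ ≤ |A| * (D * ‖x - y‖ * (1 + |Real.log ‖x - y‖|))
        + |B| * (C * ‖x - y‖ * (1 + |Real.log ‖x - y‖|)) := by
      gcongr
      · exact h' x hx y hy
      · exact h x hx y hy
    _ = _ := by ring

end Algebra

theorem of_contDiffAt {E : Type*} [NormedAddCommGroup E] [NormedSpace ℝ E] {f : E → ℝ}
    {K : Set E} (hK : IsCompact K) (hf : ∀ x ∈ K, ContDiffAt ℝ 1 f x) :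
    QuasiLipschitzOn f K := by
  have hloc : LocallyLipschitzOn K f := fun x hx => by
    obtain ⟨C, t, ht, h⟩ := (hf x hx).exists_lipschitzOnWith
    exact ⟨C, t, nhdsWithin_le_nhds ht, h⟩
  obtain ⟨C, hC⟩ := hloc.exists_lipschitzOnWith_of_compact hK
  refine of_lipschitz C.2 fun x hx y hy => ?_
  simpa [dist_eq_norm] using hC.dist_le_mul x hx y hy

end QuasiLipschitzOn

theorem mul_abs_log_sub_log_le {r s : ℝ} (hr : 0 ≤ r) (hrs : r ≤ s) :
    r * |Real.log s - Real.log r| ≤ s - r := by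
  rcases hr.eq_or_lt with rfl | hr
  · simpa using hrs
  have hs : 0 < s := hr.trans_le hrs
  rw [abs_of_nonneg (sub_nonneg.2 (Real.log_le_log hr hrs)), ← Real.log_div hs.ne' hr.ne']
  calc r * Real.log (s / r) ≤ r * (s / r - 1) := by
        gcongr
        exact Real.log_le_sub_one_of_pos (by positivity)
    _ = s - r := by field_simp

/-- A linear coordinate times the logarithm of the norm is quasi-Lipschitz on bounded sets. -/
theorem quasiLipschitzOn_coord_mul_log_norm (p : Plane) {K : Set Plane}
    (hK : Bornology.IsBounded K) :
    QuasiLipschitzOn (fun x => (x 0 - p 0) * Real.log ‖x - p‖) K := by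
  obtain ⟨M, hM1, hM⟩ : ∃ M : ℝ, 1 ≤ M ∧ ∀ x ∈ K, ‖x - p‖ ≤ M := by
    obtain ⟨R, hR⟩ := hK.subset_closedBall p
    refine ⟨max 1 R, le_max_left _ _, fun x hx => ?_⟩
    have := hR hx
    rw [Metric.mem_closedBall, dist_eq_norm] at this
    exact this.trans (le_max_right _ _)
  have hlM : 0 ≤ Real.log M := Real.log_nonneg hM1
  have hl2 : 0 ≤ Real.log 2 := Real.log_nonneg one_le_two
  have hcoord : ∀ v : Plane, |v 0| ≤ ‖v‖ := fun v => by
    simpa using PiLp.norm_apply_le v 0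
  have key : ∀ x ∈ K, ∀ y ∈ K, ‖x - p‖ ≤ ‖y - p‖ →
      |(x 0 - p 0) * Real.log ‖x - p‖ - (y 0 - p 0) * Real.log ‖y - p‖|
        ≤ (Real.log M + Real.log 2 + 1) * ‖x - y‖ * (1 + |Real.log ‖x - y‖|) := by
    intro x hx y hy hle
    rcases eq_or_ne x y with rfl | hne
    · simp
    have ht : 0 < ‖x - y‖ := norm_pos_iff.2 (sub_ne_zero.2 hne)
    have htri : ‖x - y‖ ≤ ‖x - p‖ + ‖y - p‖ := by
      simpa using norm_sub_le (x - p) (y - p)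
    have hdiff : ‖y - p‖ - ‖x - p‖ ≤ ‖x - y‖ := by
      have := norm_sub_norm_le (y - p) (x - p)
      rw [sub_sub_sub_cancel_right, norm_sub_rev y x] at this
      exact this
    have hlog := mul_abs_log_sub_log_le (norm_nonneg _) hle
    have hx0 := hcoord (x - p)
    have hxy0 := hcoord (x - y)
    simp only [PiLp.sub_apply] at hx0 hxy0
    have hyM := hM y hy
    generalize ‖x - y‖ = t at *
    generalize ‖x - p‖ = r at *
    generalize ‖y - p‖ = s at *
    have hs : 0 < s := by linarith
    have hup : Real.log s ≤ Real.log M := Real.log_le_log hs hyM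
    have hlo : Real.log t ≤ Real.log 2 + Real.log s := by
      rw [← Real.log_mul two_ne_zero hs.ne']
      exact Real.log_le_log ht (by linarith)
    have hlogs : |Real.log s| ≤ Real.log M + Real.log 2 + |Real.log t| := by
      rw [abs_le]
      constructor <;> linarith [neg_abs_le (Real.log t), abs_nonneg (Real.log t)]
    calc |(x 0 - p 0) * Real.log r - (y 0 - p 0) * Real.log s|
        = |(x 0 - y 0) * Real.log s - (x 0 - p 0) * (Real.log s - Real.log r)| := by ring_nf
      _ ≤ |(x 0 - y 0) * Real.log s| + |(x 0 - p 0) * (Real.log s - Real.log r)| := abs_sub _ _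
      _ = |x 0 - y 0| * |Real.log s| + |x 0 - p 0| * |Real.log s - Real.log r| := by
        rw [abs_mul, abs_mul]
      _ ≤ t * (Real.log M + Real.log 2 + |Real.log t|) + r * |Real.log s - Real.log r| := by
        gcongr
      _ ≤ t * (Real.log M + Real.log 2 + |Real.log t|) + t := by gcongr; linarith
      _ ≤ _ := by
        have : 0 ≤ (Real.log M + Real.log 2) * (t * |Real.log t|) := by positivity
        linarith
  refine ⟨Real.log M + Real.log 2 + 1, by positivity, fun x hx y hy => ?_⟩
  rcases le_total ‖x - p‖ ‖y - p‖ with hle | hle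
  · exact key x hx y hy hle
  · rw [abs_sub_comm, norm_sub_rev]
    exact key y hy x hx hle

/-- The Euclidean distance in `ℝ³` from `(x₁, x₂, 0)` to `(z cos θ, 0, z sin θ)`. -/
def circleDist (z : ℝ) (x : Plane) (θ : ℝ) : ℝ :=
  Real.sqrt ((x 1) ^ 2 + (x 0) ^ 2 + z ^ 2 - 2 * x 0 * z * Real.cos θ)

theorem circleDist_eq_norm (z : ℝ) (x : Plane) (θ : ℝ) :
    circleDist z x θ = ‖(!₂[x 0 - z * Real.cos θ, x 1, z * Real.sin θ] :
      EuclideanSpace ℝ (Fin 3))‖ := by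
  rw [circleDist, EuclideanSpace.norm_eq]
  congr 1
  simp [Fin.sum_univ_three]
  linear_combination -(z ^ 2) * Real.sin_sq_add_cos_sq θ

theorem abs_circleDist_sub_le (z : ℝ) (x y : Plane) (θ : ℝ) :
    |circleDist z x θ - circleDist z y θ| ≤ ‖x - y‖ := by
  rw [circleDist_eq_norm, circleDist_eq_norm]
  refine (abs_norm_sub_norm_le _ _).trans (le_of_eq ?_)
  rw [EuclideanSpace.norm_eq, EuclideanSpace.norm_eq]
  simp [Fin.sum_univ_three, Fin.sum_univ_two]

theorem continuous_circleDist (z : ℝ) (x : Plane) : Continuous (circleDist z x) := by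
  unfold circleDist
  fun_prop

theorem circleDist_eq_half_angle (z : ℝ) (x : Plane) (θ : ℝ) :
    circleDist z x θ =
      Real.sqrt ((x 0 - z) ^ 2 + (x 1) ^ 2 + 4 * (x 0 * z) * Real.sin (θ / 2) ^ 2) := by
  rw [circleDist]
  congr 1
  have : Real.cos θ = 1 - 2 * Real.sin (θ / 2) ^ 2 := by
    conv_lhs => rw [show θ = 2 * (θ / 2) by ring, Real.cos_two_mul]
    linear_combination 2 * Real.sin_sq_add_cos_sq (θ / 2)
  rw [this]
  ring

theorem le_circleDist {z δ : ℝ} (hz : 0 ≤ z) {x : Plane} (hδ : 0 ≤ δ) (hx : δ ≤ x 0) (θ : ℝ) :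
    2 * Real.sqrt (δ * z) * |Real.sin (θ / 2)| ≤ circleDist z x θ := by
  rw [circleDist_eq_half_angle]
  refine Real.le_sqrt_of_sq_le ?_
  rw [mul_pow, mul_pow, sq_abs, Real.sq_sqrt (by positivity)]
  have : δ * z * Real.sin (θ / 2) ^ 2 ≤ x 0 * z * Real.sin (θ / 2) ^ 2 := by gcongr
  nlinarith [sq_nonneg (x 0 - z), sq_nonneg (x 1)]

theorem abs_cos_sub_cos_half_le {θ : ℝ} (hθ : |θ| ≤ π) :
    |Real.cos θ - Real.cos (θ / 2)| ≤ 2 * Real.sin (θ / 2) ^ 2 := by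
  rw [abs_le] at hθ
  have h0 : 0 ≤ Real.cos (θ / 2) := Real.cos_nonneg_of_mem_Icc ⟨by linarith, by linarith⟩
  have h1 := Real.cos_le_one (θ / 2)
  have h2 : Real.cos θ = 2 * Real.cos (θ / 2) ^ 2 - 1 := by
    rw [← Real.cos_two_mul]; ring_nf
  have h3 := Real.sin_sq_add_cos_sq (θ / 2)
  rw [abs_le]
  constructor <;> nlinarith

/-- The integral left over from `Gstar` after its logarithmically singular part is removed. -/
def regInt (z : ℝ) (x : Plane) : ℝ :=
  ∫ θ in (-π)..π, (Real.cos θ - Real.cos (θ / 2)) / circleDist z x θ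

theorem abs_le_pi_of_mem_uIoc {θ : ℝ} (hθ : θ ∈ Set.uIoc (-π) π) : |θ| ≤ π := by
  rw [Set.uIoc_of_le (by linarith [Real.pi_pos])] at hθ
  exact abs_le.2 ⟨hθ.1.le, hθ.2⟩

theorem intervalIntegrable_regInt {z : ℝ} (hz : 0 < z) {x : Plane} (hx : x ∈ halfPlane) :
    IntervalIntegrable (fun θ => (Real.cos θ - Real.cos (θ / 2)) / circleDist z x θ)
      volume (-π) π := by
  have hx : 0 < x 0 := hx
  refine IntervalIntegrable.mono_fun' (g := fun _ => 1 / Real.sqrt (x 0 * z))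
    intervalIntegrable_const ?_ ?_
  · have : Measurable (circleDist z x) := (continuous_circleDist z x).measurable
    exact Measurable.aestronglyMeasurable (by fun_prop)
  · refine (ae_restrict_iff' measurableSet_uIoc).2 (Eventually.of_forall fun θ hθ => ?_)
    have hn := abs_cos_sub_cos_half_le (abs_le_pi_of_mem_uIoc hθ)
    have hd := le_circleDist hz.le hx.le le_rfl θ
    have hs1 := Real.abs_sin_le_one (θ / 2)
    have hs0 := abs_nonneg (Real.sin (θ / 2))
    rw [← sq_abs (Real.sin (θ / 2))] at hn
    have hm : 0 < Real.sqrt (x 0 * z) := Real.sqrt_pos.2 (by positivity)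
    have hd0 : 0 ≤ circleDist z x θ := Real.sqrt_nonneg _
    beta_reduce
    rw [Real.norm_eq_abs, abs_div, abs_of_nonneg hd0]
    rcases hd0.eq_or_lt with h0 | h0
    · rw [← h0]; simp
    rw [div_le_div_iff₀ h0 hm]
    generalize |Real.sin (θ / 2)| = s at *
    have : s ^ 2 ≤ s := by nlinarith
    nlinarith

theorem abs_div_sub_div_le {n s m A B t : ℝ} (hm : 0 < m) (hs : 0 ≤ s) (hn : |n| ≤ 2 * s ^ 2)
    (hA : 2 * m * s ≤ A) (hB : 2 * m * s ≤ B) (hAB : |A - B| ≤ t) :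
    |n / A - n / B| ≤ t / (2 * m ^ 2) := by
  have ht : 0 ≤ t := (abs_nonneg _).trans hAB
  rcases hs.eq_or_lt with rfl | hs
  · have : n = 0 := by simpa using hn
    subst this
    simp only [zero_div, sub_self, abs_zero]
    positivity
  have hA0 : 0 < A := lt_of_lt_of_le (by positivity) hA
  have hB0 : 0 < B := lt_of_lt_of_le (by positivity) hB
  have hprod : (2 * m * s) * (2 * m * s) ≤ A * B := by gcongr
  have heq : n / A - n / B = n * (B - A) / (A * B) := by field_simp
  rw [heq, abs_div, abs_mul, abs_of_pos (mul_pos hA0 hB0), abs_sub_comm B A,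
    div_le_div_iff₀ (by positivity) (by positivity)]
  calc |n| * |A - B| * (2 * m ^ 2) ≤ 2 * s ^ 2 * t * (2 * m ^ 2) := by gcongr
    _ = t * ((2 * m * s) * (2 * m * s)) := by ring
    _ ≤ t * (A * B) := by gcongr

theorem abs_regInt_sub_le {z δ : ℝ} (hz : 0 < z) (hδ : 0 < δ) {x y : Plane} (hx : δ ≤ x 0)
    (hy : δ ≤ y 0) : |regInt z x - regInt z y| ≤ (π / (δ * z)) * ‖x - y‖ := by
  have hxp : x ∈ halfPlane := hδ.trans_le hx
  have hyp : y ∈ halfPlane := hδ.trans_le hy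
  rw [regInt, regInt, ← intervalIntegral.integral_sub (intervalIntegrable_regInt hz hxp)
    (intervalIntegrable_regInt hz hyp)]
  have hm : 0 < Real.sqrt (δ * z) := Real.sqrt_pos.2 (by positivity)
  refine (intervalIntegral.norm_integral_le_of_norm_le_const (E := ℝ)
    (C := ‖x - y‖ / (2 * (δ * z))) fun θ hθ => ?_).trans (le_of_eq ?_)
  · have hn := abs_cos_sub_cos_half_le (abs_le_pi_of_mem_uIoc hθ)
    rw [← sq_abs (Real.sin (θ / 2))] at hn
    have := abs_div_sub_div_le hm (abs_nonneg _) hn (le_circleDist hz.le hδ.le hx θ)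
      (le_circleDist hz.le hδ.le hy θ) (abs_circleDist_sub_le z x y θ)
    rwa [Real.sq_sqrt (by positivity)] at this
  · rw [abs_of_pos (by linarith [Real.pi_pos])]
    field_simp
    ring

theorem quasiLipschitzOn_regInt {z : ℝ} (hz : 0 < z) {K : Set Plane} (hK : K ⊆ halfPlane)
    (hKc : IsCompact K) : QuasiLipschitzOn (regInt z) K := by
  obtain ⟨δ, hδ, hδK⟩ : ∃ δ : ℝ, 0 < δ ∧ ∀ x ∈ K, δ ≤ x 0 := by
    have hc : ContinuousOn (fun x : Plane => x 0) K := by fun_prop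
    exact hKc.exists_forall_le' hc hK
  exact .of_lipschitz (by positivity) fun x hx y hy =>
    abs_regInt_sub_le hz hδ (hδK x hx) (hδK y hy)

theorem integral_cos_half_div_sqrt {m ρ : ℝ} (hm : 0 < m) (hρ : 0 < ρ) :
    ∫ θ in (-π)..π, Real.cos (θ / 2) / Real.sqrt (ρ ^ 2 + 4 * m ^ 2 * Real.sin (θ / 2) ^ 2) =
      2 / m * (Real.log (2 * m + Real.sqrt (ρ ^ 2 + 4 * m ^ 2)) - Real.log ρ) := by
  have hpos : ∀ θ : ℝ, 0 < ρ ^ 2 + 4 * m ^ 2 * Real.sin (θ / 2) ^ 2 := fun θ => by positivity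
  have hderiv : ∀ θ : ℝ, HasDerivAt
      (fun θ => 1 / m * Real.arsinh (2 * m / ρ * Real.sin (θ / 2)))
      (Real.cos (θ / 2) / Real.sqrt (ρ ^ 2 + 4 * m ^ 2 * Real.sin (θ / 2) ^ 2)) θ := by
    intro θ
    have h1 : HasDerivAt (fun θ : ℝ => 2 * m / ρ * Real.sin (θ / 2))
        (2 * m / ρ * (Real.cos (θ / 2) * (1 / 2))) θ :=
      (((hasDerivAt_id θ).div_const 2).sin).const_mul _
    refine (h1.arsinh.const_mul (1 / m)).congr_deriv ?_
    have : Real.sqrt (ρ ^ 2 + 4 * m ^ 2 * Real.sin (θ / 2) ^ 2) =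
        ρ * Real.sqrt (1 + (2 * m / ρ * Real.sin (θ / 2)) ^ 2) := by
      rw [← Real.sqrt_sq hρ.le, ← Real.sqrt_mul (sq_nonneg _), Real.sqrt_sq hρ.le]
      congr 1
      field_simp
      ring
    rw [this]
    have : 0 < Real.sqrt (1 + (2 * m / ρ * Real.sin (θ / 2)) ^ 2) :=
      Real.sqrt_pos.2 (by positivity)
    simp only [smul_eq_mul]
    field_simp
  rw [intervalIntegral.integral_eq_sub_of_hasDerivAt (fun θ _ => hderiv θ)
    (Continuous.intervalIntegrable (Continuous.div (by fun_prop) (by fun_prop)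
      fun θ => (Real.sqrt_pos.2 (hpos θ)).ne') _ _)]
  rw [neg_div, Real.sin_neg, Real.sin_pi_div_two, mul_neg, Real.arsinh_neg, mul_one,
    Real.arsinh]
  have : 2 * m / ρ + Real.sqrt (1 + (2 * m / ρ) ^ 2) =
      (2 * m + Real.sqrt (ρ ^ 2 + 4 * m ^ 2)) / ρ := by
    rw [show ρ ^ 2 + 4 * m ^ 2 = ρ ^ 2 * (1 + (2 * m / ρ) ^ 2) by field_simp; ring,
      Real.sqrt_mul (sq_nonneg _), Real.sqrt_sq hρ.le]
    field_simp
  rw [this, Real.log_div (by positivity) hρ.ne']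
  ring

theorem norm_sub_mk2 (x : Plane) (a b : ℝ) :
    ‖x - mk2 a b‖ = Real.sqrt ((x 0 - a) ^ 2 + (x 1 - b) ^ 2) := by
  rw [EuclideanSpace.norm_eq]
  simp [mk2, Fin.sum_univ_two]

theorem Gstar_eq_s18 {z : ℝ} (hz : 0 < z) {x : Plane} (hx : x ∈ halfPlane) (hne : x ≠ mk2 z 0) :
    Gstar x (mk2 z 0) = x 0 * z ^ 2 / (4 * π) * (regInt z x +
      2 / (Real.sqrt (x 0) * Real.sqrt z) *
        (Real.log (2 * (Real.sqrt (x 0) * Real.sqrt z) + Real.sqrt ((x 0 + z) ^ 2 + (x 1) ^ 2))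
          - Real.log ‖x - mk2 z 0‖)) := by
  have hx0 : 0 < x 0 := hx
  have hρ : 0 < ‖x - mk2 z 0‖ := norm_pos_iff.2 (sub_ne_zero.2 hne)
  have hρ2 : ‖x - mk2 z 0‖ ^ 2 = (x 0 - z) ^ 2 + (x 1) ^ 2 := by
    rw [norm_sub_mk2, Real.sq_sqrt (by positivity), sub_zero]
  have hm : 0 < Real.sqrt (x 0) * Real.sqrt z := by positivity
  have hm2 : (Real.sqrt (x 0) * Real.sqrt z) ^ 2 = x 0 * z := by
    rw [mul_pow, Real.sq_sqrt hx0.le, Real.sq_sqrt hz.le]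
  have hdist : ∀ θ, circleDist z x θ = Real.sqrt (‖x - mk2 z 0‖ ^ 2 +
      4 * (Real.sqrt (x 0) * Real.sqrt z) ^ 2 * Real.sin (θ / 2) ^ 2) := fun θ => by
    rw [hρ2, hm2, circleDist_eq_half_angle]
  have hσ : (x 0 + z) ^ 2 + (x 1) ^ 2 =
      ‖x - mk2 z 0‖ ^ 2 + 4 * (Real.sqrt (x 0) * Real.sqrt z) ^ 2 := by
    rw [hρ2, hm2]; ring
  have hpos : ∀ θ, circleDist z x θ ≠ 0 := fun θ => by
    rw [hdist]
    exact (Real.sqrt_pos.2 (by positivity)).ne'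
  have hint : IntervalIntegrable (fun θ => Real.cos (θ / 2) / circleDist z x θ)
      volume (-π) π :=
    ((Real.continuous_cos.comp (by fun_prop)).div (continuous_circleDist z x)
      hpos).intervalIntegrable _ _
  rw [hσ, ← integral_cos_half_div_sqrt hm hρ]
  simp only [← hdist]
  rw [regInt, ← intervalIntegral.integral_add (intervalIntegrable_regInt hz hx) hint]
  simp only [Gstar, mk2, WithLp.equiv_symm_apply, Matrix.cons_val_zero, Matrix.cons_val_one,
    sub_zero]
  congr 1
  refine intervalIntegral.integral_congr fun θ _ => ?_
  simp only [circleDist]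
  ring

theorem Gfun_eq {z : ℝ} (hz : 0 < z) {x : Plane} (hx : x ∈ halfPlane) (hne : x ≠ mk2 z 0) :
    Gfun x (mk2 z 0) = 1 / (4 * π) *
      (Real.log ((x 0 + z) ^ 2 + (x 1) ^ 2) - 2 * Real.log ‖x - mk2 z 0‖) := by
  have hx0 : 0 < x 0 := hx
  have hρ : 0 < ‖x - mk2 z 0‖ := norm_pos_iff.2 (sub_ne_zero.2 hne)
  have hρ2 : ‖x - mk2 z 0‖ ^ 2 = (x 0 - z) ^ 2 + (x 1) ^ 2 := by
    rw [norm_sub_mk2, Real.sq_sqrt (by positivity), sub_zero]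
  have hlog : Real.log ((x 0 - z) ^ 2 + (x 1) ^ 2) = 2 * Real.log ‖x - mk2 z 0‖ := by
    rw [← hρ2, Real.log_pow]; norm_num
  rw [← hlog, ← Real.log_div (by positivity) (by rw [← hρ2]; positivity)]
  simp [Gfun, mk2]

/-- The continuous extension of `Gstar · (z, 0) - z² Gfun · (z, 0)` to the half plane. -/
def regPart (z : ℝ) (x : Plane) : ℝ :=
  x 0 * z ^ 2 / (4 * π) * regInt z x
    + (z * Real.sqrt z / (2 * π) * Real.sqrt (x 0) *
        Real.log (2 * (Real.sqrt (x 0) * Real.sqrt z) + Real.sqrt ((x 0 + z) ^ 2 + (x 1) ^ 2))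
      - z ^ 2 / (4 * π) * Real.log ((x 0 + z) ^ 2 + (x 1) ^ 2))
    + -(z * Real.sqrt z / (2 * π)) / (Real.sqrt (x 0) + Real.sqrt z) *
        ((x 0 - (mk2 z 0 : Plane) 0) * Real.log ‖x - mk2 z 0‖)

theorem regPart_eq {z : ℝ} (hz : 0 < z) {x : Plane} (hx : x ∈ halfPlane) (hne : x ≠ mk2 z 0) :
    regPart z x = Gstar x (mk2 z 0) - z ^ 2 * Gfun x (mk2 z 0) := by
  have hx0 : 0 < x 0 := hx
  have hcoord : (mk2 z 0 : Plane) 0 = z := by simp [mk2]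
  rw [Gstar_eq_s18 hz hx hne, Gfun_eq hz hx hne, regPart, hcoord]
  obtain ⟨s, hs, hs2⟩ : ∃ s, 0 < s ∧ s ^ 2 = x 0 :=
    ⟨_, Real.sqrt_pos.2 hx0, Real.sq_sqrt hx0.le⟩
  obtain ⟨t, ht, ht2⟩ : ∃ t, 0 < t ∧ t ^ 2 = z := ⟨_, Real.sqrt_pos.2 hz, Real.sq_sqrt hz.le⟩
  have hπ := Real.pi_pos
  generalize regInt z x = R
  generalize Real.log ‖x - mk2 z 0‖ = l
  rw [← hs2, ← ht2, Real.sqrt_sq hs.le, Real.sqrt_sq ht.le]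
  generalize Real.log (2 * (s * t) + _) = L
  generalize Real.log _ = M
  have : s + t ≠ 0 := by positivity
  field_simp
  ring

theorem quasiLipschitzOn_regPart {z : ℝ} (hz : 0 < z) {K : Set Plane} (hK : K ⊆ halfPlane)
    (hKc : IsCompact K) : QuasiLipschitzOn (regPart z) K := by
  have hcoord : ∀ i : Fin 2, ContDiff ℝ 1 fun x : Plane => x i := fun i => by fun_prop
  have hsqrt : ∀ x ∈ K, ContDiffAt ℝ 1 (fun x : Plane => Real.sqrt (x 0)) x := fun x hx =>
    (hcoord 0).contDiffAt.sqrt (hK hx).ne'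
  have hpos : ∀ x ∈ K, 0 < Real.sqrt (x 0) := fun x hx => Real.sqrt_pos.2 (hK hx)
  have hz' : 0 < Real.sqrt z := Real.sqrt_pos.2 hz
  have hσpos : ∀ x ∈ K, 0 < (x 0 + z) ^ 2 + (x 1) ^ 2 := fun x hx => by
    have : 0 < x 0 := hK hx
    positivity
  have hσ : ContDiff ℝ 1 fun x : Plane => (x 0 + z) ^ 2 + (x 1) ^ 2 := by fun_prop
  refine ((QuasiLipschitzOn.of_contDiffAt hKc fun x hx => ?_).mul hKc
    (quasiLipschitzOn_regInt hz hK hKc)).add (QuasiLipschitzOn.of_contDiffAt hKc fun x hx => ?_)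
    |>.add ((QuasiLipschitzOn.of_contDiffAt hKc fun x hx => ?_).mul hKc
      (quasiLipschitzOn_coord_mul_log_norm (mk2 z 0) hKc.isBounded))
  · exact ContDiff.contDiffAt (by fun_prop)
  · refine ContDiffAt.sub (ContDiffAt.mul (contDiffAt_const.mul (hsqrt x hx)) ?_)
      (contDiffAt_const.mul (hσ.contDiffAt.log (hσpos x hx).ne'))
    refine ContDiffAt.log ((contDiffAt_const.mul ((hsqrt x hx).mul contDiffAt_const)).add
      (hσ.contDiffAt.sqrt (hσpos x hx).ne')) ?_
    have := hpos x hx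
    positivity
  · refine contDiffAt_const.div ((hsqrt x hx).add contDiffAt_const) ?_
    have := hpos x hx
    positivity

theorem continuousOn_regPart {z : ℝ} (hz : 0 < z) : ContinuousOn (regPart z) halfPlane := by
  have hopen : IsOpen halfPlane := isOpen_lt continuous_const (by fun_prop)
  intro x hx
  obtain ⟨K, hKc, hxK, hK⟩ := exists_compact_subset hopen hx
  exact ((quasiLipschitzOn_regPart hz hK hKc).continuousOn.continuousAt
    (mem_interior_iff_mem_nhds.1 hxK)).continuousWithinAt

/-- **Quasi-Lipschitz regularity of the regular part of the Green function.** For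
`z = (z₁, 0)` with `z₁ > 0`, the function `x ↦ G_*(x,z) − z₁² G(x,z)` extends to a
continuous function `H(·, z)` on the half plane which is quasi-Lipschitz on every compact
subset: `|H(x) − H(y)| ≤ C |x − y| (1 + |ln|x − y||)`. -/
theorem regular_part_quasi_lipschitz (z₁ : ℝ) (hz₁ : 0 < z₁) :
    ∃ H : Plane → ℝ, ContinuousOn H halfPlane ∧
      (∀ x ∈ halfPlane, x ≠ mk2 z₁ 0 →
        H x = Gstar x (mk2 z₁ 0) - z₁ ^ 2 * Gfun x (mk2 z₁ 0)) ∧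
      ∀ K : Set Plane, K ⊆ halfPlane → IsCompact K →
        ∃ C : ℝ, ∀ x ∈ K, ∀ y ∈ K, x ≠ y →
          |H x - H y| ≤ C * ‖x - y‖ * (1 + |Real.log ‖x - y‖|) := by
  refine ⟨regPart z₁, continuousOn_regPart hz₁, fun x hx hne => regPart_eq hz₁ hx hne,
    fun K hK hKc => ?_⟩
  obtain ⟨C, -, hC⟩ := quasiLipschitzOn_regPart hz₁ hK hKc
  exact ⟨C, fun x hx y hy _ => hC x hx y hy⟩
end
end

section
/- (Explicit Newtonian potential of the unit disc and of its first moment — the planar Rankine vortex formulas.) For every y = (y₁, y₂) ∈ ℝ²: (1/(2π)) ∫_{B₁(0)} ln(1/|y − y'|) dy' equals (1/4)(1 − |y|²) if |y| ≤ 1 and equals (1/2) ln(1/|y|) if |y| ≥ 1; and (1/(2π)) ∫_{B₁(0)} y₁' ln(1/|y − y'|) dy' equals y₁/4 − |y|² y₁/8 if |y| ≤ 1 and equals y₁/(8|y|²) if |y| ≥ 1. -/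
open MeasureTheory Real Filter
open scoped RealInnerProductSpace

noncomputable section

lemma integrableOn_polarCoord_target {f : ℂ → ℝ} (hf : Integrable f) :
    IntegrableOn (fun p : ℝ × ℝ => p.1 * f (Complex.polarCoord.symm p)) polarCoord.target := by
  have h1 : Integrable (fun p => f (Complex.measurableEquivRealProd.symm p)) :=
    (Complex.volume_preserving_equiv_real_prod.symm).integrable_comp_of_integrable hf
  have h2 : IntegrableOn (fun p => f (Complex.measurableEquivRealProd.symm p))
      (polarCoord.symm '' polarCoord.target) := h1.integrableOn
  rw [integrableOn_image_iff_integrableOn_abs_det_fderiv_smul volume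
    (polarCoord.open_target.measurableSet)
    (fun p _ => (hasFDerivAt_polarCoord_symm p).hasFDerivWithinAt) polarCoord.symm.injOn] at h2
  refine h2.congr_fun (fun p hp => ?_) polarCoord.open_target.measurableSet
  have : 0 < p.1 := hp.1
  simp only [det_fderivPolarCoordSymm, abs_of_pos this, smul_eq_mul,
    Complex.measurableEquivRealProd_symm_polarCoord_symm_apply]

lemma integral_angle_polarCoord_symm (f : ℂ → ℝ) (r : ℝ) :
    ∫ θ in Set.Ioo (-π) π, r * f (Complex.polarCoord.symm (r, θ))
      = 2 * π * (r * circleAverage f 0 r) := by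
  rw [circleAverage_eq_integral_add (-π),
    intervalIntegral.integral_comp_add_right (fun θ ↦ f (circleMap 0 r θ)),
    show 0 + -π = -π by ring, show 2 * π + -π = π by ring,
    intervalIntegral.integral_of_le (by linarith [pi_pos]), integral_Ioc_eq_integral_Ioo,
    integral_const_mul, smul_eq_mul]
  have : ∀ θ, Complex.polarCoord.symm (r, θ) = circleMap 0 r θ := by
    intro θ
    simp [circleMap, Complex.exp_mul_I]
  simp only [this]
  field_simp

lemma integrableOn_mul_circleAverage {f : ℂ → ℝ} (hf : Integrable f) :
    IntegrableOn (fun r => r * circleAverage f 0 r) (Set.Ioi 0) := by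
  have h := integrableOn_polarCoord_target hf
  rw [polarCoord_target, IntegrableOn, Measure.volume_eq_prod, ← Measure.prod_restrict] at h
  have h2 := h.integral_prod_left.const_mul (2 * π)⁻¹
  simp only [integral_angle_polarCoord_symm] at h2
  refine h2.congr (ae_of_all _ fun r => ?_)
  field_simp

lemma integral_eq_integral_circleAverage {f : ℂ → ℝ} (hf : Integrable f) :
    ∫ z, f z = 2 * π * ∫ r in Set.Ioi (0 : ℝ), r * circleAverage f 0 r := by
  have h := integrableOn_polarCoord_target hf
  rw [← Complex.integral_comp_polarCoord_symm]
  simp only [smul_eq_mul]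
  rw [polarCoord_target, Measure.volume_eq_prod] at h ⊢
  rw [setIntegral_prod _ h, ← integral_const_mul]
  simp only [integral_angle_polarCoord_symm]

lemma circleAverage_indicator_ball (f : ℂ → ℝ) {R r : ℝ} (hr : 0 < r) :
    r * circleAverage ((Metric.ball 0 R).indicator f) 0 r
      = (Set.Iio R).indicator (fun r => r * circleAverage f 0 r) r := by
  by_cases h : r < R
  · rw [Set.indicator_of_mem (by exact h)]
    congr 1
    apply circleAverage_congr_sphere
    intro z hz
    have hz' : ‖z‖ = r := by simpa [abs_of_pos hr] using hz
    exact Set.indicator_of_mem (by simpa [hz'] using h) _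
  · rw [Set.indicator_of_notMem (by exact h)]
    have : circleAverage ((Metric.ball 0 R).indicator f) 0 r = 0 := by
      refine circleAverage_const_on_circle fun z hz => ?_
      have hz' : ‖z‖ = r := by simpa [abs_of_pos hr] using hz
      exact Set.indicator_of_notMem (by simpa [hz'] using h) _
    rw [this, mul_zero]

lemma intervalIntegrable_mul_circleAverage {f : ℂ → ℝ} {R : ℝ} (hR : 0 ≤ R)
    (hf : IntegrableOn f (Metric.ball 0 R)) :
    IntervalIntegrable (fun r => r * circleAverage f 0 r) volume 0 R := by
  rw [intervalIntegrable_iff_integrableOn_Ioo_of_le hR]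
  have h := integrableOn_mul_circleAverage
    ((integrable_indicator_iff Metric.isOpen_ball.measurableSet).mpr hf)
  refine (h.mono_set Set.Ioo_subset_Ioi_self).congr_fun (fun r hr => ?_) measurableSet_Ioo
  simp only [circleAverage_indicator_ball f hr.1]
  exact Set.indicator_of_mem (by exact hr.2) _

/-- Integration over a disc in polar coordinates, through circle averages. -/
lemma setIntegral_ball_eq_integral_circleAverage {f : ℂ → ℝ} {R : ℝ} (hR : 0 ≤ R)
    (hf : IntegrableOn f (Metric.ball 0 R)) :
    ∫ z in Metric.ball 0 R, f z = 2 * π * ∫ r in 0..R, r * circleAverage f 0 r := by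
  have hm : MeasurableSet (Metric.ball (0 : ℂ) R) := Metric.isOpen_ball.measurableSet
  rw [← integral_indicator hm,
    integral_eq_integral_circleAverage ((integrable_indicator_iff hm).mpr hf),
    setIntegral_congr_fun measurableSet_Ioi
      (fun r hr => circleAverage_indicator_ball f (R := R) hr),
    setIntegral_indicator measurableSet_Iio, Set.Ioi_inter_Iio,
    intervalIntegral.integral_of_le hR, integral_Ioc_eq_integral_Ioo]

lemma integrableOn_log_norm_sub (a : ℂ) (R : ℝ) :
    IntegrableOn (fun z : ℂ => Real.log ‖z - a‖) (Metric.ball 0 R) := by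
  have h0 : IntegrableOn (fun z : ℂ => Real.log ‖z‖) (Metric.ball 0 (R + ‖a‖)) := by
    rw [integrableOn_fun_norm_addHaar volume (f := Real.log)]
    have hc : Continuous fun y : ℝ => y ^ (Module.finrank ℝ ℂ - 1) • Real.log y := by
      simpa [Complex.finrank_real_complex] using Real.continuous_mul_log
    exact (hc.integrableOn_Icc (a := 0) (b := R + ‖a‖)).mono_set Set.Ioo_subset_Icc_self
  have h1 := (measurePreserving_sub_right volume a).integrableOn_comp_preimage
    (measurableEmbedding_subRight a) (f := fun z : ℂ => Real.log ‖z‖)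
    (s := Metric.ball 0 (R + ‖a‖)) |>.mpr h0
  refine h1.mono_set fun z hz => ?_
  have hz' : ‖z‖ < R := by simpa using hz
  simpa using (norm_sub_le z a).trans_lt (by linarith)

lemma integrableOn_re_mul_log_norm_sub (a : ℂ) (R : ℝ) :
    IntegrableOn (fun z : ℂ => z.re * Real.log ‖z - a‖) (Metric.ball 0 R) := by
  refine (integrableOn_log_norm_sub a R).bdd_mul (c := R)
    Complex.continuous_re.aestronglyMeasurable ?_
  filter_upwards [ae_restrict_mem Metric.isOpen_ball.measurableSet] with z hz
  have hz' : ‖z‖ < R := by simpa using hz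
  exact (Complex.abs_re_le_norm z).trans hz'.le

lemma circleAverage_log_norm_sub_of_le {R : ℝ} {a : ℂ} (h : ‖a‖ ≤ |R|) :
    circleAverage (fun z : ℂ => Real.log ‖z - a‖) 0 R = Real.log R :=
  circleAverage_log_norm_sub_const_of_mem_closedBall (by simpa using h)

lemma circleAverage_log_norm_sub_of_ge {R : ℝ} {a : ℂ} (h0 : 0 < R) (h : R ≤ ‖a‖) :
    circleAverage (fun z : ℂ => Real.log ‖z - a‖) 0 R = Real.log ‖a‖ := by
  rw [circleAverage_log_norm_sub_const_eq_log_radius_add_posLog h0.ne', zero_sub, norm_neg,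
    Real.posLog_eq_log, Real.log_mul (by positivity) (by linarith), Real.log_inv]
  · ring
  · rw [abs_of_nonneg (by positivity), ← div_eq_inv_mul]
    exact (one_le_div h0).mpr h

lemma setIntegral_ball_log_norm_sub_of_ge {a : ℂ} (h : 1 ≤ ‖a‖) :
    ∫ z in Metric.ball (0 : ℂ) 1, Real.log ‖z - a‖ = π * Real.log ‖a‖ := by
  rw [setIntegral_ball_eq_integral_circleAverage zero_le_one (integrableOn_log_norm_sub a 1),
    intervalIntegral.integral_congr_Ioo_of_le (g := fun r => r * Real.log ‖a‖) zero_le_one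
      (fun r hr => by
        simp only [circleAverage_log_norm_sub_of_ge hr.1 (hr.2.le.trans h)])]
  simp
  ring

lemma integral_mul_log {s : ℝ} (hs : 0 ≤ s) (hs1 : s ≤ 1) :
    ∫ r in s..1, r * Real.log r = -(1 / 4) + s ^ 2 / 4 - s ^ 2 * Real.log s / 2 := by
  rw [intervalIntegral.integral_eq_sub_of_hasDerivAt_of_le
    (f := fun r => r * (r * Real.log r) / 2 - r ^ 2 / 4) hs1]
  · simp; ring
  · have := Real.continuous_mul_log
    fun_prop
  · intro x hx
    have hx0 : x ≠ 0 := (hs.trans_lt hx.1).ne'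
    have h := (((hasDerivAt_id x).mul ((hasDerivAt_id x).mul (Real.hasDerivAt_log hx0))).div_const
      2).sub (((hasDerivAt_id x).pow 2).div_const 4)
    refine h.congr_deriv ?_
    simp
    field_simp
    ring
  · exact Real.continuous_mul_log.intervalIntegrable _ _

lemma setIntegral_ball_log_norm_sub_of_le {a : ℂ} (h : ‖a‖ ≤ 1) :
    ∫ z in Metric.ball (0 : ℂ) 1, Real.log ‖z - a‖ = -(π / 2 * (1 - ‖a‖ ^ 2)) := by
  have hi := intervalIntegrable_mul_circleAverage zero_le_one (integrableOn_log_norm_sub a 1)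
  have hs : ‖a‖ ∈ Set.uIcc (0 : ℝ) 1 := by
    rw [Set.uIcc_of_le zero_le_one]; exact ⟨norm_nonneg a, h⟩
  rw [setIntegral_ball_eq_integral_circleAverage zero_le_one (integrableOn_log_norm_sub a 1),
    ← intervalIntegral.integral_add_adjacent_intervals
      (hi.mono_set (Set.uIcc_subset_uIcc_left hs)) (hi.mono_set (Set.uIcc_subset_uIcc_right hs)),
    intervalIntegral.integral_congr_Ioo_of_le (g := fun r => r * Real.log ‖a‖) (norm_nonneg a)
      (fun r hr => by simp only [circleAverage_log_norm_sub_of_ge hr.1 hr.2.le]),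
    intervalIntegral.integral_congr_Ioo_of_le (g := fun r => r * Real.log r) h
      (fun r hr => by
        simp only [circleAverage_log_norm_sub_of_le (hr.1.le.trans (le_abs_self r))]),
    integral_mul_log (norm_nonneg a) h]
  simp
  ring
lemma circleAverage_re_mul_log_norm_one_sub_mul {R : ℝ} {b : ℂ} (h : |R| * ‖b‖ < 1) :
    circleAverage (fun z : ℂ => z.re * Real.log ‖1 - b * z‖) 0 R = -(R ^ 2 * b.re / 2) := by
  rcases eq_or_ne R 0 with rfl | hR
  · simp
  have hsub : ∀ z ∈ Metric.closedBall (0 : ℂ) |R|, 1 - b * z ∈ Complex.slitPlane := by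
    intro z hz
    have hz' : ‖z‖ ≤ |R| := by simpa using hz
    have : ‖b * z‖ < 1 := by
      rw [norm_mul, mul_comm]
      exact (mul_le_mul_of_nonneg_right hz' (norm_nonneg b)).trans_lt h
    rw [sub_eq_add_neg]
    exact Complex.mem_slitPlane_of_norm_lt_one (by simpa using this)
  set f : ℂ → ℂ := fun z => Complex.log (1 - b * z) with hf
  have hfd : ∀ z ∈ Metric.closedBall (0 : ℂ) |R|, HasDerivAt f (-b / (1 - b * z)) z := by
    intro z hz
    have h1 : HasDerivAt (fun z : ℂ => 1 - b * z) (-b) z := by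
      simpa using ((hasDerivAt_id z).const_mul b).const_sub 1
    exact h1.clog (hsub z hz)
  set g : ℂ → ℂ := fun z => (z * f z + (R : ℂ) ^ 2 * dslope f 0 z) / 2 with hg
  have hfdiff : DifferentiableOn ℂ f (Metric.closedBall 0 |R|) :=
    fun z hz => (hfd z hz).differentiableAt.differentiableWithinAt
  have hgd : DifferentiableOn ℂ g (Metric.closedBall 0 |R|) := by
    have h0 : Metric.closedBall (0 : ℂ) |R| ∈ nhds 0 :=
      Metric.closedBall_mem_nhds _ (abs_pos.mpr hR)
    have := (Complex.differentiableOn_dslope h0).mpr hfdiff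
    exact ((differentiableOn_id.mul hfdiff).add (this.const_mul _)).div_const 2
  have hgc : DiffContOnCl ℂ g (Metric.ball 0 |R|) := by
    apply DifferentiableOn.diffContOnCl
    rwa [closure_ball _ (abs_pos.mpr hR).ne']
  have havg : circleAverage g 0 R = g 0 := hgc.circleAverage
  have hg0 : g 0 = -((R : ℂ) ^ 2 * b / 2) := by
    have : deriv f 0 = -b := by
      simpa using (hfd 0 (by simp)).deriv
    simp only [hg, dslope_same, this]
    ring
  have hci : CircleIntegrable g 0 R := by
    apply ContinuousOn.circleIntegrable'
    exact hgd.continuousOn.mono Metric.sphere_subset_closedBall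
  have hre := Complex.reCLM.circleAverage_comp_comm hci
  rw [havg, hg0] at hre
  have hval : Complex.reCLM (-((R : ℂ) ^ 2 * b / 2)) = -(R ^ 2 * b.re / 2) := by
    rw [show -((R : ℂ) ^ 2 * b / 2) = ((-(R ^ 2 / 2) : ℝ) : ℂ) * b by push_cast; ring]
    rw [Complex.reCLM_apply, Complex.re_ofReal_mul]
    ring
  rw [← hval, ← hre]
  apply circleAverage_congr_sphere
  intro z hz
  have hzn : ‖z‖ = |R| := by simpa using hz
  have hz0 : z ≠ 0 := by
    rw [← norm_pos_iff, hzn]; exact abs_pos.mpr hR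
  have hconj : (R : ℂ) ^ 2 = z * (starRingEnd ℂ) z := by
    rw [Complex.mul_conj, Complex.normSq_eq_norm_sq, hzn, sq_abs]; push_cast; rfl
  have hsl : dslope f 0 z = f z / z := by
    rw [dslope_of_ne _ hz0, slope_def_field]
    simp [hf]
  have hgz : g z = ((z.re : ℝ) : ℂ) * f z := by
    rw [Complex.re_eq_add_conj]
    simp only [hg, hsl, hconj]
    field_simp
  simp only [Function.comp, Complex.reCLM_apply, hgz, Complex.re_ofReal_mul, hf, Complex.log_re]

lemma circleAverage_re {R : ℝ} : circleAverage (fun z : ℂ => z.re) 0 R = 0 := by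
  have h : DiffContOnCl ℂ (fun z : ℂ => z) (Metric.ball 0 |R|) := differentiable_id.diffContOnCl
  have := Complex.reCLM.circleAverage_comp_comm (f := fun z : ℂ => z) (c := 0) (R := R)
    (continuous_id.continuousOn.circleIntegrable')
  rw [h.circleAverage] at this
  simpa [Function.comp_def] using this

lemma circleAverage_re_mul_const_add_log {R C : ℝ} {b : ℂ} (h : |R| * ‖b‖ < 1) :
    circleAverage (fun z : ℂ => z.re * (C + Real.log ‖1 - b * z‖)) 0 R
      = -(R ^ 2 * b.re / 2) := by
  have hne : ∀ z ∈ Metric.sphere (0 : ℂ) |R|, ‖1 - b * z‖ ≠ 0 := by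
    intro z hz h0
    have hz' : ‖z‖ = |R| := by simpa using hz
    have h1 : 1 = b * z := sub_eq_zero.mp (norm_eq_zero.mp h0)
    have : ‖b * z‖ < 1 := by rwa [norm_mul, mul_comm, hz']
    rw [← h1] at this
    simp at this
  simp only [mul_add]
  rw [circleAverage_fun_add, circleAverage_re_mul_log_norm_one_sub_mul h]
  · simp only [mul_comm _ C]
    have := circleAverage_fun_smul (a := C) (f := fun z : ℂ => z.re) (c := 0) (R := R)
    simp only [smul_eq_mul] at this
    rw [this, circleAverage_re]; simp
  · apply ContinuousOn.circleIntegrable'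
    fun_prop
  · apply ContinuousOn.circleIntegrable'
    exact Complex.continuous_re.continuousOn.mul
      (ContinuousOn.log (by fun_prop) hne)

lemma circleAverage_re_mul_log_norm_sub_of_lt {R : ℝ} {a : ℂ} (h : |R| < ‖a‖) :
    circleAverage (fun z : ℂ => z.re * Real.log ‖z - a‖) 0 R
      = -(R ^ 2 * a.re / (2 * ‖a‖ ^ 2)) := by
  have ha : 0 < ‖a‖ := (abs_nonneg R).trans_lt h
  have ha0 : a ≠ 0 := norm_pos_iff.mp ha
  have hb : |R| * ‖a⁻¹‖ < 1 := by
    rw [norm_inv, ← div_eq_mul_inv, div_lt_one ha]; exact h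
  have key := circleAverage_re_mul_const_add_log (C := Real.log ‖a‖) hb
  have hre : (a⁻¹).re = a.re / ‖a‖ ^ 2 := by
    rw [Complex.inv_re, Complex.normSq_eq_norm_sq]
  rw [hre] at key
  rw [show -(R ^ 2 * a.re / (2 * ‖a‖ ^ 2)) = -(R ^ 2 * (a.re / ‖a‖ ^ 2) / 2) by field_simp, ← key]
  apply circleAverage_congr_sphere
  intro z hz
  have hz' : ‖z‖ = |R| := by simpa using hz
  have hza : z - a ≠ 0 := by
    intro h0
    rw [sub_eq_zero.mp h0] at hz'
    linarith
  have : z - a = -(a * (1 - a⁻¹ * z)) := by field_simp; ring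
  have h1 : 1 - a⁻¹ * z ≠ 0 := by
    intro h0; rw [this, h0] at hza; simp at hza
  simp only [this, norm_neg, norm_mul]
  rw [Real.log_mul ha.ne' (norm_ne_zero_iff.mpr h1)]

lemma circleAverage_re_mul_log_norm_sub_of_gt {R : ℝ} {a : ℂ} (h : ‖a‖ < |R|) :
    circleAverage (fun z : ℂ => z.re * Real.log ‖z - a‖) 0 R = -(a.re / 2) := by
  have hR : 0 < |R| := (norm_nonneg a).trans_lt h
  have hR0 : R ≠ 0 := abs_pos.mp hR
  set b : ℂ := (((R ^ 2)⁻¹ : ℝ) : ℂ) * (starRingEnd ℂ) a with hbdef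
  have hbn : |R| * ‖b‖ < 1 := by
    rw [hbdef, norm_mul, Complex.norm_real, RCLike.norm_conj, norm_inv, norm_pow, Real.norm_eq_abs]
    rw [show |R| * ((|R| ^ 2)⁻¹ * ‖a‖) = ‖a‖ / |R| by field_simp]
    rwa [div_lt_one hR]
  have key := circleAverage_re_mul_const_add_log (C := Real.log |R|) hbn
  have hre : b.re = (R ^ 2)⁻¹ * a.re := by
    rw [hbdef, Complex.re_ofReal_mul, Complex.conj_re]
  rw [hre] at key
  rw [show -(a.re / 2) = -(R ^ 2 * ((R ^ 2)⁻¹ * a.re) / 2) by field_simp, ← key]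
  apply circleAverage_congr_sphere
  intro z hz
  have hz' : ‖z‖ = |R| := by simpa using hz
  have hz0 : z ≠ 0 := by rw [← norm_pos_iff, hz']; exact hR
  have hza : z - a ≠ 0 := by
    intro h0
    rw [sub_eq_zero.mp h0] at hz'
    linarith
  have hconj : z * (starRingEnd ℂ) z = (R : ℂ) ^ 2 := by
    rw [Complex.mul_conj, Complex.normSq_eq_norm_sq, hz', sq_abs]; push_cast; rfl
  have hRC : (R : ℂ) ≠ 0 := by exact_mod_cast hR0
  have h2 : z * (starRingEnd ℂ) (1 - b * z) = z - a := by
    have : z * (starRingEnd ℂ) (1 - b * z)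
        = z - ((R : ℂ) ^ 2)⁻¹ * a * (z * (starRingEnd ℂ) z) := by
      simp [hbdef]; ring
    rw [this, hconj]
    field_simp
  have h1 : 1 - b * z ≠ 0 := by
    intro h0; rw [← h2, h0] at hza; simp at hza
  simp only [← h2, norm_mul, RCLike.norm_conj, hz']
  rw [Real.log_mul hR.ne' (norm_ne_zero_iff.mpr h1)]

lemma setIntegral_ball_re_mul_log_norm_sub_of_ge {a : ℂ} (h : 1 ≤ ‖a‖) :
    ∫ z in Metric.ball (0 : ℂ) 1, z.re * Real.log ‖z - a‖ = -(π * a.re / (4 * ‖a‖ ^ 2)) := by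
  rw [setIntegral_ball_eq_integral_circleAverage zero_le_one (integrableOn_re_mul_log_norm_sub a 1),
    intervalIntegral.integral_congr_Ioo_of_le (g := fun r => r ^ 3 * -(a.re / (2 * ‖a‖ ^ 2)))
      zero_le_one (fun r hr => by
        simp only [circleAverage_re_mul_log_norm_sub_of_lt
          (show |r| < ‖a‖ by rw [abs_of_pos hr.1]; exact hr.2.trans_le h)]
        ring)]
  rw [intervalIntegral.integral_mul_const, integral_pow]
  norm_num
  ring

lemma setIntegral_ball_re_mul_log_norm_sub_of_le {a : ℂ} (h : ‖a‖ ≤ 1) :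
    ∫ z in Metric.ball (0 : ℂ) 1, z.re * Real.log ‖z - a‖
      = -(2 * π * (a.re / 4 - ‖a‖ ^ 2 * a.re / 8)) := by
  have hi := intervalIntegrable_mul_circleAverage zero_le_one (integrableOn_re_mul_log_norm_sub a 1)
  have hs : ‖a‖ ∈ Set.uIcc (0 : ℝ) 1 := by
    rw [Set.uIcc_of_le zero_le_one]; exact ⟨norm_nonneg a, h⟩
  rw [setIntegral_ball_eq_integral_circleAverage zero_le_one (integrableOn_re_mul_log_norm_sub a 1),
    ← intervalIntegral.integral_add_adjacent_intervals
      (hi.mono_set (Set.uIcc_subset_uIcc_left hs)) (hi.mono_set (Set.uIcc_subset_uIcc_right hs)),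
    intervalIntegral.integral_congr_Ioo_of_le (g := fun r => r ^ 3 * -(a.re / (2 * ‖a‖ ^ 2)))
      (norm_nonneg a) (fun r hr => by
        simp only [circleAverage_re_mul_log_norm_sub_of_lt
          (show |r| < ‖a‖ by rw [abs_of_pos hr.1]; exact hr.2)]
        ring),
    intervalIntegral.integral_congr_Ioo_of_le (g := fun r => r ^ 1 * -(a.re / 2)) h
      (fun r hr => by
        simp only [circleAverage_re_mul_log_norm_sub_of_gt (hr.1.trans_le (le_abs_self r))]
        ring),
    intervalIntegral.integral_mul_const, intervalIntegral.integral_mul_const, integral_pow,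
    integral_pow]
  rcases eq_or_ne ‖a‖ 0 with h0 | h0
  · simp [norm_eq_zero.mp h0]
  · norm_num
    field_simp
    ring

/-- Integrals over the unit disc of the plane, transferred to the complex plane. -/
lemma setIntegral_ball_plane (g : ℝ → ℝ → ℝ) (y : Plane) :
    ∃ a : ℂ, ‖a‖ = ‖y‖ ∧ a.re = y 0 ∧
      ∫ y' in Metric.ball (0 : Plane) 1, g (y' 0) ‖y - y'‖
        = ∫ z in Metric.ball (0 : ℂ) 1, g z.re ‖z - a‖ := by
  set e := Complex.orthonormalBasisOneI.repr with he
  have hre : ∀ x, (e.symm x).re = x 0 := fun x => by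
    rw [he, Complex.orthonormalBasisOneI_repr_symm_apply]; simp
  refine ⟨e.symm y, e.symm.norm_map y, hre y, ?_⟩
  rw [← e.symm.measurePreserving.setIntegral_preimage_emb
    e.symm.toHomeomorph.measurableEmbedding]
  have hb : e.symm ⁻¹' Metric.ball (0 : ℂ) 1 = Metric.ball (0 : Plane) 1 := by
    rw [e.symm.preimage_ball]; simp
  rw [hb]
  simp only [hre, ← map_sub, e.symm.norm_map, norm_sub_rev y]

/-- **Planar Rankine vortex formulas.** The logarithmic potential of the unit disc and of
its first moment: `(1/2π) ∫_{B₁(0)} ln(1/|y−y'|) dy'` equals `(1−|y|²)/4` for `|y| ≤ 1` and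
`(1/2) ln(1/|y|)` for `|y| ≥ 1`; and `(1/2π) ∫_{B₁(0)} y₁' ln(1/|y−y'|) dy'` equals
`y₁/4 − |y|² y₁/8` for `|y| ≤ 1` and `y₁/(8|y|²)` for `|y| ≥ 1`. -/
theorem rankine_vortex_formulas (y : Plane) :
    ((‖y‖ ≤ 1 →
        (1 / (2 * π)) * ∫ y' in Metric.ball (0 : Plane) 1, Real.log (1 / ‖y - y'‖)
          = (1 / 4) * (1 - ‖y‖ ^ 2)) ∧
      (1 ≤ ‖y‖ →
        (1 / (2 * π)) * ∫ y' in Metric.ball (0 : Plane) 1, Real.log (1 / ‖y - y'‖)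
          = (1 / 2) * Real.log (1 / ‖y‖))) ∧
    ((‖y‖ ≤ 1 →
        (1 / (2 * π)) * ∫ y' in Metric.ball (0 : Plane) 1, (y' 0) * Real.log (1 / ‖y - y'‖)
          = y 0 / 4 - ‖y‖ ^ 2 * y 0 / 8) ∧
      (1 ≤ ‖y‖ →
        (1 / (2 * π)) * ∫ y' in Metric.ball (0 : Plane) 1, (y' 0) * Real.log (1 / ‖y - y'‖)
          = y 0 / (8 * ‖y‖ ^ 2))) := by
  obtain ⟨a, han, har, h0⟩ := setIntegral_ball_plane (fun _ r => Real.log r) y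
  obtain ⟨b, hbn, hbr, h1⟩ := setIntegral_ball_plane (fun s r => s * Real.log r) y
  simp only [one_div, Real.log_inv, mul_neg, integral_neg]
  rw [h0, h1, ← hbr, ← hbn]
  refine ⟨⟨fun h => ?_, fun h => ?_⟩, fun h => ?_, fun h => ?_⟩
  · rw [setIntegral_ball_log_norm_sub_of_le (han.trans_le (hbn ▸ h)), han, hbn]
    field_simp
    ring
  · rw [setIntegral_ball_log_norm_sub_of_ge (h.trans_eq (hbn.trans han.symm)), han, hbn]
    field_simp
  · rw [setIntegral_ball_re_mul_log_norm_sub_of_le h]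
    field_simp
  · rw [setIntegral_ball_re_mul_log_norm_sub_of_ge h]
    have : ‖b‖ ≠ 0 := by linarith
    field_simp
    ring
end
end
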